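/- arXiv:1908.03969 — 4 statements merged into one kernel-verified Lean document; each statement's English description precedes it below -/
import Mathlib

section
/- For all real numbers N > 0 and 0 < r₁ < r₂, the Lebesgue measure (volume) of the region R(N, r₁, r₂) in ℝ³ equals (4N/3)·(log r₂ − log r₁)². -/
/-- The region `R(N, r₁, r₂) ⊆ ℝ³`: triples `(g₁, g₂, g₃)` with `g₁g₂g₃ ≠ 0`,
`|g₁g₂g₃| < N`, and `r₁ ≤ |g₃/g₁| ≤ |g₃/g₂| < r₂`. -/
def regionR (N r₁ r₂ : ℝ) : Set (ℝ × ℝ × ℝ) :=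
  {g | g.1 * g.2.1 * g.2.2 ≠ 0 ∧ |g.1 * g.2.1 * g.2.2| < N ∧
    r₁ ≤ |g.2.2 / g.1| ∧ |g.2.2 / g.1| ≤ |g.2.2 / g.2.1| ∧ |g.2.2 / g.2.1| < r₂}

open MeasureTheory Set
open scoped Pointwise

lemma ftc_aux (a b : ℝ) (hab : a ≤ b) (F f : ℝ → ℝ)
    (hF : ∀ x ∈ Icc a b, HasDerivAt F (f x) x) (hf : ContinuousOn f (Icc a b))
    (h0 : ∀ x ∈ Icc a b, 0 ≤ f x) :
    ∫⁻ x in Ioc a b, ENNReal.ofReal (f x) = ENNReal.ofReal (F b - F a) := by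
  have hi : IntervalIntegrable f volume a b := by
    apply ContinuousOn.intervalIntegrable
    rwa [uIcc_of_le hab]
  rw [← intervalIntegral.integral_eq_sub_of_hasDerivAt (f := F) (f' := f) _ hi,
    intervalIntegral.integral_of_le hab]
  · rw [ofReal_integral_eq_lintegral_ofReal]
    · exact (intervalIntegrable_iff_integrableOn_Ioc_of_le hab).1 hi
    · filter_upwards [ae_restrict_mem measurableSet_Ioc] with x hx
      exact h0 x (Ioc_subset_Icc_self hx)
  · rw [uIcc_of_le hab]; exact hF

lemma lint_abs (f : ℝ → ENNReal) :
    ∫⁻ x, f |x| = 2 * ∫⁻ x in Ioi 0, f x := by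
  have h1 : ∫⁻ x in Ioi (0:ℝ), f |x| = ∫⁻ x in Ioi 0, f x :=
    setLIntegral_congr_fun measurableSet_Ioi (fun x hx => by
      rw [abs_of_pos hx])
  have h2 : ∫⁻ x in Iic (0:ℝ), f |x| = ∫⁻ x in Ioi 0, f x := by
    rw [← h1, ← setLIntegral_congr (Iio_ae_eq_Iic (a := (0:ℝ)) (μ := volume))]
    have := (Measure.measurePreserving_neg (volume : Measure ℝ)).setLIntegral_comp_preimage_emb
      (MeasurableEquiv.neg ℝ).measurableEmbedding (fun x => f |x|) (Ioi 0)
    rw [← this]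
    simp
  rw [← lintegral_add_compl _ (measurableSet_Ioi (a := (0:ℝ))), compl_Ioi, h1, h2, two_mul]

lemma z_int (N q : ℝ) (hN : 0 < N) (hq : 0 < q) :
    ∫⁻ z : ℝ, (if |z| ^ 3 * q < N then ENNReal.ofReal (|z| ^ 2) else 0)
      = ENNReal.ofReal (2 * N / (3 * q)) := by
  rw [lint_abs (fun z => if z ^ 3 * q < N then ENNReal.ofReal (z ^ 2) else 0)]
  obtain ⟨c, hc, hcq⟩ : ∃ c : ℝ, 0 < c ∧ c ^ 3 = N / q := by
    refine ⟨(N / q) ^ ((1:ℝ) / 3), by positivity, ?_⟩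
    rw [← Real.rpow_natCast, ← Real.rpow_mul (by positivity)]
    norm_num
  have hN' : N = c ^ 3 * q := by rw [hcq]; field_simp
  have key : ∀ z ∈ Ioi (0:ℝ), (if z ^ 3 * q < N then ENNReal.ofReal (z ^ 2) else 0) =
      (Iio c).indicator (fun z => ENNReal.ofReal (z ^ 2)) z := by
    intro z hz
    have : z ^ 3 * q < N ↔ z < c := by
      rw [hN', mul_lt_mul_iff_left₀ hq]
      exact pow_lt_pow_iff_left₀ (le_of_lt hz) hc.le (by norm_num)
    simp only [this, indicator, mem_Iio]
  rw [setLIntegral_congr_fun measurableSet_Ioi key, setLIntegral_indicator measurableSet_Iio,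
    inter_comm, Ioi_inter_Iio, setLIntegral_congr (Ioo_ae_eq_Ioc),
    ftc_aux 0 c hc.le (fun z => z ^ 3 / 3) (fun z => z ^ 2)]
  · rw [← ENNReal.ofReal_ofNat 2, ← ENNReal.ofReal_mul (by norm_num)]
    congr 1
    rw [hN']; field_simp; simp
  · intro x _
    have := (hasDerivAt_pow 3 x).div_const 3
    refine this.congr_deriv ?_
    norm_num
  · fun_prop
  · intros; positivity

noncomputable def GG (N r₁ r₂ s t : ℝ) : ENNReal :=
  if r₂⁻¹ < t ∧ t ≤ s ∧ s ≤ r₁⁻¹ then ENNReal.ofReal (2 * N / (3 * (s * t))) else 0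

lemma st_int (N r₁ r₂ : ℝ) (hN : 0 < N) (hr₁ : 0 < r₁) (hr : r₁ < r₂) :
    ∫⁻ t : ℝ, ∫⁻ s : ℝ, GG N r₁ r₂ |s| |t| =
      ENNReal.ofReal (4 * N / 3 * (Real.log r₂ - Real.log r₁) ^ 2) := by
  have hr₂ : 0 < r₂ := hr₁.trans hr
  have hb : 0 < r₁⁻¹ := by positivity
  have ha : 0 < r₂⁻¹ := by positivity
  have hab : r₂⁻¹ ≤ r₁⁻¹ := by gcongr
  simp_rw [fun t => lint_abs (fun s => GG N r₁ r₂ s t)]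
  rw [lint_abs (fun t => 2 * ∫⁻ s in Ioi 0, GG N r₁ r₂ s t)]
  have key : ∀ t ∈ Ioi (0:ℝ), 2 * ∫⁻ s in Ioi 0, GG N r₁ r₂ s t =
      (Ioc r₂⁻¹ r₁⁻¹).indicator (fun t => ENNReal.ofReal
        (4 * N / 3 * (Real.log r₁⁻¹ - Real.log t) / t)) t := by
    intro t ht
    have ht : 0 < t := ht
    by_cases h : t ∈ Ioc r₂⁻¹ r₁⁻¹
    · rw [indicator_of_mem h]
      have : ∀ s, GG N r₁ r₂ s t = (Icc t r₁⁻¹).indicator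
          (fun s => ENNReal.ofReal (2 * N / (3 * (s * t)))) s := by
        intro s
        simp [GG, indicator, h.1]
      simp_rw [this]
      rw [setLIntegral_indicator measurableSet_Icc, inter_eq_left.2
        (show Icc t r₁⁻¹ ⊆ Ioi 0 from fun x hx => lt_of_lt_of_le ht hx.1), setLIntegral_congr (Ioc_ae_eq_Icc.symm),
        ftc_aux t r₁⁻¹ h.2 (fun s => 2 * N / (3 * t) * Real.log s)
          (fun s => 2 * N / (3 * (s * t)))]
      · rw [← ENNReal.ofReal_ofNat 2, ← ENNReal.ofReal_mul (by norm_num)]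
        congr 1
        field_simp; ring
      · intro x hx
        have hx0 : 0 < x := lt_of_lt_of_le ht hx.1
        refine ((Real.hasDerivAt_log hx0.ne').const_mul (2 * N / (3 * t))).congr_deriv ?_
        field_simp
      · apply ContinuousOn.div (by fun_prop) (by fun_prop)
        intro x hx
        have hx0 : 0 < x := lt_of_lt_of_le ht hx.1
        positivity
      · intro x hx
        have hx0 : 0 < x := lt_of_lt_of_le ht hx.1
        positivity
    · rw [indicator_of_notMem h]
      have : ∀ s, GG N r₁ r₂ s t = 0 := by
        intro s
        rw [GG, if_neg]
        rintro ⟨h1, h2, h3⟩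
        exact h ⟨h1, h2.trans h3⟩
      simp [this]
  rw [setLIntegral_congr_fun measurableSet_Ioi key, setLIntegral_indicator measurableSet_Ioc,
    inter_eq_left.2 (show Ioc r₂⁻¹ r₁⁻¹ ⊆ Ioi 0 from fun x hx => lt_trans ha hx.1),
    ftc_aux r₂⁻¹ r₁⁻¹ hab (fun t => - (2 * N / 3 * (Real.log r₁⁻¹ - Real.log t) ^ 2))
      (fun t => 4 * N / 3 * (Real.log r₁⁻¹ - Real.log t) / t)]
  · rw [← ENNReal.ofReal_ofNat 2, ← ENNReal.ofReal_mul (by norm_num)]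
    congr 1
    simp only [Real.log_inv]
    ring
  · intro x hx
    have hx0 : 0 < x := lt_of_lt_of_le ha hx.1
    refine ((((((Real.hasDerivAt_log hx0.ne').const_sub (Real.log r₁⁻¹)).pow 2).const_mul
      (2 * N / 3)).neg)).congr_deriv ?_
    field_simp; simp; ring
  · apply ContinuousOn.div _ (by fun_prop)
    · intro x hx
      exact (lt_of_lt_of_le ha hx.1).ne'
    · apply ContinuousOn.mul (by fun_prop)
      apply ContinuousOn.sub (by fun_prop)
      apply Real.continuousOn_log.mono
      intro x hx
      exact (lt_of_lt_of_le ha hx.1).ne'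
  · intro x hx
    have hx0 : 0 < x := lt_of_lt_of_le ha hx.1
    have := Real.log_le_log hx0 hx.2
    have : 0 ≤ Real.log r₁⁻¹ - Real.log x := by linarith
    positivity

def BB (N r₁ r₂ : ℝ) : Set ((ℝ × ℝ) × ℝ) :=
  {g | (r₂⁻¹ < |g.1.2| ∧ |g.1.2| ≤ |g.1.1| ∧ |g.1.1| ≤ r₁⁻¹) ∧
    |g.2| ^ 3 * (|g.1.1| * |g.1.2|) < N}

lemma meas_BB (N r₁ r₂ : ℝ) : MeasurableSet (BB N r₁ r₂) := by
  unfold BB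
  measurability

lemma meas_R (N r₁ r₂ : ℝ) : MeasurableSet (regionR N r₁ r₂) := by
  have h1 : Measurable (fun g : ℝ × ℝ × ℝ => g.1 * g.2.1 * g.2.2) := by fun_prop
  have h2 : Measurable (fun g : ℝ × ℝ × ℝ => |g.2.2 / g.1|) :=
    (Measurable.div (by fun_prop) (by fun_prop)).abs
  have h3 : Measurable (fun g : ℝ × ℝ × ℝ => |g.2.2 / g.2.1|) :=
    (Measurable.div (by fun_prop) (by fun_prop)).abs
  exact (measurableSet_eq_fun h1 (measurable_const (a := (0:ℝ)))).compl.inter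
    ((measurableSet_lt h1.abs measurable_const).inter
    ((measurableSet_le measurable_const h2).inter
    ((measurableSet_le h2 h3).inter (measurableSet_lt h3 measurable_const))))

lemma mem_iff (N r₁ r₂ : ℝ) (hr₁ : 0 < r₁) (hr : r₁ < r₂) (z : ℝ) (hz : z ≠ 0)
    (p : ℝ × ℝ) : (z * p.1, z * p.2, z) ∈ regionR N r₁ r₂ ↔ (p, z) ∈ BB N r₁ r₂ := by
  have hr₂ : 0 < r₂ := hr₁.trans hr
  obtain ⟨s, t⟩ := p
  simp only [regionR, BB, mem_ofPred_eq]
  have e : |z * s * (z * t) * z| = |z| ^ 3 * (|s| * |t|) := by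
    simp only [abs_mul]; ring
  have ha : 0 < r₂⁻¹ := by positivity
  by_cases hs : s = 0
  · subst hs
    simp only [mul_zero, zero_mul, ne_eq, not_true, false_and, false_iff, abs_zero]
    rintro ⟨⟨h1, h2, h3⟩, h4⟩
    linarith
  by_cases ht : t = 0
  · subst ht
    simp only [mul_zero, zero_mul, ne_eq, not_true, false_and, false_iff, abs_zero]
    rintro ⟨⟨h1, h2, h3⟩, h4⟩
    linarith
  have e1 : |z / (z * s)| = |s|⁻¹ := by
    rw [← abs_inv]; congr 1; field_simp
  have e2 : |z / (z * t)| = |t|⁻¹ := by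
    rw [← abs_inv]; congr 1; field_simp
  have hs' : 0 < |s| := abs_pos.2 hs
  have ht' : 0 < |t| := abs_pos.2 ht
  rw [e, e1, e2, inv_le_inv₀ hs' ht', le_inv_comm₀ hr₁ hs', inv_lt_comm₀ ht' hr₂]
  have : z * s * (z * t) * z ≠ 0 := by simp [hz, hs, ht]
  tauto

theorem stmt1 (N r₁ r₂ : ℝ) (hN : 0 < N) (hr₁ : 0 < r₁) (hr : r₁ < r₂) :
    MeasureTheory.volume (regionR N r₁ r₂) =
      ENNReal.ofReal (4 * N / 3 * (Real.log r₂ - Real.log r₁) ^ 2) := by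
  have hr₂ : 0 < r₂ := hr₁.trans hr
  have ha : 0 < r₂⁻¹ := by positivity
  have hmF : Measurable (fun g : (ℝ × ℝ) × ℝ =>
      (BB N r₁ r₂).indicator (fun g => ENNReal.ofReal (|g.2| ^ 2)) g) := by
    apply Measurable.indicator _ (meas_BB N r₁ r₂)
    fun_prop
  have hmp := volume_preserving_prodAssoc (α₁ := ℝ) (β₁ := ℝ) (γ₁ := ℝ)
  rw [← hmp.measure_preimage (meas_R N r₁ r₂).nullMeasurableSet]
  rw [Measure.volume_eq_prod (ℝ × ℝ) ℝ,
    Measure.prod_apply_symm (MeasurableEquiv.prodAssoc.measurable (meas_R N r₁ r₂))]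
  have h1 : ∀ᵐ z : ℝ, volume ((fun p : ℝ × ℝ => (p, z)) ⁻¹'
      (MeasurableEquiv.prodAssoc ⁻¹' regionR N r₁ r₂)) =
      ∫⁻ p : ℝ × ℝ, (BB N r₁ r₂).indicator (fun g => ENNReal.ofReal (|g.2| ^ 2)) (p, z) := by
    filter_upwards [Measure.ae_ne volume (0:ℝ)] with z hz
    have hset : ((fun p : ℝ × ℝ => (p, z)) ⁻¹' (MeasurableEquiv.prodAssoc ⁻¹' regionR N r₁ r₂))
        = z • ((fun p : ℝ × ℝ => (p, z)) ⁻¹' BB N r₁ r₂) := by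
      ext p
      rw [mem_smul_set_iff_inv_smul_mem₀ hz, mem_preimage, mem_preimage, mem_preimage,
        ← mem_iff N r₁ r₂ hr₁ hr z hz]
      simp [hz, MeasurableEquiv.prodAssoc]
    rw [hset, Measure.addHaar_smul]
    have hm : MeasurableSet ((fun p : ℝ × ℝ => (p, z)) ⁻¹' BB N r₁ r₂) :=
      (meas_BB N r₁ r₂).preimage (by fun_prop)
    have : ∀ p : ℝ × ℝ, (BB N r₁ r₂).indicator (fun g => ENNReal.ofReal (|g.2| ^ 2)) (p, z) =
      ((fun p : ℝ × ℝ => (p, z)) ⁻¹' BB N r₁ r₂).indicator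
        (fun _ => ENNReal.ofReal (|z| ^ 2)) p := by
      intro p; rfl
    simp_rw [this]
    rw [lintegral_indicator_const hm]
    simp
  rw [lintegral_congr_ae h1, lintegral_lintegral_swap
    (f := fun z p => (BB N r₁ r₂).indicator (fun g => ENNReal.ofReal (|g.2| ^ 2)) (p, z))
    (hmF.comp measurable_swap).aemeasurable]
  have h2 : ∀ p : ℝ × ℝ,
      ∫⁻ z, (BB N r₁ r₂).indicator (fun g => ENNReal.ofReal (|g.2| ^ 2)) (p, z) =
        GG N r₁ r₂ |p.1| |p.2| := by
    intro p
    by_cases h : r₂⁻¹ < |p.2| ∧ |p.2| ≤ |p.1| ∧ |p.1| ≤ r₁⁻¹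
    · rw [GG, if_pos h, ← z_int N _ hN (mul_pos (by linarith) (by linarith))]
      apply lintegral_congr
      intro z
      simp only [indicator, BB, mem_ofPred_eq, h, true_and]
    · rw [GG, if_neg h]
      simp [indicator, BB, h]
  have hmG : Measurable (fun p : ℝ × ℝ => GG N r₁ r₂ |p.1| |p.2|) := by
    simp_rw [← h2]
    exact hmF.lintegral_prod_right'
  simp_rw [h2]
  rw [Measure.volume_eq_prod ℝ ℝ, lintegral_prod_symm' _ hmG]
  exact st_int N r₁ r₂ hN hr₁ hr
end

section
/- Fix real numbers 0 < r₁ < r₂. Then, as N → ∞, the number of integer lattice points in R(N, r₁, r₂), i.e. #(ℤ³ ∩ R(N, r₁, r₂)), equals (4N/3)·(log r₂ − log r₁)² + O(N^{2/3}); that is, the difference #(ℤ³ ∩ R(N, r₁, r₂)) − (4N/3)(log r₂ − log r₁)² is O(N^{2/3}) as N → ∞. -/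
open Filter Asymptotics

open MeasureTheory Set in
/-- Counting measure of the integers, as a measure on the real line. -/
noncomputable def intMeas : Measure ℝ := (Measure.count : Measure ℤ).map (fun n : ℤ => (n : ℝ))

section Davenport
open MeasureTheory Set

instance intMeas_sfinite : SFinite intMeas := by unfold intMeas; infer_instance

lemma intMeas_apply {s : Set ℝ} (hs : MeasurableSet s) :
    intMeas s = ((fun n : ℤ => (n : ℝ)) ⁻¹' s).encard := by
  unfold intMeas
  rw [Measure.map_apply (measurable_of_countable _) hs, Measure.count_apply (MeasurableSet.of_discrete)]

lemma intMeas_Icc (a b : ℝ) (hab : a ≤ b) : intMeas (Icc a b) ≤ ENNReal.ofReal (b - a + 1) := by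
  rw [intMeas_apply measurableSet_Icc, Int.preimage_Icc, ← Finset.coe_Icc, Set.encard_coe_eq_coe_finsetCard,
    Int.card_Icc]
  have h : ((⌊b⌋ + 1 - ⌈a⌉).toNat : ℝ) ≤ b - a + 1 := by
    rcases le_total 0 (⌊b⌋ + 1 - ⌈a⌉) with h | h
    · have h2 : (((⌊b⌋ + 1 - ⌈a⌉).toNat : ℤ) : ℝ) = ((⌊b⌋ + 1 - ⌈a⌉ : ℤ) : ℝ) := by
        rw [Int.toNat_of_nonneg h]
      push_cast at h2
      rw [h2]
      linarith [Int.floor_le b, Int.le_ceil a]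
    · rw [Int.toNat_of_nonpos h]; simp; linarith
  calc _ = ENNReal.ofReal ((⌊b⌋ + 1 - ⌈a⌉).toNat : ℝ) := by simp
    _ ≤ _ := ENNReal.ofReal_le_ofReal h

lemma intMeas_Ioo (a b : ℝ) : ENNReal.ofReal (b - a) ≤ intMeas (Ioo a b) + 1 := by
  rw [intMeas_apply measurableSet_Ioo, Int.preimage_Ioo, ← Finset.coe_Ioo, Set.encard_coe_eq_coe_finsetCard,
    Int.card_Ioo]
  have h : b - a ≤ ((⌈b⌉ - ⌊a⌋ - 1).toNat : ℝ) + 1 := by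
    have h2 : ((⌈b⌉ - ⌊a⌋ - 1 : ℤ) : ℝ) ≤ (((⌈b⌉ - ⌊a⌋ - 1).toNat : ℤ) : ℝ) := by
      exact_mod_cast Int.self_le_toNat _
    push_cast at h2
    linarith [Int.floor_le a, Int.le_ceil b]
  calc _ ≤ ENNReal.ofReal (((⌈b⌉ - ⌊a⌋ - 1).toNat : ℝ) + 1) := ENNReal.ofReal_le_ofReal h
    _ = _ := by rw [ENNReal.ofReal_add (by positivity) (by positivity)]; simp

/-- Two measures agree up to one on bounded intervals. -/
def Close (μ ν : Measure ℝ) : Prop :=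
  ∀ M : ℝ, ∀ I : Set ℝ, I ⊆ Icc 0 M → I.OrdConnected → μ I ≤ ν I + 1

lemma sandwich {M : ℝ} {I : Set ℝ} (h : I ⊆ Icc 0 M) (hI : I.OrdConnected) (hne : I.Nonempty) :
    ∃ a b, a ≤ b ∧ Ioo a b ⊆ I ∧ I ⊆ Icc a b := by
  have hb : BddBelow I := bddBelow_Icc.mono h
  have ha : BddAbove I := bddAbove_Icc.mono h
  refine ⟨sInf I, sSup I, ?_, ?_, fun x hx => ⟨csInf_le hb hx, le_csSup ha hx⟩⟩
  · obtain ⟨x, hx⟩ := hne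
    exact (csInf_le hb hx).trans (le_csSup ha hx)
  · rintro x ⟨h1, h2⟩
    obtain ⟨y, hy, hy'⟩ := exists_lt_of_csInf_lt hne h1
    obtain ⟨z, hz, hz'⟩ := exists_lt_of_lt_csSup hne h2
    exact hI.out hy hz ⟨hy'.le, hz'.le⟩

lemma close_int_vol : Close intMeas volume := by
  intro M I h hI
  rcases I.eq_empty_or_nonempty with rfl | hne
  · simp
  obtain ⟨a, b, hab, h1, h2⟩ := sandwich h hI hne
  calc intMeas I ≤ intMeas (Icc a b) := measure_mono h2
    _ ≤ ENNReal.ofReal (b - a + 1) := intMeas_Icc a b hab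
    _ = volume (Ioo a b) + 1 := by
      rw [Real.volume_Ioo, ENNReal.ofReal_add (by linarith) (by positivity)]; simp
    _ ≤ _ := by gcongr

lemma close_vol_int : Close volume intMeas := by
  intro M I h hI
  rcases I.eq_empty_or_nonempty with rfl | hne
  · simp
  obtain ⟨a, b, hab, h1, h2⟩ := sandwich h hI hne
  calc volume I ≤ volume (Icc a b) := measure_mono h2
    _ = ENNReal.ofReal (b - a) := by simp
    _ ≤ intMeas (Ioo a b) + 1 := intMeas_Ioo a b
    _ ≤ _ := by gcongr

lemma step (μ ν : Measure ℝ) [SFinite μ] [SFinite ν] (hc : Close μ ν) (ρ : Measure (ℝ × ℝ)) [SFinite ρ]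
    (S : Set (ℝ × ℝ × ℝ)) (hS : MeasurableSet S) (M : ℝ)
    (hB : S ⊆ Icc 0 M ×ˢ (Icc 0 M ×ˢ Icc 0 M))
    (hI : ∀ p : ℝ × ℝ, ((fun x => (x, p)) ⁻¹' S).OrdConnected) :
    (μ.prod ρ) S ≤ (ν.prod ρ) S + ρ (Icc 0 M ×ˢ Icc 0 M) := by
  rw [Measure.prod_apply_symm hS, Measure.prod_apply_symm hS]
  have hm : MeasurableSet (Icc (0:ℝ) M ×ˢ Icc (0:ℝ) M) := measurableSet_Icc.prod measurableSet_Icc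
  rw [← lintegral_indicator_one hm, ← lintegral_add_right]
  · apply lintegral_mono
    intro p
    by_cases hp : p ∈ (Icc (0:ℝ) M ×ˢ Icc (0:ℝ) M)
    · simp only [indicator_of_mem hp, Pi.one_apply]
      exact hc M _ (fun x hx => (hB hx).1) (hI p)
    · have : ((fun x => (x, p)) ⁻¹' S) = ∅ := by
        ext x; simp only [mem_preimage, mem_empty_iff_false, iff_false]
        exact fun hx => hp (hB hx).2
      simp [this]
  · exact measurable_one.indicator hm

/-- Cyclic rotation of coordinates. -/
def rotSet (S : Set (ℝ × ℝ × ℝ)) : Set (ℝ × ℝ × ℝ) := {p | (p.2.2, p.1, p.2.1) ∈ S}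

lemma rotSet_meas {S : Set (ℝ × ℝ × ℝ)} (hS : MeasurableSet S) : MeasurableSet (rotSet S) := by
  have : Measurable (fun p : ℝ × ℝ × ℝ => (p.2.2, p.1, p.2.1)) := by fun_prop
  exact this hS

lemma rot_measure (μ₁ μ₂ μ₃ : Measure ℝ) [SFinite μ₁] [SFinite μ₂] [SFinite μ₃]
    (S : Set (ℝ × ℝ × ℝ)) (hS : MeasurableSet S) :
    (μ₁.prod (μ₂.prod μ₃)) S = (μ₂.prod (μ₃.prod μ₁)) (rotSet S) := by
  rw [← Measure.prodAssoc_prod (μ := μ₂) (ν := μ₃) (τ := μ₁), Measure.map_apply (MeasurableEquiv.measurable _) (rotSet_meas hS),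
    ← Measure.prod_swap (μ := μ₂.prod μ₃) (ν := μ₁), Measure.map_apply measurable_swap hS]
  rfl

lemma davenport (μ ν : Measure ℝ) [SFinite μ] [SFinite ν] (hc : Close μ ν)
    (S : Set (ℝ × ℝ × ℝ)) (hS : MeasurableSet S) (M : ℝ) (C : ENNReal)
    (hμ : μ (Icc 0 M) ≤ C) (hν : ν (Icc 0 M) ≤ C)
    (hB : S ⊆ Icc 0 M ×ˢ (Icc 0 M ×ˢ Icc 0 M))
    (h1 : ∀ y z, {x | (x, y, z) ∈ S}.OrdConnected)
    (h2 : ∀ x z, {y | (x, y, z) ∈ S}.OrdConnected)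
    (h3 : ∀ x y, {z | (x, y, z) ∈ S}.OrdConnected) :
    (μ.prod (μ.prod μ)) S ≤ (ν.prod (ν.prod ν)) S + 3 * C ^ 2 := by
  have hS' := rotSet_meas hS
  have hS'' := rotSet_meas hS'
  have a1 := step μ ν hc (μ.prod μ) S hS M hB (fun p => h1 p.1 p.2)
  have a2 := step μ ν hc (μ.prod ν) (rotSet S) hS' M
    (fun p hp => ⟨(hB hp).2.1, (hB hp).2.2, (hB hp).1⟩) (fun p => h2 p.2 p.1)
  have a3 := step μ ν hc (ν.prod ν) (rotSet (rotSet S)) hS'' M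
    (fun p hp => ⟨(hB hp).2.2, (hB hp).1, (hB hp).2.1⟩) (fun p => h3 p.1 p.2)
  rw [Measure.prod_prod] at a1 a2 a3
  rw [rot_measure ν μ μ S hS] at a1
  rw [rot_measure ν μ ν _ hS'] at a2
  rw [rot_measure ν ν ν S hS, rot_measure ν ν ν _ hS']
  have b : ∀ u v : ENNReal, u ≤ C → v ≤ C → u * v ≤ C ^ 2 := by
    intro u v hu hv; rw [sq]; exact mul_le_mul' hu hv
  calc _ ≤ _ := a1
    _ ≤ ((ν.prod (ν.prod ν)) (rotSet (rotSet S)) + C ^ 2 + C ^ 2) + C ^ 2 := by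
      refine add_le_add (a2.trans (add_le_add (a3.trans (add_le_add le_rfl ?_)) ?_)) ?_
      · exact b _ _ hν hν
      · exact b _ _ hμ hν
      · exact b _ _ hμ hμ
    _ = _ := by ring

lemma count_prod_count' {α β : Type*} [Countable α] [Countable β] [MeasurableSpace α]
    [MeasurableSpace β] [MeasurableSingletonClass α] [MeasurableSingletonClass β] :
    (Measure.count : Measure α).prod (Measure.count : Measure β) = Measure.count := by
  apply Measure.ext_of_singleton
  rintro ⟨a, b⟩
  rw [← Set.singleton_prod_singleton, Measure.prod_prod]
  simp

lemma intMeas_cube (S : Set (ℝ × ℝ × ℝ)) (hS : MeasurableSet S) :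
    (intMeas.prod (intMeas.prod intMeas)) S =
      {g : ℤ × ℤ × ℤ | ((g.1 : ℝ), (g.2.1 : ℝ), (g.2.2 : ℝ)) ∈ S}.encard := by
  have m : Measurable (fun n : ℤ => (n : ℝ)) := measurable_of_countable _
  unfold intMeas
  rw [Measure.map_prod_map _ _ m m, Measure.map_prod_map _ _ m (m.prodMap m), count_prod_count',
    count_prod_count', Measure.map_apply (m.prodMap (m.prodMap m)) hS,
    Measure.count_apply (MeasurableSet.of_discrete)]
  rfl

end Davenport

section Volume
open MeasureTheory Set

lemma meas_and {α : Type*} [MeasurableSpace α] {p q : α → Prop} (hp : MeasurableSet {x | p x})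
    (hq : MeasurableSet {x | q x}) : MeasurableSet {x | p x ∧ q x} := by
  have : {x | p x ∧ q x} = {x | p x} ∩ {x | q x} := by ext; simp
  rw [this]; exact hp.inter hq

lemma lint_ftc (F f : ℝ → ℝ) (a b : ℝ) (hab : a ≤ b) (hd : ∀ x ∈ Icc a b, HasDerivAt F (f x) x)
    (hf : ContinuousOn f (Icc a b)) (h0 : ∀ x ∈ Icc a b, 0 ≤ f x) :
    ∫⁻ x in Ioc a b, ENNReal.ofReal (f x) = ENNReal.ofReal (F b - F a) := by
  have hi : IntervalIntegrable f volume a b := by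
    apply ContinuousOn.intervalIntegrable; rwa [uIcc_of_le hab]
  rw [← intervalIntegral.integral_eq_sub_of_hasDerivAt (by rwa [uIcc_of_le hab]) hi,
    intervalIntegral.integral_of_le hab, ofReal_integral_eq_lintegral_ofReal]
  · exact (intervalIntegrable_iff_integrableOn_Ioc_of_le hab).1 hi
  · exact (ae_restrict_iff' measurableSet_Ioc).2 (ae_of_all _ fun x hx => h0 x (Ioc_subset_Icc_self hx))

/-- Positive part of the region. -/
def posR (N r₁ r₂ : ℝ) : Set (ℝ × ℝ × ℝ) :=
  {g | 0 < g.1 ∧ 0 < g.2.1 ∧ 0 < g.2.2 ∧ g.1 * g.2.1 * g.2.2 < N ∧ r₁ * g.1 ≤ g.2.2 ∧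
    g.2.1 ≤ g.1 ∧ g.2.2 < r₂ * g.2.1}

lemma posR_meas (N r₁ r₂ : ℝ) : MeasurableSet (posR N r₁ r₂) := by
  unfold posR
  refine meas_and (measurableSet_lt (by fun_prop) (by fun_prop)) ?_
  refine meas_and (measurableSet_lt (by fun_prop) (by fun_prop)) ?_
  refine meas_and (measurableSet_lt (by fun_prop) (by fun_prop)) ?_
  refine meas_and (measurableSet_lt (by fun_prop) (by fun_prop)) ?_
  refine meas_and (measurableSet_le (by fun_prop) (by fun_prop)) ?_
  exact meas_and (measurableSet_le (by fun_prop) (by fun_prop))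
    (measurableSet_lt (by fun_prop) (by fun_prop))

/-- The triangle of ratios. -/
def triW (r₁ r₂ : ℝ) : Set (ℝ × ℝ) :=
  {p | r₁ * p.1 ≤ 1 ∧ p.2 ≤ p.1 ∧ 1 < r₂ * p.2}

lemma triW_meas (r₁ r₂ : ℝ) : MeasurableSet (triW r₁ r₂) := by
  refine meas_and (measurableSet_le (by fun_prop) (by fun_prop)) ?_
  exact meas_and (measurableSet_le (by fun_prop) (by fun_prop))
    (measurableSet_lt (by fun_prop) (by fun_prop))

lemma sec_vol (N r₁ r₂ : ℝ) (hr₂ : 0 < r₂) (z : ℝ) :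
    volume {p : ℝ × ℝ | (p.1, p.2, z) ∈ posR N r₁ r₂} =
      ∫⁻ p in triW r₁ r₂, (Ioi (0:ℝ) ∩ {z | z ^ 3 * (p.1 * p.2) < N}).indicator
        (fun z => ENNReal.ofReal (z ^ 2)) z := by
  by_cases hz : 0 < z
  · set V : Set (ℝ × ℝ) := {p | z ^ 3 * (p.1 * p.2) < N} with hV
    have hVm : MeasurableSet V := measurableSet_lt (by fun_prop) (by fun_prop)
    have e : {p : ℝ × ℝ | (p.1, p.2, z) ∈ posR N r₁ r₂} =
        (fun p => z⁻¹ • p) ⁻¹' (V ∩ triW r₁ r₂) := by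
      ext ⟨x, y⟩
      simp only [posR, triW, hV, mem_ofPred_eq, mem_preimage, mem_inter_iff, Prod.smul_mk, smul_eq_mul]
      have e1 : z ^ 3 * (z⁻¹ * x * (z⁻¹ * y)) = x * y * z := by field_simp
      have e2 : r₁ * (z⁻¹ * x) ≤ 1 ↔ r₁ * x ≤ z := by
        rw [show r₁ * (z⁻¹ * x) = (r₁ * x) / z by field_simp, div_le_one hz]
      have e3 : z⁻¹ * y ≤ z⁻¹ * x ↔ y ≤ x := mul_le_mul_iff_right₀ (inv_pos.2 hz)
      have e4 : 1 < r₂ * (z⁻¹ * y) ↔ z < r₂ * y := by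
        rw [show r₂ * (z⁻¹ * y) = (r₂ * y) / z by field_simp, one_lt_div hz]
      rw [e1, e2, e3, e4]
      constructor
      · rintro ⟨a, b, c, d, e, f, g⟩; exact ⟨d, e, f, g⟩
      · rintro ⟨d, e, f, g⟩
        have hy : 0 < y := by
          by_contra h
          nlinarith
        exact ⟨by linarith, hy, hz, d, e, f, g⟩
    rw [e, Measure.addHaar_preimage_smul _ (inv_ne_zero hz.ne')]
    have i : ∀ p : ℝ × ℝ, (Ioi (0:ℝ) ∩ {z | z ^ 3 * (p.1 * p.2) < N}).indicator
        (fun z => ENNReal.ofReal (z ^ 2)) z = V.indicator (fun _ => ENNReal.ofReal (z ^ 2)) p := by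
      intro p
      simp [indicator, hV, hz]
    simp_rw [i]
    rw [lintegral_indicator hVm, setLIntegral_const, Measure.restrict_apply hVm]
    congr 2
    simp
  · have e : {p : ℝ × ℝ | (p.1, p.2, z) ∈ posR N r₁ r₂} = ∅ := by
      ext p; simp only [posR, mem_ofPred_eq, mem_empty_iff_false, iff_false]; tauto
    rw [e]
    simp [indicator, hz]

lemma inner_vol (N c : ℝ) (hN : 0 < N) (hc : 0 < c) :
    ∫⁻ z, (Ioi (0:ℝ) ∩ {z | z ^ 3 * c < N}).indicator (fun z => ENNReal.ofReal (z ^ 2)) z =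
      ENNReal.ofReal (N / 3 / c) := by
  obtain ⟨m, hm0, hm⟩ : ∃ m : ℝ, 0 < m ∧ m ^ 3 = N / c := by
    refine ⟨(N / c) ^ ((1:ℝ)/3), by positivity, ?_⟩
    rw [← Real.rpow_natCast, ← Real.rpow_mul (by positivity)]
    norm_num
  have e : Ioi (0:ℝ) ∩ {z | z ^ 3 * c < N} = Ioo 0 m := by
    ext z
    simp only [mem_inter_iff, mem_Ioi, mem_ofPred_eq, mem_Ioo]
    refine and_congr_right fun hz => ?_
    rw [← lt_div_iff₀ hc, ← hm]
    exact pow_lt_pow_iff_left₀ hz.le hm0.le (by norm_num)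
  rw [e, lintegral_indicator measurableSet_Ioo, setLIntegral_congr Ioo_ae_eq_Ioc,
    lint_ftc (fun z => z ^ 3 / 3) (fun z => z ^ 2) 0 m hm0.le]
  · rw [hm]; congr 1; field_simp; simp
  · intro x _
    refine ((hasDerivAt_pow 3 x).div_const 3).congr_deriv ?_
    norm_num
  · fun_prop
  · intro x _; positivity

lemma tri_int (N r₁ r₂ : ℝ) (hN : 0 < N) (hr₁ : 0 < r₁) (hr : r₁ < r₂) :
    ∫⁻ p in triW r₁ r₂, ENNReal.ofReal (N / 3 / (p.1 * p.2)) =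
      ENNReal.ofReal (N / 6 * (Real.log r₂ - Real.log r₁) ^ 2) := by
  have hr₂ : 0 < r₂ := hr₁.trans hr
  have hm : Measurable (fun p : ℝ × ℝ => ENNReal.ofReal (N / 3 / (p.1 * p.2))) := by fun_prop
  rw [← lintegral_indicator (triW_meas _ _), Measure.volume_eq_prod,
    lintegral_prod _ (hm.indicator (triW_meas _ _)).aemeasurable]
  have key : ∀ s : ℝ, ∫⁻ t, (triW r₁ r₂).indicator
      (fun p : ℝ × ℝ => ENNReal.ofReal (N / 3 / (p.1 * p.2))) (s, t) =
      (Ioc r₂⁻¹ r₁⁻¹).indicator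
        (fun s => ENNReal.ofReal (N / 3 / s * (Real.log s + Real.log r₂))) s := by
    intro s
    by_cases hs : s ∈ Ioc r₂⁻¹ r₁⁻¹
    · have hs0 : 0 < s := (inv_pos.2 hr₂).trans hs.1
      rw [indicator_of_mem hs]
      have : ∀ t, (triW r₁ r₂).indicator
          (fun p : ℝ × ℝ => ENNReal.ofReal (N / 3 / (p.1 * p.2))) (s, t) =
          (Ioc r₂⁻¹ s).indicator (fun t => ENNReal.ofReal (N / 3 / (s * t))) t := by
        intro t
        have : (s, t) ∈ triW r₁ r₂ ↔ t ∈ Ioc r₂⁻¹ s := by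
          simp only [triW, mem_ofPred_eq, mem_Ioc]
          have : r₁ * s ≤ 1 := by
            rw [← le_div_iff₀' hr₁, one_div]; exact hs.2
          rw [inv_lt_iff_one_lt_mul₀' hr₂]
          tauto
        simp [indicator, this]
      simp_rw [this]
      rw [lintegral_indicator measurableSet_Ioc,
        lint_ftc (fun t => N / 3 / s * Real.log t) (fun t => N / 3 / (s * t)) _ _ hs.1.le]
      · congr 1
        rw [Real.log_inv]; ring
      · intro x hx
        have hx0 : 0 < x := (inv_pos.2 hr₂).trans_le hx.1
        refine ((Real.hasDerivAt_log hx0.ne').const_mul (N / 3 / s)).congr_deriv ?_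
        field_simp
      · refine ContinuousOn.div (by fun_prop) (by fun_prop) fun x hx => ?_
        have hx0 : 0 < x := (inv_pos.2 hr₂).trans_le hx.1
        positivity
      · intro x hx
        have hx0 : 0 < x := (inv_pos.2 hr₂).trans_le hx.1
        positivity
    · rw [indicator_of_notMem hs, lintegral_eq_zero_of_ae_eq_zero]
      refine ae_of_all _ fun t => ?_
      refine indicator_of_notMem ?_ _
      rintro ⟨h1, h2, h3⟩
      apply hs
      refine ⟨?_, ?_⟩
      · rw [inv_lt_iff_one_lt_mul₀' hr₂]
        exact h3.trans_le (by simp only at h2 ⊢; gcongr)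
      · rw [← one_div, le_div_iff₀' hr₁]; exact h1
  simp_rw [key]
  rw [lintegral_indicator measurableSet_Ioc, lint_ftc
    (fun s => N / 6 * (Real.log s + Real.log r₂) ^ 2)
    (fun s => N / 3 / s * (Real.log s + Real.log r₂)) _ _ (by gcongr)]
  · congr 1
    simp only [Real.log_inv]; ring
  · intro x hx
    have hx0 : 0 < x := (inv_pos.2 hr₂).trans_le hx.1
    refine ((((Real.hasDerivAt_log hx0.ne').add_const (Real.log r₂)).pow 2).const_mul
      (N / 6)).congr_deriv ?_
    field_simp
    norm_num
    ring
  · refine ContinuousOn.mul (ContinuousOn.div (by fun_prop) (by fun_prop) fun x hx => ?_)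
      ((Real.continuousOn_log.mono ?_).add continuousOn_const)
    · have hx0 : 0 < x := (inv_pos.2 hr₂).trans_le hx.1
      exact hx0.ne'
    · intro x hx
      have hx0 : 0 < x := (inv_pos.2 hr₂).trans_le hx.1
      exact hx0.ne'
  · intro x hx
    have hx0 : 0 < x := (inv_pos.2 hr₂).trans_le hx.1
    have : 0 ≤ Real.log x + Real.log r₂ := by
      rw [← Real.log_mul hx0.ne' hr₂.ne']
      apply Real.log_nonneg
      have := hx.1
      rw [inv_le_iff_one_le_mul₀ hr₂] at this
      exact this
    positivity

lemma posR_vol (N r₁ r₂ : ℝ) (hN : 0 < N) (hr₁ : 0 < r₁) (hr : r₁ < r₂) :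
    ((volume : Measure ℝ).prod ((volume : Measure ℝ).prod (volume : Measure ℝ))) (posR N r₁ r₂) =
      ENNReal.ofReal (N / 6 * (Real.log r₂ - Real.log r₁) ^ 2) := by
  have hr₂ : 0 < r₂ := hr₁.trans hr
  have hS := posR_meas N r₁ r₂
  rw [rot_measure _ _ _ _ hS, rot_measure _ _ _ _ (rotSet_meas hS),
    Measure.prod_apply (rotSet_meas (rotSet_meas hS))]
  have e : ∀ z : ℝ, ((volume : Measure ℝ).prod (volume : Measure ℝ))
      (Prod.mk z ⁻¹' rotSet (rotSet (posR N r₁ r₂))) = _ := fun z => sec_vol N r₁ r₂ hr₂ z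
  simp_rw [e]
  rw [lintegral_lintegral_swap]
  · rw [← tri_int N r₁ r₂ hN hr₁ hr]
    refine setLIntegral_congr_fun (triW_meas _ _) fun p hp => ?_
    have h2 : 0 < p.2 := by
      by_contra h
      nlinarith [hp.2.2]
    have h1 : 0 < p.1 := h2.trans_le hp.2.1
    exact inner_vol N (p.1 * p.2) hN (by positivity)
  · apply Measurable.aemeasurable
    have hm : MeasurableSet {q : ℝ × ℝ × ℝ | 0 < q.1 ∧ q.1 ^ 3 * (q.2.1 * q.2.2) < N} :=
      meas_and (measurableSet_lt (by fun_prop) (by fun_prop))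
        (measurableSet_lt (by fun_prop) (by fun_prop))
    have hf : Measurable (fun q : ℝ × ℝ × ℝ => ENNReal.ofReal (q.1 ^ 2)) := by fun_prop
    convert hf.indicator hm using 1
    ext q
    simp [indicator, Function.uncurry]

end Volume

section Final
open MeasureTheory Set

lemma posR_card_bound (N r₁ r₂ M : ℝ) (hN : 0 < N) (hr₁ : 0 < r₁) (hr : r₁ < r₂) (hM0 : 0 ≤ M)
    (hB : posR N r₁ r₂ ⊆ Icc 0 M ×ˢ (Icc 0 M ×ˢ Icc 0 M)) :
    |(Nat.card {g : ℤ × ℤ × ℤ // ((g.1 : ℝ), (g.2.1 : ℝ), (g.2.2 : ℝ)) ∈ posR N r₁ r₂} : ℝ) -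
      N / 6 * (Real.log r₂ - Real.log r₁) ^ 2| ≤ 3 * (M + 1) ^ 2 := by
  have hr₂ : 0 < r₂ := hr₁.trans hr
  have hS := posR_meas N r₁ r₂
  have h1 : ∀ y z, {x | (x, y, z) ∈ posR N r₁ r₂}.OrdConnected := by
    intro y z
    refine ⟨?_⟩
    rintro a ⟨a1, a2, a3, a4, a5, a6, a7⟩ b ⟨b1, b2, b3, b4, b5, b6, b7⟩ c ⟨h1, h2⟩
    simp only at *
    refine ⟨by simp only; linarith, a2, a3, ?_, ?_, by simp only; linarith, a7⟩
    · refine lt_of_le_of_lt ?_ b4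
      simp only; gcongr
    · refine le_trans ?_ b5
      simp only; gcongr
  have h2 : ∀ x z, {y | (x, y, z) ∈ posR N r₁ r₂}.OrdConnected := by
    intro y z
    refine ⟨?_⟩
    rintro a ⟨a1, a2, a3, a4, a5, a6, a7⟩ b ⟨b1, b2, b3, b4, b5, b6, b7⟩ c ⟨h1, h2⟩
    simp only at *
    refine ⟨a1, by simp only; linarith, a3, ?_, a5, by simp only; linarith, ?_⟩
    · refine lt_of_le_of_lt ?_ b4
      simp only; gcongr
    · refine lt_of_lt_of_le a7 ?_
      simp only; gcongr
  have h3 : ∀ x y, {z | (x, y, z) ∈ posR N r₁ r₂}.OrdConnected := by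
    intro y z
    refine ⟨?_⟩
    rintro a ⟨a1, a2, a3, a4, a5, a6, a7⟩ b ⟨b1, b2, b3, b4, b5, b6, b7⟩ c ⟨h1, h2⟩
    simp only at *
    refine ⟨a1, a2, by simp only; linarith, ?_, by simp only; linarith, a6, by simp only; linarith⟩
    · refine lt_of_le_of_lt ?_ b4
      simp only; gcongr
  have c1 : intMeas (Icc 0 M) ≤ ENNReal.ofReal (M + 1) := by
    have := intMeas_Icc 0 M hM0
    rwa [sub_zero] at this
  have c2 : volume (Icc 0 M) ≤ ENNReal.ofReal (M + 1) := by
    rw [Real.volume_Icc]; exact ENNReal.ofReal_le_ofReal (by linarith)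
  have u := davenport _ _ close_int_vol _ hS M _ c1 c2 hB h1 h2 h3
  have l := davenport _ _ close_vol_int _ hS M _ c2 c1 hB h1 h2 h3
  rw [posR_vol N r₁ r₂ hN hr₁ hr, intMeas_cube _ hS] at u l
  set A : Set (ℤ × ℤ × ℤ) := {g | ((g.1 : ℝ), (g.2.1 : ℝ), (g.2.2 : ℝ)) ∈ posR N r₁ r₂} with hA
  have hv : 0 ≤ N / 6 * (Real.log r₂ - Real.log r₁) ^ 2 := by positivity
  have e3 : (3 : ENNReal) * ENNReal.ofReal (M + 1) ^ 2 = ENNReal.ofReal (3 * (M + 1) ^ 2) := by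
    rw [ENNReal.ofReal_mul (by norm_num), ENNReal.ofReal_pow (by linarith)]; simp
  rw [e3] at u l
  have hfin : A.Finite := by
    by_contra h
    rw [Set.Infinite.encard_eq h, ← ENNReal.ofReal_add hv (by positivity)] at u
    simp at u
  have hc : Nat.card {g : ℤ × ℤ × ℤ // ((g.1 : ℝ), (g.2.1 : ℝ), (g.2.2 : ℝ)) ∈ posR N r₁ r₂}
      = A.ncard := rfl
  rw [hc]
  have hc2 : ((A.encard : ℕ∞) : ENNReal) = ENNReal.ofReal (A.ncard : ℝ) := by
    rw [← hfin.cast_ncard_eq]; simp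
  rw [hc2, ← ENNReal.ofReal_add (by positivity) (by positivity),
    ENNReal.ofReal_le_ofReal_iff (by positivity)] at u l
  rw [abs_le]
  constructor <;> linarith

lemma regionR_iff (N r₁ r₂ x y z : ℝ) : (x, y, z) ∈ regionR N r₁ r₂ ↔
    x ≠ 0 ∧ y ≠ 0 ∧ z ≠ 0 ∧ (|x|, |y|, |z|) ∈ posR N r₁ r₂ := by
  simp only [regionR, posR, mem_ofPred_eq, abs_mul, abs_div, mul_ne_zero_iff, abs_pos]
  constructor
  · rintro ⟨⟨⟨hx, hy⟩, hz⟩, a, b, c, d⟩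
    have hx' := abs_pos.2 hx
    have hy' := abs_pos.2 hy
    have hz' := abs_pos.2 hz
    refine ⟨hx, hy, hz, hx, hy, hz, a, (le_div_iff₀ hx').1 b, ?_, (div_lt_iff₀ hy').1 d⟩
    exact (div_le_div_iff_of_pos_left hz' hx' hy').1 c
  · rintro ⟨hx, hy, hz, -, -, -, a, b, c, d⟩
    have hx' := abs_pos.2 hx
    have hy' := abs_pos.2 hy
    have hz' := abs_pos.2 hz
    exact ⟨⟨⟨hx, hy⟩, hz⟩, a, (le_div_iff₀ hx').2 b,
      (div_le_div_iff_of_pos_left hz' hx' hy').2 c, (div_lt_iff₀ hy').2 d⟩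

lemma unit_inj (e e' : ℤˣ) (a a' : ℤ) (ha : 0 < a) (ha' : 0 < a') (h : e * a = e' * a') :
    e = e' ∧ a = a' := by
  rcases Int.units_eq_one_or e with rfl | rfl <;> rcases Int.units_eq_one_or e' with rfl | rfl <;>
    simp at h ⊢ <;> omega

lemma unit_surj (a : ℤ) (ha : a ≠ 0) : ∃ e : ℤˣ, e * |a| = a := by
  rcases lt_or_gt_of_ne ha with h | h
  · exact ⟨-1, by simp [abs_of_neg h]⟩
  · exact ⟨1, by simp [abs_of_pos h]⟩

lemma unit_abs (e : ℤˣ) (a : ℤ) (ha : 0 < a) : |(((e : ℤ) * a : ℤ) : ℝ)| = a := by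
  have : (0:ℝ) < a := by exact_mod_cast ha
  rcases Int.units_eq_one_or e with rfl | rfl <;> simp [abs_of_pos this]

lemma card8 (N r₁ r₂ : ℝ) :
    Nat.card {g : ℤ × ℤ × ℤ // ((g.1 : ℝ), (g.2.1 : ℝ), (g.2.2 : ℝ)) ∈ regionR N r₁ r₂} =
    8 * Nat.card {g : ℤ × ℤ × ℤ // ((g.1 : ℝ), (g.2.1 : ℝ), (g.2.2 : ℝ)) ∈ posR N r₁ r₂} := by
  let P := {g : ℤ × ℤ × ℤ // ((g.1 : ℝ), (g.2.1 : ℝ), (g.2.2 : ℝ)) ∈ posR N r₁ r₂}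
  let Q := {g : ℤ × ℤ × ℤ // ((g.1 : ℝ), (g.2.1 : ℝ), (g.2.2 : ℝ)) ∈ regionR N r₁ r₂}
  have pos : ∀ p : P, 0 < p.1.1 ∧ 0 < p.1.2.1 ∧ 0 < p.1.2.2 := by
    rintro ⟨p, h1, h2, h3, -⟩
    exact ⟨Int.cast_pos.1 h1, Int.cast_pos.1 h2, Int.cast_pos.1 h3⟩
  let f : (ℤˣ × ℤˣ × ℤˣ) × P → Q := fun q =>
    ⟨(q.1.1 * q.2.1.1, q.1.2.1 * q.2.1.2.1, q.1.2.2 * q.2.1.2.2), by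
      obtain ⟨h1, h2, h3⟩ := pos q.2
      rw [regionR_iff, unit_abs _ _ h1, unit_abs _ _ h2, unit_abs _ _ h3]
      refine ⟨?_, ?_, ?_, q.2.2⟩
      · exact_mod_cast mul_ne_zero q.1.1.ne_zero h1.ne'
      · exact_mod_cast mul_ne_zero q.1.2.1.ne_zero h2.ne'
      · exact_mod_cast mul_ne_zero q.1.2.2.ne_zero h3.ne'⟩
  have hf : Function.Bijective f := by
    constructor
    · rintro ⟨⟨e1, e2, e3⟩, p⟩ ⟨⟨e1', e2', e3'⟩, p'⟩ h
      obtain ⟨h1, h2, h3⟩ := pos p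
      obtain ⟨h1', h2', h3'⟩ := pos p'
      have h := congrArg Subtype.val h
      simp only [f, Prod.mk.injEq] at h
      obtain ⟨a, b, c⟩ := h
      obtain ⟨rfl, i1⟩ := unit_inj _ _ _ _ h1 h1' a
      obtain ⟨rfl, i2⟩ := unit_inj _ _ _ _ h2 h2' b
      obtain ⟨rfl, i3⟩ := unit_inj _ _ _ _ h3 h3' c
      have : p = p' := Subtype.ext (Prod.ext i1 (Prod.ext i2 i3))
      rw [this]
    · rintro ⟨⟨a, b, c⟩, h⟩
      have h' := h
      rw [regionR_iff] at h'
      obtain ⟨ha, hb, hc, h'⟩ := h'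
      obtain ⟨e1, h1⟩ := unit_surj a (by exact_mod_cast ha)
      obtain ⟨e2, h2⟩ := unit_surj b (by exact_mod_cast hb)
      obtain ⟨e3, h3⟩ := unit_surj c (by exact_mod_cast hc)
      refine ⟨((e1, e2, e3), ⟨(|a|, |b|, |c|), by simpa using h'⟩), ?_⟩
      apply Subtype.ext
      simp only [f, h1, h2, h3]
  have := Nat.card_congr (Equiv.ofBijective f hf)
  rw [← this, Nat.card_prod, Nat.card_prod, Nat.card_prod]
  simp [P]

end Final

/-- For fixed `0 < r₁ < r₂`, as `N → ∞`,
`#(ℤ³ ∩ R(N, r₁, r₂)) = (4N/3)·(log r₂ − log r₁)² + O(N^{2/3})`. -/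
theorem stmt2 (r₁ r₂ : ℝ) (hr₁ : 0 < r₁) (hr : r₁ < r₂) :
    (fun N : ℝ =>
        (Nat.card {g : ℤ × ℤ × ℤ //
            ((g.1 : ℝ), (g.2.1 : ℝ), (g.2.2 : ℝ)) ∈ regionR N r₁ r₂} : ℝ) -
          4 * N / 3 * (Real.log r₂ - Real.log r₁) ^ 2)
      =O[atTop] fun N : ℝ => N ^ ((2 : ℝ) / 3) := by
  have hr₂ : 0 < r₂ := hr₁.trans hr
  set K : ℝ := (1 + r₂) * (1 + 1 / r₁) with hK
  have hK0 : 0 < K := by positivity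
  refine IsBigO.of_bound (24 * (K + 1) ^ 2) ?_
  filter_upwards [eventually_ge_atTop 1] with N hN
  have hN0 : 0 < N := by linarith
  set n : ℝ := N ^ ((1 : ℝ) / 3) with hn
  have hn1 : 1 ≤ n := Real.one_le_rpow hN (by norm_num)
  have hn3 : n ^ 3 = N := by
    rw [hn, ← Real.rpow_natCast, ← Real.rpow_mul hN0.le]; norm_num
  have hn2 : N ^ ((2 : ℝ) / 3) = n ^ 2 := by
    rw [hn, ← Real.rpow_natCast, ← Real.rpow_mul hN0.le]; norm_num
  have hB : posR N r₁ r₂ ⊆ Set.Icc 0 (K * n) ×ˢ (Set.Icc 0 (K * n) ×ˢ Set.Icc 0 (K * n)) := by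
    rintro ⟨x, y, z⟩ ⟨h1, h2, h3, h4, h5, h6, h7⟩
    simp only at h1 h2 h3 h4 h5 h6 h7
    have hz : z ≤ (1 + r₂) * n := by
      refine le_of_lt (lt_of_pow_lt_pow_left₀ 3 (by positivity) ?_)
      have hx : z < r₂ * x := h7.trans_le (by gcongr)
      calc z ^ 3 = z * z * z := by ring
        _ ≤ (r₂ * x) * (r₂ * y) * z := by gcongr
        _ = r₂ ^ 2 * (x * y * z) := by ring
        _ < r₂ ^ 2 * N := by gcongr
        _ ≤ (1 + r₂) ^ 3 * N := by
          gcongr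
          nlinarith [pow_pos hr₂ 3, pow_pos hr₂ 2]
        _ = _ := by rw [← hn3]; ring
    have hx : x ≤ (1 + r₂) * n * (1 / r₁) := by
      rw [mul_one_div, le_div_iff₀ hr₁]; linarith
    have p1 : 0 < (1 + r₂) * n := by positivity
    have p2 : 0 < (1 + r₂) * n * (1 / r₁) := by positivity
    have hKn : K * n = (1 + r₂) * n + (1 + r₂) * n * (1 / r₁) := by rw [hK]; ring
    rw [hKn]
    exact ⟨⟨h1.le, by simp only; linarith⟩, ⟨h2.le, by simp only; linarith⟩,
      ⟨h3.le, by simp only; linarith⟩⟩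
  have key := posR_card_bound N r₁ r₂ (K * n) hN0 hr₁ hr (by positivity) hB
  rw [card8, hn2, Real.norm_eq_abs, Real.norm_eq_abs, abs_of_nonneg (sq_nonneg n)]
  push_cast
  set c : ℝ := (Nat.card {g : ℤ × ℤ × ℤ //
    ((g.1 : ℝ), (g.2.1 : ℝ), (g.2.2 : ℝ)) ∈ posR N r₁ r₂} : ℝ)
  have e : 8 * c - 4 * N / 3 * (Real.log r₂ - Real.log r₁) ^ 2 =
      8 * (c - N / 6 * (Real.log r₂ - Real.log r₁) ^ 2) := by ring
  rw [e, abs_mul, abs_of_pos (by norm_num : (0:ℝ) < 8)]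
  have b : (K * n + 1) ^ 2 ≤ ((K + 1) * n) ^ 2 := by
    gcongr; linarith
  nlinarith
end

section
/- Fix an integer n ≥ 1, a subset C of ({−1, +1} × ℤ/nℤ)³, and real numbers 0 < r₁ < r₂. Say an integer triple (g₁, g₂, g₃) with all gᵢ ≠ 0 is 'in C' if ((sgn g₁, g₁ mod n), (sgn g₂, g₂ mod n), (sgn g₃, g₃ mod n)) ∈ C. Then, as N → ∞, the number of triples (g₁, g₂, g₃) ∈ ℤ³ lying in R(N, r₁, r₂) that are NOT in C equals (4/3)·(1 − #C/(8n³))·N·(log r₂ − log r₁)² + O(N^{2/3}). -/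
open Filter Asymptotics

/-- The sign of a nonzero integer, as an element of `ℤˣ = {−1, +1}`. -/
def signUnit (g : ℤ) : ℤˣ := if 0 < g then 1 else -1

/-- A triple of nonzero integers is "in `C`" if the triple of
(sign, residue class mod `n`) pairs lies in `C`. -/
def inCond (n : ℕ) (C : Finset ((ℤˣ × ZMod n) × (ℤˣ × ZMod n) × (ℤˣ × ZMod n)))
    (g : ℤ × ℤ × ℤ) : Prop :=
  ((signUnit g.1, (g.1 : ZMod n)), (signUnit g.2.1, (g.2.1 : ZMod n)),
    (signUnit g.2.2, (g.2.2 : ZMod n))) ∈ C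

open MeasureTheory

lemma aux_real_prod {X Y : Type*} [MeasurableSpace X] [MeasurableSpace Y]
    (μ : Measure X) (ν : Measure Y) [IsFiniteMeasure μ] [IsFiniteMeasure ν]
    (S : Set (X × Y)) (hS : MeasurableSet S) :
    (μ.prod ν).real S = ∫ x, ν.real (Prod.mk x ⁻¹' S) ∂μ ∧
      Integrable (fun x => ν.real (Prod.mk x ⁻¹' S)) μ := by
  have hm : Measurable (fun x => ν (Prod.mk x ⁻¹' S)) := measurable_measure_prodMk_left hS
  constructor
  · rw [measureReal_def, Measure.prod_apply hS, ← integral_toReal hm.aemeasurable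
      (Eventually.of_forall fun x => measure_lt_top _ _)]
    rfl
  · refine Integrable.of_bound (C := ν.real Set.univ) hm.ennreal_toReal.aestronglyMeasurable
      (Eventually.of_forall fun x => ?_)
    rw [Real.norm_of_nonneg measureReal_nonneg]
    exact measureReal_mono (Set.subset_univ _)

lemma aux_real_prod_symm {X Y : Type*} [MeasurableSpace X] [MeasurableSpace Y]
    (μ : Measure X) (ν : Measure Y) [IsFiniteMeasure μ] [IsFiniteMeasure ν]
    (S : Set (X × Y)) (hS : MeasurableSet S) :
    (μ.prod ν).real S = ∫ y, μ.real ((fun x => (x, y)) ⁻¹' S) ∂ν ∧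
      Integrable (fun y => μ.real ((fun x => (x, y)) ⁻¹' S)) ν := by
  have hm : Measurable (fun y => μ ((fun x => (x, y)) ⁻¹' S)) := measurable_measure_prodMk_right hS
  constructor
  · rw [measureReal_def, Measure.prod_apply_symm hS, ← integral_toReal hm.aemeasurable
      (Eventually.of_forall fun x => measure_lt_top _ _)]
    rfl
  · refine Integrable.of_bound (C := μ.real Set.univ) hm.ennreal_toReal.aestronglyMeasurable
      (Eventually.of_forall fun x => ?_)
    rw [Real.norm_of_nonneg measureReal_nonneg]
    exact measureReal_mono (Set.subset_univ _)

/-- Replace the second factor. -/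
lemma aux_step_right {X Y : Type*} [MeasurableSpace X] [MeasurableSpace Y]
    (μ : Measure X) (ν ν' : Measure Y) [IsFiniteMeasure μ] [IsFiniteMeasure ν] [IsFiniteMeasure ν']
    (S : Set (X × Y)) (hS : MeasurableSet S) (c : ℝ)
    (h : ∀ x, |ν.real (Prod.mk x ⁻¹' S) - ν'.real (Prod.mk x ⁻¹' S)| ≤ c) :
    |(μ.prod ν).real S - (μ.prod ν').real S| ≤ c * μ.real Set.univ := by
  obtain ⟨h1, h2⟩ := aux_real_prod μ ν S hS
  obtain ⟨h3, h4⟩ := aux_real_prod μ ν' S hS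
  rw [h1, h3, ← integral_sub h2 h4]
  rw [← Real.norm_eq_abs]
  exact norm_integral_le_of_norm_le_const (Eventually.of_forall fun z => by
    rw [Real.norm_eq_abs]; exact h z)

/-- Replace the first factor. -/
lemma aux_step_left {X Y : Type*} [MeasurableSpace X] [MeasurableSpace Y]
    (μ μ' : Measure X) (ν : Measure Y) [IsFiniteMeasure μ] [IsFiniteMeasure ν] [IsFiniteMeasure μ']
    (S : Set (X × Y)) (hS : MeasurableSet S) (c : ℝ)
    (h : ∀ y, |μ.real ((fun x => (x, y)) ⁻¹' S) - μ'.real ((fun x => (x, y)) ⁻¹' S)| ≤ c) :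
    |(μ.prod ν).real S - (μ'.prod ν).real S| ≤ c * ν.real Set.univ := by
  obtain ⟨h1, h2⟩ := aux_real_prod_symm μ ν S hS
  obtain ⟨h3, h4⟩ := aux_real_prod_symm μ' ν S hS
  rw [h1, h3, ← integral_sub h2 h4]
  rw [← Real.norm_eq_abs]
  exact norm_integral_le_of_norm_le_const (Eventually.of_forall fun z => by
    rw [Real.norm_eq_abs]; exact h z)

/-- The three-step comparison of product measures on sets whose axis-parallel sections are
intervals. -/
lemma aux_three (μ₁ μ₂ μ₃ l : Measure ℝ) [IsFiniteMeasure μ₁] [IsFiniteMeasure μ₂]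
    [IsFiniteMeasure μ₃] [IsFiniteMeasure l] (c M : ℝ) (hc : 0 ≤ c) (hM : 0 ≤ M)
    (h₁ : ∀ I : Set ℝ, I.OrdConnected → |μ₁.real I - l.real I| ≤ c)
    (h₂ : ∀ I : Set ℝ, I.OrdConnected → |μ₂.real I - l.real I| ≤ c)
    (h₃ : ∀ I : Set ℝ, I.OrdConnected → |μ₃.real I - l.real I| ≤ c)
    (hl : l.real Set.univ ≤ M)
    (S : Set (ℝ × ℝ × ℝ)) (hS : MeasurableSet S)
    (s₁ : ∀ y z, {x | (x, y, z) ∈ S}.OrdConnected)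
    (s₂ : ∀ x z, {y | (x, y, z) ∈ S}.OrdConnected)
    (s₃ : ∀ x y, {z | (x, y, z) ∈ S}.OrdConnected) :
    |(μ₁.prod (μ₂.prod μ₃)).real S - (l.prod (l.prod l)).real S| ≤ 3 * c * (M + c) ^ 2 := by
  have m₂ : μ₂.real Set.univ ≤ M + c := by
    have := (abs_le.1 (h₂ Set.univ Set.ordConnected_univ)).2; linarith
  have m₃ : μ₃.real Set.univ ≤ M + c := by
    have := (abs_le.1 (h₃ Set.univ Set.ordConnected_univ)).2; linarith
  have hl' : l.real Set.univ ≤ M + c := by linarith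
  have n₂ : 0 ≤ μ₂.real Set.univ := measureReal_nonneg
  have n₃ : 0 ≤ μ₃.real Set.univ := measureReal_nonneg
  have nl : 0 ≤ l.real Set.univ := measureReal_nonneg
  have a1 := aux_step_left μ₁ l (μ₂.prod μ₃) S hS c (fun y => h₁ _ (s₁ y.1 y.2))
  have a2 := aux_step_right l (μ₂.prod μ₃) (l.prod μ₃) S hS (c * μ₃.real Set.univ) (fun x =>
    aux_step_left μ₂ l μ₃ (Prod.mk x ⁻¹' S) (measurable_prodMk_left hS) c
      (fun z => h₂ _ (s₂ x z)))
  have a3 := aux_step_right l (l.prod μ₃) (l.prod l) S hS (c * l.real Set.univ) (fun x =>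
    aux_step_right l μ₃ l (Prod.mk x ⁻¹' S) (measurable_prodMk_left hS) c
      (fun y => h₃ _ (s₃ x y)))
  have e : (μ₂.prod μ₃).real Set.univ = μ₂.real Set.univ * μ₃.real Set.univ := by
    rw [← Set.univ_prod_univ, measureReal_prod_prod]
  rw [e] at a1
  have b1 : c * (μ₂.real Set.univ * μ₃.real Set.univ) ≤ c * (M + c) ^ 2 := by
    rw [sq]; gcongr
  have b2 : c * μ₃.real Set.univ * l.real Set.univ ≤ c * (M + c) ^ 2 := by
    rw [sq, mul_assoc]; gcongr
  have b3 : c * l.real Set.univ * l.real Set.univ ≤ c * (M + c) ^ 2 := by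
    rw [sq, mul_assoc]; gcongr
  rw [abs_le] at *
  constructor <;> linarith [a1.1, a1.2, a2.1, a2.2, a3.1, a3.2]

/-- Arithmetic progressions in integer intervals. -/
lemma aux_card_Ioc (a b v : ℤ) (n : ℕ) (hn : 1 ≤ n) :
    (b - a : ℝ) - n ≤ n * (((Finset.Ioc a b).filter (fun k => k ≡ v [ZMOD n])).card : ℝ) ∧
    (a ≤ b → n * (((Finset.Ioc a b).filter (fun k => k ≡ v [ZMOD n])).card : ℝ) ≤ b - a + n) := by
  have hn' : (0 : ℤ) < n := by exact_mod_cast hn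
  have hnq : (0 : ℝ) < n := by exact_mod_cast hn
  have hh := Int.Ioc_filter_modEq_card a b hn' v
  set A := ((Finset.Ioc a b).filter (fun k => k ≡ v [ZMOD n])).card
  set p := ⌊((b : ℚ) - v) / ((n : ℤ) : ℚ)⌋ with hp
  set q := ⌊((a : ℚ) - v) / ((n : ℤ) : ℚ)⌋ with hq
  have hn2 : (0 : ℚ) < ((n : ℤ) : ℚ) := by exact_mod_cast hn
  have p1 : (p : ℝ) * n ≤ b - v := by
    have := Int.floor_le (((b : ℚ) - v) / ((n : ℤ) : ℚ))
    rw [← hp, le_div_iff₀ hn2] at this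
    exact_mod_cast this
  have p2 : (b - v : ℝ) < (p + 1) * n := by
    have := Int.lt_floor_add_one (((b : ℚ) - v) / ((n : ℤ) : ℚ))
    rw [← hp, div_lt_iff₀ hn2] at this
    exact_mod_cast this
  have q1 : (q : ℝ) * n ≤ a - v := by
    have := Int.floor_le (((a : ℚ) - v) / ((n : ℤ) : ℚ))
    rw [← hq, le_div_iff₀ hn2] at this
    exact_mod_cast this
  have q2 : (a - v : ℝ) < (q + 1) * n := by
    have := Int.lt_floor_add_one (((a : ℚ) - v) / ((n : ℤ) : ℚ))
    rw [← hq, div_lt_iff₀ hn2] at this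
    exact_mod_cast this
  have hh' : (A : ℝ) = max ((p : ℝ) - q) 0 := by exact_mod_cast hh
  constructor
  · have : (p : ℝ) - q ≤ A := by rw [hh']; exact le_max_left _ _
    have := mul_le_mul_of_nonneg_left this hnq.le
    nlinarith
  · intro hab
    have hab' : (a : ℝ) ≤ b := by exact_mod_cast hab
    rw [hh']
    rcases max_choice ((p : ℝ) - q) 0 with h | h <;> rw [h] <;> nlinarith

lemma aux_interval (J : Set ℝ) (hJ : J.OrdConnected) (M : ℝ) (hJM : J ⊆ Set.Ioc 0 M)
    (n : ℕ) (hn : 1 ≤ n) (v : ℤ) :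
    |n * (Nat.card {k : ℤ // (k : ℝ) ∈ J ∧ k ≡ v [ZMOD n]} : ℝ) - volume.real J| ≤ 3 * n := by
  have hn1 : (1 : ℝ) ≤ n := by exact_mod_cast hn
  rcases J.eq_empty_or_nonempty with rfl | hne
  · simp
  have hb : BddBelow J := ⟨0, fun x hx => (hJM hx).1.le⟩
  have ha : BddAbove J := ⟨M, fun x hx => (hJM hx).2⟩
  have hsub1 : Set.Ioo (sInf J) (sSup J) ⊆ J :=
    IsConnected.Ioo_csInf_csSup_subset ⟨hne, hJ.isPreconnected⟩ hb ha
  have hsub2 : J ⊆ Set.Icc (sInf J) (sSup J) := subset_Icc_csInf_csSup hb ha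
  have hst : sInf J ≤ sSup J := csInf_le_csSup hne hb ha
  set s := sInf J
  set t := sSup J
  have hv : volume.real J = t - s := by
    apply le_antisymm
    · refine (measureReal_mono hsub2 (by simp)).trans ?_
      simp [Real.volume_real_Icc_of_le hst]
    · refine le_trans ?_ (measureReal_mono hsub1
        ((measure_mono hsub2).trans_lt (by simp)).ne)
      simp [Real.volume_real_Ioo_of_le hst]
  have up : {k : ℤ | (k : ℝ) ∈ J ∧ k ≡ v [ZMOD n]} ⊆
      (((Finset.Ioc (⌈s⌉ - 1) ⌊t⌋).filter (fun k => k ≡ v [ZMOD n]) : Finset ℤ) : Set ℤ) := by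
    rintro k ⟨hk, hk2⟩
    have := hsub2 hk
    simp only [Finset.coe_filter, Finset.mem_Ioc, Set.mem_ofPred_eq]
    refine ⟨⟨?_, Int.le_floor.2 this.2⟩, hk2⟩
    have := Int.ceil_le.2 this.1
    omega
  have lo : (((Finset.Ioc (⌊s⌋) (⌈t⌉ - 1)).filter (fun k => k ≡ v [ZMOD n]) : Finset ℤ) : Set ℤ)
      ⊆ {k : ℤ | (k : ℝ) ∈ J ∧ k ≡ v [ZMOD n]} := by
    intro k hk
    simp only [Finset.coe_filter, Finset.mem_Ioc, Set.mem_ofPred_eq] at hk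
    refine ⟨hsub1 ⟨Int.floor_lt.1 hk.1.1, Int.lt_ceil.1 (by omega)⟩, hk.2⟩
  have hcard : Nat.card {k : ℤ // (k : ℝ) ∈ J ∧ k ≡ v [ZMOD n]} =
    Set.ncard {k : ℤ | (k : ℝ) ∈ J ∧ k ≡ v [ZMOD n]} := rfl
  have c1 := Set.ncard_le_ncard up (Finset.finite_toSet _)
  have c2 := Set.ncard_le_ncard lo ((Finset.finite_toSet _).subset up)
  rw [Set.ncard_coe_finset] at c1 c2
  rw [hcard, hv]
  set B := Set.ncard {k : ℤ | (k : ℝ) ∈ J ∧ k ≡ v [ZMOD n]}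
  have d1 := (aux_card_Ioc (⌈s⌉ - 1) ⌊t⌋ v n hn).2 (by
    have : ⌈s⌉ < ⌊t⌋ + 2 := by
      have h1 := Int.ceil_lt_add_one s
      have h2 := Int.lt_floor_add_one t
      have : (⌈s⌉ : ℝ) < (⌊t⌋ + 2 : ℤ) := by push_cast; linarith
      exact_mod_cast this
    omega)
  have d2 := (aux_card_Ioc ⌊s⌋ (⌈t⌉ - 1) v n hn).1
  have c1' : (n : ℝ) * B ≤ n * (((Finset.Ioc (⌈s⌉ - 1) ⌊t⌋).filter (fun k => k ≡ v [ZMOD n])).card : ℝ) := by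
    gcongr
  have c2' : n * (((Finset.Ioc (⌊s⌋) (⌈t⌉ - 1)).filter (fun k => k ≡ v [ZMOD n])).card : ℝ) ≤ (n : ℝ) * B := by
    gcongr
  push_cast at d1 d2
  have f1 := Int.le_ceil s
  have f2 := Int.floor_le t
  have f3 := Int.le_ceil t
  have f4 := Int.floor_le s
  rw [abs_le]
  constructor <;> linarith

/-- `n` times the counting measure on a finite set of integers, pushed to `ℝ`. -/
noncomputable def auxDisc (n : ℕ) (A : Finset ℤ) : Measure ℝ :=
  ∑ k ∈ A, (n : NNReal) • Measure.dirac (k : ℝ)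

instance auxDisc_finite (n : ℕ) (A : Finset ℤ) : IsFiniteMeasure (auxDisc n A) := by
  constructor
  simp only [auxDisc, Measure.coe_finsetSum, Finset.sum_apply]
  exact ENNReal.sum_lt_top.2 fun k _ => measure_lt_top _ _

lemma auxDisc_real (n : ℕ) (A : Finset ℤ) (I : Set ℝ) :
    (auxDisc n A).real I = n * ∑ k ∈ A, I.indicator (fun _ => (1 : ℝ)) (k : ℝ) := by
  rw [measureReal_def]
  simp only [auxDisc, Measure.coe_finsetSum, Finset.sum_apply]
  rw [ENNReal.toReal_sum (fun k _ => (measure_lt_top _ _).ne), Finset.mul_sum]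
  refine Finset.sum_congr rfl fun k _ => ?_
  by_cases h : (k : ℝ) ∈ I <;> simp [h]

lemma auxDisc_prod {Y : Type*} [MeasurableSpace Y] (n : ℕ) (A : Finset ℤ) (ν : Measure Y)
    [IsFiniteMeasure ν] (S : Set (ℝ × Y)) (hS : MeasurableSet S) :
    ((auxDisc n A).prod ν).real S = n * ∑ k ∈ A, ν.real (Prod.mk (k : ℝ) ⁻¹' S) := by
  have hm : Measurable (fun x => ν (Prod.mk x ⁻¹' S)) := measurable_measure_prodMk_left hS
  rw [measureReal_def, Measure.prod_apply hS, auxDisc, lintegral_finsetSum_measure,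
    ENNReal.toReal_sum, Finset.mul_sum]
  · refine Finset.sum_congr rfl fun k _ => ?_
    rw [lintegral_smul_measure, lintegral_dirac]
    simp [measureReal_def, ENNReal.smul_def]
  · intro k _
    rw [lintegral_smul_measure, lintegral_dirac]
    simp [ENNReal.smul_def, ENNReal.mul_eq_top]

lemma auxDisc_prod3 (n : ℕ) (A B D : Finset ℤ) (S : Set (ℝ × ℝ × ℝ)) (hS : MeasurableSet S) :
    ((auxDisc n A).prod ((auxDisc n B).prod (auxDisc n D))).real S =
      n ^ 3 * (Set.ncard {g : ℤ × ℤ × ℤ | g ∈ A ×ˢ B ×ˢ D ∧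
        ((g.1 : ℝ), (g.2.1 : ℝ), (g.2.2 : ℝ)) ∈ S} : ℝ) := by
  classical
  have e : {g : ℤ × ℤ × ℤ | g ∈ A ×ˢ B ×ˢ D ∧
        ((g.1 : ℝ), (g.2.1 : ℝ), (g.2.2 : ℝ)) ∈ S} =
      (((A ×ˢ B ×ˢ D).filter (fun g : ℤ × ℤ × ℤ => ((g.1 : ℝ), (g.2.1 : ℝ), (g.2.2 : ℝ)) ∈ S) :
        Finset (ℤ × ℤ × ℤ)) : Set (ℤ × ℤ × ℤ)) := by
    ext g; simp
  rw [e, Set.ncard_coe_finset, Finset.card_filter, Finset.sum_product, auxDisc_prod _ _ _ _ hS]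
  push_cast
  simp only [Finset.mul_sum]
  refine Finset.sum_congr rfl fun x _ => ?_
  rw [auxDisc_prod _ _ _ _ (measurable_prodMk_left hS), Finset.sum_product]
  simp only [Finset.mul_sum]
  refine Finset.sum_congr rfl fun y _ => ?_
  rw [auxDisc_real]
  simp only [Finset.mul_sum]
  refine Finset.sum_congr rfl fun z _ => ?_
  by_cases h : ((x : ℝ), (y : ℝ), (z : ℝ)) ∈ S <;> simp [h]
  ring

noncomputable def auxA (n : ℕ) (v : ℤ) (M : ℝ) : Finset ℤ :=
  (Finset.Ioc 0 ⌊M⌋).filter (fun k => k ≡ v [ZMOD n])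

lemma auxDisc_close (n : ℕ) (hn : 1 ≤ n) (v : ℤ) (M : ℝ) (I : Set ℝ) (hI : I.OrdConnected) :
    |(auxDisc n (auxA n v M)).real I - (volume.restrict (Set.Ioc 0 M)).real I| ≤ 3 * n := by
  have h := aux_interval (I ∩ Set.Ioc 0 M) (hI.inter Set.ordConnected_Ioc) M
    Set.inter_subset_right n hn v
  rw [auxDisc_real, measureReal_restrict_apply hI.measurableSet]
  convert h using 4
  classical
  have e : {k : ℤ | (k : ℝ) ∈ I ∩ Set.Ioc 0 M ∧ k ≡ v [ZMOD n]} =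
    ((auxA n v M).filter (fun k : ℤ => (k : ℝ) ∈ I) : Finset ℤ) := by
    ext k
    simp [auxA, Int.le_floor]
    tauto
  change _ = ((Set.ncard {k : ℤ | (k : ℝ) ∈ I ∩ Set.Ioc 0 M ∧ k ≡ v [ZMOD n]} : ℕ) : ℝ)
  rw [e, Set.ncard_coe_finset, Finset.card_filter]
  push_cast
  simp only [Set.indicator_apply]

/-- The positive part of the region. -/
def auxPos (N r₁ r₂ : ℝ) : Set (ℝ × ℝ × ℝ) :=
  {g | 0 < g.1 ∧ 0 < g.2.1 ∧ 0 < g.2.2 ∧ g.1 * g.2.1 * g.2.2 < N ∧ r₁ * g.1 ≤ g.2.2 ∧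
    g.2.1 ≤ g.1 ∧ g.2.2 < r₂ * g.2.1}

lemma auxPos_meas (N r₁ r₂ : ℝ) : MeasurableSet (auxPos N r₁ r₂) := by
  unfold auxPos
  measurability

lemma auxPos_le (N r₁ r₂ M : ℝ) (hr₁ : 0 < r₁) (hr : r₁ < r₂) (hM : 0 < M)
    (h1 : N * r₂ ^ 2 ≤ M ^ 3) (h2 : N * (r₂ / r₁ ^ 2) ≤ M ^ 3) (g : ℝ × ℝ × ℝ)
    (hg : g ∈ auxPos N r₁ r₂) : g.1 ≤ M ∧ g.2.1 ≤ M ∧ g.2.2 ≤ M := by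
  obtain ⟨x, y, z⟩ := g
  obtain ⟨hx, hy, hz, h, a, b, c⟩ := hg
  simp only at *
  have hr₂ : 0 < r₂ := hr₁.trans hr
  have hxM : x ≤ M := by
    refine le_of_pow_le_pow_left₀ three_ne_zero hM.le (le_trans ?_ h2)
    rw [mul_div_assoc', le_div_iff₀ (by positivity)]
    have : (r₁ * x) * (r₁ * x) * x ≤ (r₂ * y) * z * x := by
      exact mul_le_mul_of_nonneg_right
        (mul_le_mul (a.trans c.le) a (by positivity) (by positivity)) hx.le
    nlinarith
  have hzM : z ≤ M := by
    refine le_of_pow_le_pow_left₀ three_ne_zero hM.le (le_trans ?_ h1)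
    have hzx : z ≤ r₂ * x := c.le.trans (mul_le_mul_of_nonneg_left b hr₂.le)
    have : z * z * z ≤ (r₂ * x) * (r₂ * y) * z := by
      gcongr
    nlinarith [mul_pos hr₂ hr₂]
  exact ⟨hxM, b.trans hxM, hzM⟩

lemma auxPos_s₁ (N r₁ r₂ : ℝ) (hr₁ : 0 < r₁) (y z : ℝ) :
    {x | (x, y, z) ∈ auxPos N r₁ r₂}.OrdConnected := by
  constructor
  rintro p ⟨a1, a2, a3, a4, a5, a6, a7⟩ q ⟨b1, b2, b3, b4, b5, b6, b7⟩ w ⟨h1, h2⟩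
  simp only at *
  refine ⟨by simp only; linarith, a2, a3, lt_of_le_of_lt ?_ b4, le_trans ?_ b5,
    by simp only; linarith, a7⟩ <;> simp only <;> gcongr

lemma auxPos_s₂ (N r₁ r₂ : ℝ) (hr₂ : 0 < r₂) (x z : ℝ) :
    {y | (x, y, z) ∈ auxPos N r₁ r₂}.OrdConnected := by
  constructor
  rintro p ⟨a1, a2, a3, a4, a5, a6, a7⟩ q ⟨b1, b2, b3, b4, b5, b6, b7⟩ w ⟨h1, h2⟩
  simp only at *
  refine ⟨a1, by simp only; linarith, a3, lt_of_le_of_lt ?_ b4, a5,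
    by simp only; linarith, lt_of_lt_of_le a7 ?_⟩ <;> simp only <;> gcongr

lemma auxPos_s₃ (N r₁ r₂ : ℝ) (x y : ℝ) :
    {z | (x, y, z) ∈ auxPos N r₁ r₂}.OrdConnected := by
  constructor
  rintro p ⟨a1, a2, a3, a4, a5, a6, a7⟩ q ⟨b1, b2, b3, b4, b5, b6, b7⟩ w ⟨h1, h2⟩
  simp only at *
  refine ⟨a1, a2, by simp only; linarith, lt_of_le_of_lt ?_ b4, by simp only; linarith, a6,
    by simp only; linarith⟩
  simp only
  gcongr

lemma aux_exp_subst (f : ℝ → ENNReal) (hf : ∀ x, x ≤ 0 → f x = 0) :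
    ∫⁻ x, f x = ∫⁻ p, ENNReal.ofReal (Real.exp p) * f (Real.exp p) := by
  have h := lintegral_image_eq_lintegral_abs_deriv_mul (s := Set.univ) (f := Real.exp)
    (f' := Real.exp) MeasurableSet.univ (fun x _ => (Real.hasDerivAt_exp x).hasDerivWithinAt)
    Real.exp_injective.injOn f
  rw [Set.image_univ, Real.range_exp, setLIntegral_univ] at h
  simp only [Real.abs_exp] at h
  rw [← h, ← lintegral_indicator measurableSet_Ioi]
  congr 1
  ext x
  by_cases hx : 0 < x
  · simp [hx]
  · simp [hx, hf x (not_lt.1 hx)]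

lemma aux_scale (N c : ℝ) (hN : 0 < N) :
    ∫⁻ p, (if 3 * p + c < Real.log N then ENNReal.ofReal (Real.exp (3 * p + c)) else 0) =
      ENNReal.ofReal (N / 3) := by
  have e : ∀ p : ℝ, (if 3 * p + c < Real.log N then ENNReal.ofReal (Real.exp (3 * p + c)) else 0) =
      (Set.Iio ((Real.log N - c) / 3)).indicator
        (fun p => ENNReal.ofReal (Real.exp (3 * p) * Real.exp c)) p := by
    intro p
    have : 3 * p + c < Real.log N ↔ p ∈ Set.Iio ((Real.log N - c) / 3) := by
      rw [Set.mem_Iio, lt_div_iff₀ three_pos]; constructor <;> intro h <;> linarith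
    simp only [this, Set.indicator_apply, Real.exp_add]
  simp only [e]
  rw [lintegral_indicator measurableSet_Iio, setLIntegral_congr Iio_ae_eq_Iic]
  have hi := integrableOn_exp_mul_Iic (a := 3) three_pos ((Real.log N - c) / 3)
  rw [← ofReal_integral_eq_lintegral_ofReal (hi.mul_const _)
    (Eventually.of_forall fun x => by positivity), integral_mul_const,
    integral_exp_mul_Iic three_pos]
  congr 1
  rw [mul_div_cancel₀ _ (three_ne_zero), Real.exp_sub, Real.exp_log hN]
  field_simp

lemma aux_tri (l₁ l₂ : ℝ) (h : l₁ ≤ l₂) :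
    ∫⁻ a, ∫⁻ b, (if l₁ ≤ a ∧ a ≤ b ∧ b < l₂ then (1 : ENNReal) else 0) =
      ENNReal.ofReal ((l₂ - l₁) ^ 2 / 2) := by
  have e : ∀ a : ℝ, ∫⁻ b, (if l₁ ≤ a ∧ a ≤ b ∧ b < l₂ then (1 : ENNReal) else 0) =
      (Set.Icc l₁ l₂).indicator (fun a => ENNReal.ofReal (l₂ - a)) a := by
    intro a
    by_cases ha : l₁ ≤ a
    · have : ∀ b, (if l₁ ≤ a ∧ a ≤ b ∧ b < l₂ then (1 : ENNReal) else 0) =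
        (Set.Ico a l₂).indicator 1 b := by
        intro b; simp [ha, Set.indicator_apply]
      simp only [this]
      rw [lintegral_indicator_one measurableSet_Ico, Real.volume_Ico]
      by_cases h2 : a ≤ l₂
      · simp [ha, h2]
      · rw [Set.indicator_of_notMem (by simp [h2])]
        exact ENNReal.ofReal_of_nonpos (by linarith)
    · simp [ha]
  simp only [e]
  rw [lintegral_indicator measurableSet_Icc, ← ofReal_integral_eq_lintegral_ofReal]
  · congr 1
    rw [integral_Icc_eq_integral_Ioc, ← intervalIntegral.integral_of_le h,
      intervalIntegral.integral_sub (by simp) (by simp), intervalIntegral.integral_const,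
      integral_id, smul_eq_mul]
    ring
  · exact (by fun_prop : Continuous fun a : ℝ => l₂ - a).integrableOn_Icc
  · filter_upwards [ae_restrict_mem measurableSet_Icc] with a ha
    exact sub_nonneg.2 ha.2

lemma auxPos_vol (N r₁ r₂ : ℝ) (hN : 0 < N) (hr₁ : 0 < r₁) (hr : r₁ < r₂) :
    volume (auxPos N r₁ r₂) = ENNReal.ofReal (N / 6 * (Real.log r₂ - Real.log r₁) ^ 2) := by
  classical
  have hr₂ : 0 < r₂ := hr₁.trans hr
  set S := auxPos N r₁ r₂ with hSdef
  have hS : MeasurableSet S := auxPos_meas _ _ _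
  set f : ℝ × ℝ × ℝ → ENNReal := S.indicator 1 with hf
  have hfm : Measurable f := measurable_one.indicator hS
  -- integrand in logarithmic coordinates
  have key : ∀ p q t : ℝ, ENNReal.ofReal (Real.exp p) * (ENNReal.ofReal (Real.exp q) *
      (ENNReal.ofReal (Real.exp t) * f (Real.exp p, Real.exp q, Real.exp t))) =
      if p + q + t < Real.log N ∧ Real.log r₁ + p ≤ t ∧ q ≤ p ∧ t < Real.log r₂ + q then
        ENNReal.ofReal (Real.exp (p + q + t)) else 0 := by
    intro p q t
    have hiff : (Real.exp p, Real.exp q, Real.exp t) ∈ S ↔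
      (p + q + t < Real.log N ∧ Real.log r₁ + p ≤ t ∧ q ≤ p ∧ t < Real.log r₂ + q) := by
      simp only [hSdef, auxPos, Set.mem_ofPred_eq, Real.exp_pos, true_and]
      rw [← Real.exp_add, ← Real.exp_add, ← Real.lt_log_iff_exp_lt hN, Real.exp_le_exp]
      nth_rewrite 1 [← Real.exp_log hr₁]
      nth_rewrite 1 [← Real.exp_log hr₂]
      rw [← Real.exp_add, ← Real.exp_add, Real.exp_le_exp, Real.exp_lt_exp]
    simp only [hf, Set.indicator_apply, hiff]
    split_ifs
    · rw [Pi.one_apply, mul_one, ← ENNReal.ofReal_mul (Real.exp_nonneg _),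
        ← ENNReal.ofReal_mul (Real.exp_nonneg _), ← Real.exp_add, ← Real.exp_add, add_assoc]
    · simp
  set G : ℝ → ℝ → ℝ → ENNReal := fun p q t =>
    if p + q + t < Real.log N ∧ Real.log r₁ + p ≤ t ∧ q ≤ p ∧ t < Real.log r₂ + q then
        ENNReal.ofReal (Real.exp (p + q + t)) else 0 with hG
  have hGm : Measurable (fun g : ℝ × ℝ × ℝ => G g.1 g.2.1 g.2.2) := by
    refine Measurable.ite (by measurability) (by fun_prop) measurable_const
  have s1 : volume S = ∫⁻ p, ∫⁻ q, ∫⁻ t, G p q t := by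
    rw [← lintegral_indicator_one hS, Measure.volume_eq_prod, lintegral_prod _ hfm.aemeasurable]
    have i1 : ∀ x : ℝ, ∫⁻ y : ℝ × ℝ, f (x, y) = ∫⁻ q, ∫⁻ t, f (x, q, t) := by
      intro x
      rw [Measure.volume_eq_prod, lintegral_prod]
      exact (hfm.comp measurable_prodMk_left).aemeasurable
    change ∫⁻ x : ℝ, ∫⁻ y : ℝ × ℝ, f (x, y) = _
    simp only [i1]
    rw [aux_exp_subst]
    · congr 1; ext p
      rw [aux_exp_subst, ← lintegral_const_mul']
      · congr 1; ext q
        rw [aux_exp_subst, ← lintegral_const_mul', ← lintegral_const_mul']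
        · congr 1; ext t
          rw [key]
        · exact ENNReal.ofReal_ne_top
        · exact ENNReal.ofReal_ne_top
        · intro x hx
          exact Set.indicator_of_notMem (fun h => absurd h.2.2.1 (not_lt.2 hx)) _
      · exact ENNReal.ofReal_ne_top
      · intro x hx
        have : ∀ t, f (Real.exp p, x, t) = 0 := fun t =>
          Set.indicator_of_notMem (fun h => absurd h.2.1 (not_lt.2 hx)) _
        simp [this]
    · intro x hx
      have : ∀ q t, f (x, q, t) = 0 := fun q t =>
          Set.indicator_of_notMem (fun h => absurd h.1 (not_lt.2 hx)) _
      simp [this]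
  have s2 : ∀ p, ∫⁻ q, ∫⁻ t, G p q t = ∫⁻ a, ∫⁻ b, G p (p + a - b) (p + a) := by
    intro p
    rw [lintegral_lintegral_swap (f := fun q t => G p q t)
      (hGm.comp (f := fun g : ℝ × ℝ => (p, g.1, g.2)) (by fun_prop)).aemeasurable,
      ← lintegral_add_left_eq_self _ p]
    congr 1; ext a
    rw [← lintegral_sub_left_eq_self _ (p + a)]
  have hHm : Measurable (fun g : ℝ × ℝ × ℝ => G g.1 (g.1 + g.2.1 - g.2.2) (g.1 + g.2.1)) :=
    hGm.comp (g := fun g : ℝ × ℝ × ℝ => G g.1 g.2.1 g.2.2)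
      (f := fun g : ℝ × ℝ × ℝ => (g.1, g.1 + g.2.1 - g.2.2, g.1 + g.2.1)) (by fun_prop)
  have s3 : ∫⁻ p, ∫⁻ a, ∫⁻ b, G p (p + a - b) (p + a) =
      ∫⁻ a, ∫⁻ b, ∫⁻ p, G p (p + a - b) (p + a) := by
    rw [lintegral_lintegral_swap]
    · congr 1; ext a
      rw [lintegral_lintegral_swap]
      exact (hHm.comp (f := fun g : ℝ × ℝ => (g.1, a, g.2)) (by fun_prop)).aemeasurable
    · refine Measurable.aemeasurable ?_
      refine Measurable.lintegral_prod_right'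
        (f := fun g : (ℝ × ℝ) × ℝ => G g.1.1 (g.1.1 + g.1.2 - g.2) (g.1.1 + g.1.2)) ?_
      exact hHm.comp (f := fun g : (ℝ × ℝ) × ℝ => (g.1.1, g.1.2, g.2)) (by fun_prop)
  have s4 : ∀ a b, ∫⁻ p, G p (p + a - b) (p + a) =
      ENNReal.ofReal (N / 3) *
        (if Real.log r₁ ≤ a ∧ a ≤ b ∧ b < Real.log r₂ then (1 : ENNReal) else 0) := by
    intro a b
    by_cases h : Real.log r₁ ≤ a ∧ a ≤ b ∧ b < Real.log r₂
    · rw [if_pos h, mul_one, ← aux_scale N (2 * a - b) hN]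
      congr 1; ext p
      simp only [hG]
      have e1 : p + (p + a - b) + (p + a) = 3 * p + (2 * a - b) := by ring
      rw [e1]
      have : (3 * p + (2 * a - b) < Real.log N ∧ Real.log r₁ + p ≤ p + a ∧ p + a - b ≤ p ∧
        p + a < Real.log r₂ + (p + a - b)) ↔ 3 * p + (2 * a - b) < Real.log N := by
        refine and_iff_left ⟨?_, ?_, ?_⟩ <;> linarith [h.1, h.2.1, h.2.2]
      simp only [this]
    · rw [if_neg h, mul_zero]
      have : ∀ p, G p (p + a - b) (p + a) = 0 := by
        intro p
        refine if_neg fun h' => h ⟨?_, ?_, ?_⟩ <;> linarith [h'.2.1, h'.2.2.1, h'.2.2.2]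
      simp [this]
  rw [s1]
  simp only [s2]
  rw [s3]
  simp only [s4]
  simp only [lintegral_const_mul' _ _ ENNReal.ofReal_ne_top]
  rw [aux_tri _ _ (Real.log_le_log hr₁ hr.le), ← ENNReal.ofReal_mul (by positivity)]
  congr 1
  ring

lemma aux_region_iff (N r₁ r₂ x y z : ℝ) :
    (x, y, z) ∈ regionR N r₁ r₂ ↔ (|x|, |y|, |z|) ∈ auxPos N r₁ r₂ := by
  simp only [regionR, auxPos, Set.mem_ofPred_eq, abs_mul, abs_div, mul_ne_zero_iff, abs_pos]
  by_cases hx : x = 0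
  · simp [hx]
  by_cases hy : y = 0
  · simp [hy]
  by_cases hz : z = 0
  · simp [hz]
  have hx' := abs_pos.2 hx
  have hy' := abs_pos.2 hy
  have hz' := abs_pos.2 hz
  rw [le_div_iff₀ hx', div_lt_iff₀ hy', div_le_div_iff_of_pos_left hz' hx' hy']
  simp [hx, hy, hz]

lemma aux_class (n : ℕ) (e : ℤˣ) (a : ZMod n) (v : ℤ) (hv : (v : ZMod n) = ((e : ℤ) : ZMod n) * a)
    (m : ℤ) (hm : 0 < m) :
    signUnit ((e : ℤ) * m) = e ∧ ((((e : ℤ) * m : ℤ) : ZMod n) = a ↔ m ≡ v [ZMOD n]) := by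
  rw [← ZMod.intCast_eq_intCast_iff, hv]
  rcases Int.units_eq_one_or e with rfl | rfl
  · simp [signUnit, hm]
  · simp [signUnit, hm.le, neg_eq_iff_eq_neg]

lemma aux_class' (g : ℤ) : g = (signUnit g : ℤ) * |g| := by
  unfold signUnit
  split_ifs with h
  · simp [abs_of_pos h]
  · simp [abs_of_nonpos (not_lt.1 h)]

def auxCls (n : ℕ) (g : ℤ × ℤ × ℤ) : (ℤˣ × ZMod n) × (ℤˣ × ZMod n) × (ℤˣ × ZMod n) :=
  ((signUnit g.1, (g.1 : ZMod n)), (signUnit g.2.1, (g.2.1 : ZMod n)),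
    (signUnit g.2.2, (g.2.2 : ZMod n)))

def auxT (n : ℕ) (N r₁ r₂ : ℝ) (κ : (ℤˣ × ZMod n) × (ℤˣ × ZMod n) × (ℤˣ × ZMod n)) :
    Set (ℤ × ℤ × ℤ) :=
  {g | ((g.1 : ℝ), (g.2.1 : ℝ), (g.2.2 : ℝ)) ∈ regionR N r₁ r₂ ∧ auxCls n g = κ}

lemma auxT_eq (n : ℕ) (N r₁ r₂ M : ℝ)
    (hM : ∀ g ∈ auxPos N r₁ r₂, g.1 ≤ M ∧ g.2.1 ≤ M ∧ g.2.2 ≤ M)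
    (κ : (ℤˣ × ZMod n) × (ℤˣ × ZMod n) × (ℤˣ × ZMod n)) :
    ∃ v₁ v₂ v₃ : ℤ, (auxT n N r₁ r₂ κ).Finite ∧ (auxT n N r₁ r₂ κ).ncard =
      Set.ncard {g : ℤ × ℤ × ℤ | g ∈ auxA n v₁ M ×ˢ auxA n v₂ M ×ˢ auxA n v₃ M ∧
        ((g.1 : ℝ), (g.2.1 : ℝ), (g.2.2 : ℝ)) ∈ auxPos N r₁ r₂} := by
  obtain ⟨⟨e₁, a₁⟩, ⟨e₂, a₂⟩, ⟨e₃, a₃⟩⟩ := κ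
  obtain ⟨v₁, hv₁⟩ := ZMod.intCast_surjective (((e₁ : ℤ) : ZMod n) * a₁)
  obtain ⟨v₂, hv₂⟩ := ZMod.intCast_surjective (((e₂ : ℤ) : ZMod n) * a₂)
  obtain ⟨v₃, hv₃⟩ := ZMod.intCast_surjective (((e₃ : ℤ) : ZMod n) * a₃)
  refine ⟨v₁, v₂, v₃, ?_⟩
  set U := {g : ℤ × ℤ × ℤ | g ∈ auxA n v₁ M ×ˢ auxA n v₂ M ×ˢ auxA n v₃ M ∧
        ((g.1 : ℝ), (g.2.1 : ℝ), (g.2.2 : ℝ)) ∈ auxPos N r₁ r₂} with hU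
  have hUf : U.Finite := (Finset.finite_toSet (auxA n v₁ M ×ˢ auxA n v₂ M ×ˢ auxA n v₃ M)).subset
    fun g hg => hg.1
  set φ : ℤ × ℤ × ℤ → ℤ × ℤ × ℤ := fun m => ((e₁ : ℤ) * m.1, (e₂ : ℤ) * m.2.1, (e₃ : ℤ) * m.2.2)
    with hφ
  have hinj : Function.Injective φ := by
    rintro ⟨x, y, z⟩ ⟨x', y', z'⟩ h
    simp only [hφ, Prod.mk.injEq] at h
    obtain ⟨h1, h2, h3⟩ := h
    rw [mul_left_cancel₀ e₁.ne_zero h1, mul_left_cancel₀ e₂.ne_zero h2,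
      mul_left_cancel₀ e₃.ne_zero h3]
  have habs : ∀ (e : ℤˣ) (m : ℤ), |(((e : ℤ) * m : ℤ) : ℝ)| = |(m : ℝ)| := by
    intro e m
    rcases Int.units_eq_one_or e with rfl | rfl <;> simp
  have himg : auxT n N r₁ r₂ ((e₁, a₁), (e₂, a₂), (e₃, a₃)) = φ '' U := by
    ext ⟨x, y, z⟩
    constructor
    · rintro ⟨h, hc⟩
      rw [aux_region_iff] at h
      simp only at h
      simp only [auxCls, Prod.mk.injEq] at hc
      obtain ⟨⟨s₁, c₁⟩, ⟨s₂, c₂⟩, ⟨s₃, c₃⟩⟩ := hc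
      have p₁ : 0 < |x| := by have := h.1; simp only at this; exact_mod_cast this
      have p₂ : 0 < |y| := by have := h.2.1; simp only at this; exact_mod_cast this
      have p₃ : 0 < |z| := by have := h.2.2.1; simp only at this; exact_mod_cast this
      have q₁ := aux_class' x
      have q₂ := aux_class' y
      have q₃ := aux_class' z
      rw [s₁] at q₁
      rw [s₂] at q₂
      rw [s₃] at q₃
      have b := hM _ h
      simp only at b
      refine ⟨(|x|, |y|, |z|), ⟨?_, by push_cast; exact h⟩, ?_⟩
      · simp only [Finset.mem_product, auxA, Finset.mem_filter, Finset.mem_Ioc, Int.le_floor,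
          Int.cast_abs]
        refine ⟨⟨⟨p₁, b.1⟩, ?_⟩, ⟨⟨p₂, b.2.1⟩, ?_⟩, ⟨⟨p₃, b.2.2⟩, ?_⟩⟩
        · exact (aux_class n e₁ a₁ v₁ hv₁ _ p₁).2.1 (by rw [← q₁]; exact c₁)
        · exact (aux_class n e₂ a₂ v₂ hv₂ _ p₂).2.1 (by rw [← q₂]; exact c₂)
        · exact (aux_class n e₃ a₃ v₃ hv₃ _ p₃).2.1 (by rw [← q₃]; exact c₃)
      · simp only [hφ]
        rw [← q₁, ← q₂, ← q₃]
    · rintro ⟨⟨m₁, m₂, m₃⟩, ⟨h1, h2⟩, h3⟩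
      rw [← h3]
      simp only [Finset.mem_product, auxA, Finset.mem_filter, Finset.mem_Ioc] at h1
      obtain ⟨⟨⟨p₁, -⟩, k₁⟩, ⟨⟨p₂, -⟩, k₂⟩, ⟨⟨p₃, -⟩, k₃⟩⟩ := h1
      refine ⟨?_, ?_⟩
      · rw [aux_region_iff]
        simp only [hφ, habs]
        simpa only [abs_of_pos h2.1, abs_of_pos h2.2.1, abs_of_pos h2.2.2.1] using h2
      · have t₁ := aux_class n e₁ a₁ v₁ hv₁ _ p₁
        have t₂ := aux_class n e₂ a₂ v₂ hv₂ _ p₂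
        have t₃ := aux_class n e₃ a₃ v₃ hv₃ _ p₃
        simp only [auxCls, hφ]
        rw [t₁.1, t₂.1, t₃.1, t₁.2.2 k₁, t₂.2.2 k₂, t₃.2.2 k₃]
  rw [himg]
  exact ⟨hUf.image _, Set.ncard_image_of_injective _ hinj⟩

lemma auxT_bound (n : ℕ) (hn : 1 ≤ n) (N r₁ r₂ M : ℝ) (hN : 0 < N) (hr₁ : 0 < r₁) (hr : r₁ < r₂)
    (hM0 : 0 < M) (h1 : N * r₂ ^ 2 ≤ M ^ 3) (h2 : N * (r₂ / r₁ ^ 2) ≤ M ^ 3)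
    (κ : (ℤˣ × ZMod n) × (ℤˣ × ZMod n) × (ℤˣ × ZMod n)) :
    (auxT n N r₁ r₂ κ).Finite ∧
    |(n : ℝ) ^ 3 * (auxT n N r₁ r₂ κ).ncard - N / 6 * (Real.log r₂ - Real.log r₁) ^ 2| ≤
      3 * (3 * n) * (M + 3 * n) ^ 2 := by
  have hM := auxPos_le N r₁ r₂ M hr₁ hr hM0 h1 h2
  obtain ⟨v₁, v₂, v₃, hfin, hcard⟩ := auxT_eq n N r₁ r₂ M hM κ
  refine ⟨hfin, ?_⟩
  have hS := auxPos_meas N r₁ r₂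
  rw [hcard, ← auxDisc_prod3 n _ _ _ _ hS]
  have hvol : (((volume : Measure ℝ).restrict (Set.Ioc 0 M)).prod
      (((volume : Measure ℝ).restrict (Set.Ioc 0 M)).prod
        ((volume : Measure ℝ).restrict (Set.Ioc 0 M)))).real (auxPos N r₁ r₂) =
      N / 6 * (Real.log r₂ - Real.log r₁) ^ 2 := by
    rw [Measure.prod_restrict, Measure.prod_restrict, measureReal_restrict_apply hS,
      Set.inter_eq_left.2, ← Measure.volume_eq_prod, ← Measure.volume_eq_prod, measureReal_def,
      auxPos_vol N r₁ r₂ hN hr₁ hr, ENNReal.toReal_ofReal (by positivity)]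
    intro g hg
    obtain ⟨b1, b2, b3⟩ := hM g hg
    exact ⟨⟨hg.1, b1⟩, ⟨hg.2.1, b2⟩, ⟨hg.2.2.1, b3⟩⟩
  rw [← hvol]
  refine aux_three _ _ _ _ (3 * n) M (by positivity) hM0.le
    (fun I hI => auxDisc_close n hn v₁ M I hI)
    (fun I hI => auxDisc_close n hn v₂ M I hI) (fun I hI => auxDisc_close n hn v₃ M I hI) ?_ _ hS
    (auxPos_s₁ N r₁ r₂ hr₁) (auxPos_s₂ N r₁ r₂ (hr₁.trans hr)) (auxPos_s₃ N r₁ r₂)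
  simp [measureReal_def, hM0.le]

lemma aux_sum (n : ℕ) (hn : 1 ≤ n)
    (C : Finset ((ℤˣ × ZMod n) × (ℤˣ × ZMod n) × (ℤˣ × ZMod n)))
    (N r₁ r₂ V E : ℝ)
    (h : ∀ κ, (auxT n N r₁ r₂ κ).Finite ∧ |(n : ℝ) ^ 3 * (auxT n N r₁ r₂ κ).ncard - V| ≤ E) :
    |(Nat.card {g : ℤ × ℤ × ℤ //
            ((g.1 : ℝ), (g.2.1 : ℝ), (g.2.2 : ℝ)) ∈ regionR N r₁ r₂ ∧
            ¬ inCond n C g} : ℝ) - 8 * (1 - (C.card : ℝ) / (8 * (n : ℝ) ^ 3)) * V| ≤ 8 * E := by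
  classical
  haveI : NeZero n := ⟨by omega⟩
  have hn0 : (0 : ℝ) < n := by exact_mod_cast hn
  set X : Set (ℤ × ℤ × ℤ) := {g | ((g.1 : ℝ), (g.2.1 : ℝ), (g.2.2 : ℝ)) ∈ regionR N r₁ r₂ ∧
            ¬ inCond n C g} with hX
  have hXf : X.Finite := by
    refine (Set.finite_iUnion (fun κ => (h κ).1)).subset fun g hg => ?_
    exact Set.mem_iUnion.2 ⟨auxCls n g, hg.1, rfl⟩
  have hc : Nat.card {g : ℤ × ℤ × ℤ //
            ((g.1 : ℝ), (g.2.1 : ℝ), (g.2.2 : ℝ)) ∈ regionR N r₁ r₂ ∧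
            ¬ inCond n C g} = ∑ κ ∈ Cᶜ, (auxT n N r₁ r₂ κ).ncard := by
    change X.ncard = _
    rw [Set.ncard_eq_toFinset_card X hXf,
      Finset.card_eq_sum_card_fiberwise (f := auxCls n) (t := Cᶜ)]
    · refine Finset.sum_congr rfl fun κ hκ => ?_
      rw [← Set.ncard_coe_finset]
      congr 1
      ext g
      simp only [Finset.coe_filter, Set.Finite.mem_toFinset, Set.mem_ofPred_eq, auxT, hX]
      constructor
      · rintro ⟨⟨a, b⟩, c⟩
        exact ⟨a, c⟩
      · rintro ⟨a, c⟩
        refine ⟨⟨a, fun hin => ?_⟩, c⟩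
        exact (Finset.mem_compl.1 hκ) (c ▸ hin)
    · intro g hg
      have hg' : g ∈ X := by simpa using hg
      simp only [Finset.coe_compl, Set.mem_compl_iff, Finset.mem_coe]
      exact hg'.2
  have hK : (Cᶜ.card : ℝ) = 8 * (n : ℝ) ^ 3 - C.card := by
    have h1 := Finset.card_compl_add_card C
    have h2 : Fintype.card ((ℤˣ × ZMod n) × (ℤˣ × ZMod n) × (ℤˣ × ZMod n)) = 8 * n ^ 3 := by
      simp only [Fintype.card_prod, ZMod.card, Fintype.card_units_int]
      ring
    rw [h2] at h1
    have : ((Cᶜ.card + C.card : ℕ) : ℝ) = ((8 * n ^ 3 : ℕ) : ℝ) := by rw [h1]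
    push_cast at this
    linarith
  have hE : 0 ≤ E := (abs_nonneg _).trans (h ((1, 0), (1, 0), (1, 0))).2
  have hb : |∑ κ ∈ Cᶜ, ((n : ℝ) ^ 3 * ((auxT n N r₁ r₂ κ).ncard : ℝ) - V)| ≤ Cᶜ.card * E := by
    refine (Finset.abs_sum_le_sum_abs _ _).trans ?_
    rw [← nsmul_eq_mul]
    exact Finset.sum_le_card_nsmul _ _ _ fun κ _ => (h κ).2
  rw [Finset.sum_sub_distrib, ← Finset.mul_sum, Finset.sum_const, nsmul_eq_mul] at hb
  have hb2 : (Cᶜ.card : ℝ) * E ≤ 8 * (n : ℝ) ^ 3 * E := by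
    gcongr
    rw [hK]
    linarith [(Nat.cast_nonneg C.card : (0 : ℝ) ≤ C.card)]
  rw [hc]
  push_cast
  set Q := ∑ κ ∈ Cᶜ, ((auxT n N r₁ r₂ κ).ncard : ℝ)
  have hn3 : (0 : ℝ) < (n : ℝ) ^ 3 := by positivity
  have e : (n : ℝ) ^ 3 * Q - Cᶜ.card * V =
      (n : ℝ) ^ 3 * (Q - 8 * (1 - (C.card : ℝ) / (8 * (n : ℝ) ^ 3)) * V) := by
    rw [hK]; field_simp
  rw [e, abs_mul, abs_of_pos hn3] at hb
  have := hb.trans hb2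
  refine le_of_mul_le_mul_left ?_ hn3
  linarith

/-- For fixed `n ≥ 1`, `C ⊆ ({±1} × ℤ/nℤ)³` and `0 < r₁ < r₂`, as `N → ∞`,
the number of integer triples in `R(N, r₁, r₂)` that are not in `C` equals
`(4/3)·(1 − #C/(8n³))·N·(log r₂ − log r₁)² + O(N^{2/3})`. -/
theorem stmt3 (n : ℕ) (hn : 1 ≤ n)
    (C : Finset ((ℤˣ × ZMod n) × (ℤˣ × ZMod n) × (ℤˣ × ZMod n)))
    (r₁ r₂ : ℝ) (hr₁ : 0 < r₁) (hr : r₁ < r₂) :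
    (fun N : ℝ =>
        (Nat.card {g : ℤ × ℤ × ℤ //
            ((g.1 : ℝ), (g.2.1 : ℝ), (g.2.2 : ℝ)) ∈ regionR N r₁ r₂ ∧
            ¬ inCond n C g} : ℝ) -
          4 / 3 * (1 - (C.card : ℝ) / (8 * (n : ℝ) ^ 3)) * N *
            (Real.log r₂ - Real.log r₁) ^ 2)
      =O[atTop] fun N : ℝ => N ^ ((2 : ℝ) / 3) := by
  have hr₂ : 0 < r₂ := hr₁.trans hr
  set K : ℝ := 1 + r₂ ^ 2 + r₂ / r₁ ^ 2 with hK
  have hq : 0 < r₂ / r₁ ^ 2 := by positivity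
  have hK1 : 1 ≤ K := by rw [hK]; nlinarith [sq_nonneg r₂]
  have hKK : K ≤ K ^ 3 := by
    nlinarith [mul_le_mul hK1 hK1 zero_le_one (by linarith)]
  have hn0 : (1 : ℝ) ≤ n := by exact_mod_cast hn
  refine IsBigO.of_bound (8 * (3 * (3 * n) * ((1 + 3 * n) * K) ^ 2)) ?_
  filter_upwards [eventually_ge_atTop (1 : ℝ)] with N hN
  have hN0 : 0 < N := by linarith
  set M : ℝ := K * N ^ ((1 : ℝ) / 3) with hM
  have hP1 : 1 ≤ N ^ ((1 : ℝ) / 3) := Real.one_le_rpow hN (by norm_num)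
  have hP3 : (N ^ ((1 : ℝ) / 3)) ^ 3 = N := by
    rw [← Real.rpow_natCast, ← Real.rpow_mul hN0.le]; norm_num
  have hP2 : (N ^ ((1 : ℝ) / 3)) ^ 2 = N ^ ((2 : ℝ) / 3) := by
    rw [← Real.rpow_natCast, ← Real.rpow_mul hN0.le]; norm_num
  have hM1 : 1 ≤ M := by rw [hM]; nlinarith
  have hM3 : M ^ 3 = N * K ^ 3 := by rw [hM, mul_pow, hP3]; ring
  have h1 : N * r₂ ^ 2 ≤ M ^ 3 := by
    rw [hM3]; gcongr; rw [hK] at hKK ⊢; linarith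
  have h2 : N * (r₂ / r₁ ^ 2) ≤ M ^ 3 := by
    rw [hM3]; gcongr; refine le_trans ?_ hKK; rw [hK]; nlinarith [sq_nonneg r₂]
  have hb := aux_sum n hn C N r₁ r₂ _ _
    (auxT_bound n hn N r₁ r₂ M hN0 hr₁ hr (by linarith) h1 h2)
  have e : 8 * (1 - (C.card : ℝ) / (8 * (n : ℝ) ^ 3)) *
      (N / 6 * (Real.log r₂ - Real.log r₁) ^ 2) =
      4 / 3 * (1 - (C.card : ℝ) / (8 * (n : ℝ) ^ 3)) * N *
            (Real.log r₂ - Real.log r₁) ^ 2 := by ring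
  rw [e] at hb
  rw [Real.norm_eq_abs, Real.norm_of_nonneg (by positivity)]
  refine hb.trans ?_
  have h3 : M + 3 * n ≤ (1 + 3 * n) * M := by nlinarith
  calc 8 * (3 * (3 * (n : ℝ)) * (M + 3 * n) ^ 2)
      ≤ 8 * (3 * (3 * (n : ℝ)) * ((1 + 3 * n) * M) ^ 2) := by gcongr
    _ = _ := by rw [← hP2, hM]; ring
end

section
/- Fix real numbers 0 < r₁ < r₂. Then, as N → ∞, the number of triples (g₁, g₂, g₃) ∈ ℤ³ lying in R(N, r₁, r₂) such that each gᵢ is squarefree, the gᵢ are pairwise coprime (gcd(gᵢ, gⱼ) = 1 for i ≠ j), at most one of g₁, g₂, g₃ is negative, and either g₁ ≡ g₂ ≡ g₃ ≡ 1 (mod 4) or g₁ ≡ g₂ ≡ g₃ ≡ 3 (mod 4), equals (1/48)·P·N·(log r₂ − log r₁)² + o(N). -/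
open Filter Asymptotics

open MeasureTheory Topology

/-- The sampling point attached to the lattice index `h`. -/
noncomputable def latPt (M : ℝ) (q : ℕ) (a h : ℤ × ℤ × ℤ) : ℝ × ℝ × ℝ :=
  ((((a.1 + q * h.1 : ℤ) : ℝ)) / M, (((a.2.1 + q * h.2.1 : ℤ) : ℝ)) / M,
    (((a.2.2 + q * h.2.2 : ℤ) : ℝ)) / M)

/-- The index of the lattice cell containing `x`. -/
noncomputable def latIdx (M : ℝ) (q : ℕ) (a : ℤ × ℤ × ℤ) (x : ℝ × ℝ × ℝ) : ℤ × ℤ × ℤ :=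
  (⌊(M * x.1 - a.1) / q⌋, ⌊(M * x.2.1 - a.2.1) / q⌋, ⌊(M * x.2.2 - a.2.2) / q⌋)

lemma measurable_latIdx (M : ℝ) (q : ℕ) (a : ℤ × ℤ × ℤ) : Measurable (latIdx M q a) := by
  unfold latIdx
  fun_prop

lemma floor_cell {M : ℝ} (hM : 0 < M) {q : ℕ} (hq : 0 < q) (a h : ℤ) (x : ℝ) :
    ⌊(M * x - a) / q⌋ = h ↔ x ∈ Set.Ico ((a + q * h) / M) ((a + q * h) / M + q / M) := by
  have hq' : (0 : ℝ) < q := by exact_mod_cast hq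
  rw [Int.floor_eq_iff, le_div_iff₀ hq', div_lt_iff₀ hq', Set.mem_Ico, div_le_iff₀ hM,
    ← add_div, lt_div_iff₀ hM]
  constructor <;> rintro ⟨h1, h2⟩ <;> constructor <;> nlinarith

lemma volume_cell {M : ℝ} (hM : 0 < M) {q : ℕ} (hq : 0 < q) (a h : ℤ × ℤ × ℤ) :
    volume (latIdx M q a ⁻¹' {h}) = ENNReal.ofReal ((q / M) ^ 3) := by
  have : latIdx M q a ⁻¹' {h} =
      Set.Ico ((a.1 + q * h.1) / M) ((a.1 + q * h.1) / M + q / M) ×ˢ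
      Set.Ico ((a.2.1 + q * h.2.1) / M) ((a.2.1 + q * h.2.1) / M + q / M) ×ˢ
      Set.Ico ((a.2.2 + q * h.2.2) / M) ((a.2.2 + q * h.2.2) / M + q / M) := by
    ext x
    simp only [Set.mem_preimage, Set.mem_singleton_iff, Set.mem_prod, latIdx, Prod.ext_iff,
      floor_cell hM hq]
  have h0 : (0 : ℝ) ≤ q / M := by positivity
  rw [this, Measure.volume_eq_prod, Measure.prod_prod, Measure.volume_eq_prod, Measure.prod_prod]
  simp only [Real.volume_Ico, add_sub_cancel_left]
  rw [← ENNReal.ofReal_mul h0, ← ENNReal.ofReal_mul h0]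
  congr 1; ring

lemma dist_latPt {M : ℝ} (hM : 0 < M) {q : ℕ} (hq : 0 < q) (a : ℤ × ℤ × ℤ) (x : ℝ × ℝ × ℝ) :
    dist (latPt M q a (latIdx M q a x)) x ≤ q / M := by
  have key : ∀ (a : ℤ) (x : ℝ), dist (((a + q * ⌊(M * x - a) / q⌋ : ℤ) : ℝ) / M) x ≤ q / M := by
    intro a x
    have := (floor_cell hM hq a ⌊(M * x - a) / q⌋ x).1 rfl
    rw [Real.dist_eq, abs_le]
    push_cast
    have h0 : (0 : ℝ) ≤ q / M := by positivity
    constructor <;> linarith [this.1, this.2]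
  rw [Prod.dist_eq, Prod.dist_eq]
  exact max_le (key _ _) (max_le (key _ _) (key _ _))

lemma finite_lat {s : Set (ℝ × ℝ × ℝ)} (hs : Bornology.IsBounded s) {M : ℝ} (hM : 0 < M)
    {q : ℕ} (hq : 0 < q) (a : ℤ × ℤ × ℤ) : {h | latPt M q a h ∈ s}.Finite := by
  obtain ⟨C, hC⟩ := hs.subset_closedBall 0
  have hq' : (0 : ℝ) < q := by exact_mod_cast hq
  have key : ∀ a h : ℤ, |(((a + q * h : ℤ) : ℝ)) / M| ≤ C →
      h ∈ Set.Icc (-⌈|(a : ℝ)| + C * M⌉) ⌈|(a : ℝ)| + C * M⌉ := by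
    intro a h hh
    rw [abs_div, abs_of_pos hM, div_le_iff₀ hM] at hh
    push_cast at hh
    have h1 : |(h : ℝ)| ≤ |(a : ℝ)| + C * M := by
      have h2 : |(q : ℝ) * h| ≤ |(a : ℝ)| + C * M := by
        have := abs_sub (a + q * h : ℝ) a
        rw [add_sub_cancel_left] at this
        linarith
      rw [abs_mul, abs_of_pos hq'] at h2
      have : (1 : ℝ) ≤ q := by exact_mod_cast hq
      nlinarith [abs_nonneg (h : ℝ)]
    have h3 : (|h| : ℤ) ≤ ⌈|(a : ℝ)| + C * M⌉ := by
      have := h1.trans (Int.le_ceil _)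
      exact_mod_cast this
    exact abs_le.1 h3
  refine ((Set.finite_Icc _ _).prod ((Set.finite_Icc _ _).prod (Set.finite_Icc _ _))).subset
    (s := Set.Icc (-⌈|(a.1 : ℝ)| + C * M⌉) ⌈|(a.1 : ℝ)| + C * M⌉ ×ˢ
      Set.Icc (-⌈|(a.2.1 : ℝ)| + C * M⌉) ⌈|(a.2.1 : ℝ)| + C * M⌉ ×ˢ
      Set.Icc (-⌈|(a.2.2 : ℝ)| + C * M⌉) ⌈|(a.2.2 : ℝ)| + C * M⌉) ?_
  intro h hh
  have := hC hh
  rw [mem_closedBall_zero_iff, Prod.norm_def, Prod.norm_def] at this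
  simp only [max_le_iff, Real.norm_eq_abs, latPt] at this
  exact ⟨key _ _ this.1, key _ _ this.2.1, key _ _ this.2.2⟩

lemma volume_sample {s : Set (ℝ × ℝ × ℝ)} (hs : Bornology.IsBounded s) {M : ℝ} (hM : 0 < M)
    {q : ℕ} (hq : 0 < q) (a : ℤ × ℤ × ℤ) :
    volume {x | latPt M q a (latIdx M q a x) ∈ s} =
      ENNReal.ofReal ({h | latPt M q a h ∈ s}.ncard * (q / M) ^ 3) := by
  have hf := finite_lat hs hM hq a
  have h1 : {x | latPt M q a (latIdx M q a x) ∈ s} = latIdx M q a ⁻¹' (hf.toFinset : Set _) := by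
    ext x; simp
  rw [h1, ← sum_measure_preimage_singleton _ (fun y _ => measurable_latIdx M q a (measurableSet_singleton y))]
  simp only [volume_cell hM hq, Finset.sum_const, nsmul_eq_mul]
  rw [Set.ncard_eq_toFinset_card _ hf, ENNReal.ofReal_mul (by positivity), ENNReal.ofReal_natCast]

lemma tendsto_lat {s : Set (ℝ × ℝ × ℝ)} (hs : Bornology.IsBounded s) (hsm : MeasurableSet s)
    (hfr : volume (frontier s) = 0) {q : ℕ} (hq : 0 < q) (a : ℤ × ℤ × ℤ) :
    Tendsto (fun M : ℝ => ({h | latPt M q a h ∈ s}.ncard : ℝ) / M ^ 3) atTop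
      (𝓝 ((volume s).toReal / q ^ 3)) := by
  have hq' : (0 : ℝ) < q := by exact_mod_cast hq
  obtain ⟨C, hC⟩ := hs.subset_closedBall 0
  have hvol : volume s ≠ ⊤ := hs.measure_lt_top.ne
  have main : Tendsto (fun M : ℝ => volume {x | latPt M q a (latIdx M q a x) ∈ s}) atTop
      (𝓝 (volume s)) := by
    refine tendsto_measure_of_ae_tendsto_indicator atTop hsm ?_
      (B := Metric.closedBall 0 (C + q)) measurableSet_closedBall
      (isCompact_closedBall _ _).measure_lt_top.ne ?_ ?_
    · intro M
      exact (measurable_latIdx M q a) (MeasurableSet.of_discrete (s := {h | latPt M q a h ∈ s}))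
    · filter_upwards [eventually_ge_atTop 1] with M hM x hx
      have h1 := dist_latPt (by linarith) hq a x (M := M)
      have h2 := hC hx
      rw [Metric.mem_closedBall] at h2 ⊢
      have h3 : (q : ℝ) / M ≤ q := div_le_self hq'.le hM
      have := dist_triangle_left x 0 (latPt M q a (latIdx M q a x))
      linarith
    · have : ∀ᵐ x ∂(volume : Measure (ℝ × ℝ × ℝ)), x ∉ frontier s := by
        rw [ae_iff]; simpa using hfr
      filter_upwards [this] with x hx
      have ht : Tendsto (fun M : ℝ => latPt M q a (latIdx M q a x)) atTop (𝓝 x) := by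
        rw [tendsto_iff_dist_tendsto_zero]
        refine squeeze_zero' (Eventually.of_forall fun _ => dist_nonneg) ?_
          (tendsto_const_nhds.div_atTop tendsto_id : Tendsto (fun M : ℝ => (q : ℝ) / M) atTop (𝓝 0))
        filter_upwards [eventually_gt_atTop 0] with M hM
        exact dist_latPt hM hq a x
      by_cases hxs : x ∈ s
      · have : x ∈ interior s := by
          by_contra hcon
          exact hx ⟨subset_closure hxs, hcon⟩
        filter_upwards [ht (mem_interior_iff_mem_nhds.1 this)] with M hM
        exact ⟨fun _ => hxs, fun _ => hM⟩
      · have : x ∈ (closure s)ᶜ := by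
          intro hcon
          exact hx ⟨hcon, fun h => hxs (interior_subset h)⟩
        filter_upwards [ht (isClosed_closure.isOpen_compl.mem_nhds this)] with M hM
        exact ⟨fun h => absurd (subset_closure h) hM, fun h => absurd h hxs⟩
  have main2 := ((ENNReal.tendsto_toReal hvol).comp main).div_const ((q : ℝ) ^ 3)
  refine main2.congr' ?_
  filter_upwards [eventually_gt_atTop 0] with M hM
  simp only [Function.comp]
  rw [volume_sample hs hM hq, ENNReal.toReal_ofReal (by positivity)]
  field_simp

/-- Reduction of an integer triple modulo `q`. -/
def castT (q : ℕ) (g : ℤ × ℤ × ℤ) : ZMod q × ZMod q × ZMod q :=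
  ((g.1 : ZMod q), (g.2.1 : ZMod q), (g.2.2 : ZMod q))

/-- Scaling an integer triple. -/
noncomputable def scalePt (M : ℝ) (g : ℤ × ℤ × ℤ) : ℝ × ℝ × ℝ :=
  ((g.1 : ℝ) / M, (g.2.1 : ℝ) / M, (g.2.2 : ℝ) / M)

/-- `D` is a union of `c` residue classes modulo `q`. -/
def IsPer (D : Set (ℤ × ℤ × ℤ)) (q c : ℕ) : Prop :=
  ∃ A : Finset (ZMod q × ZMod q × ZMod q), (∀ g, g ∈ D ↔ castT q g ∈ A) ∧ A.card = c

lemma latPt_one_zero (M : ℝ) (g : ℤ × ℤ × ℤ) : latPt M 1 0 g = scalePt M g := by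
  simp [latPt, scalePt]

lemma finite_scale {s : Set (ℝ × ℝ × ℝ)} (hs : Bornology.IsBounded s) {M : ℝ} (hM : 0 < M) :
    {g | scalePt M g ∈ s}.Finite := by
  simpa only [latPt_one_zero] using finite_lat hs hM one_pos 0

lemma ncard_fiber (s : Set (ℝ × ℝ × ℝ)) (M : ℝ) {q : ℕ} (hq : 0 < q)
    (a : ZMod q × ZMod q × ZMod q) :
    {g | castT q g = a ∧ scalePt M g ∈ s}.ncard =
      {h | latPt M q ((a.1.val : ℤ), (a.2.1.val : ℤ), (a.2.2.val : ℤ)) h ∈ s}.ncard := by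
  have : NeZero q := ⟨hq.ne'⟩
  have hq' : (q : ℤ) ≠ 0 := by exact_mod_cast hq.ne'
  have key : ∀ (b : ZMod q) (g : ℤ), (g : ZMod q) = b ↔ ∃ h : ℤ, (b.val : ℤ) + q * h = g := by
    intro b g
    have hb : (((b.val : ℤ) : ℤ) : ZMod q) = b := by simp
    have : (g : ZMod q) = b ↔ (((b.val : ℤ) : ℤ) : ZMod q) = (g : ZMod q) := by
      rw [hb, eq_comm]
    rw [this, ZMod.intCast_eq_intCast_iff_dvd_sub]
    constructor
    · rintro ⟨h, hh⟩; exact ⟨h, by linarith⟩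
    · rintro ⟨h, hh⟩; exact ⟨h, by linarith⟩
  let F : ℤ × ℤ × ℤ → ℤ × ℤ × ℤ := fun h =>
    ((a.1.val : ℤ) + q * h.1, (a.2.1.val : ℤ) + q * h.2.1, (a.2.2.val : ℤ) + q * h.2.2)
  have hF : Function.Injective F := by
    rintro ⟨x, y, z⟩ ⟨x', y', z'⟩ h
    simp only [F, Prod.mk.injEq, add_right_inj, mul_eq_mul_left_iff, hq', or_false] at h
    simp [h]
  rw [← Set.ncard_image_of_injective {h | latPt M q _ h ∈ s} hF]
  congr 1
  ext g
  constructor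
  · rintro ⟨h1, h2⟩
    simp only [castT, Prod.ext_iff] at h1
    obtain ⟨x, hx⟩ := (key _ _).1 h1.1
    obtain ⟨y, hy⟩ := (key _ _).1 h1.2.1
    obtain ⟨z, hz⟩ := (key _ _).1 h1.2.2
    refine ⟨(x, y, z), ?_, ?_⟩
    · simp only [Set.mem_ofPred_eq, latPt]
      rw [hx, hy, hz]
      exact h2
    · simp only [F, hx, hy, hz]
  · rintro ⟨h, h1, rfl⟩
    refine ⟨?_, h1⟩
    simp only [castT, Prod.ext_iff]
    exact ⟨(key _ _).2 ⟨_, rfl⟩, (key _ _).2 ⟨_, rfl⟩, (key _ _).2 ⟨_, rfl⟩⟩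

lemma tendsto_per {s : Set (ℝ × ℝ × ℝ)} (hs : Bornology.IsBounded s) (hsm : MeasurableSet s)
    (hfr : volume (frontier s) = 0) {q c : ℕ} (hq : 0 < q) {D : Set (ℤ × ℤ × ℤ)}
    (hD : IsPer D q c) :
    Tendsto (fun M : ℝ => ({g | g ∈ D ∧ scalePt M g ∈ s}.ncard : ℝ) / M ^ 3) atTop
      (𝓝 ((volume s).toReal * (c / q ^ 3))) := by
  classical
  obtain ⟨A, hA, rfl⟩ := hD
  have h1 := tendsto_finsetSum A (fun a _ => tendsto_lat hs hsm hfr hq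
    ((a.1.val : ℤ), (a.2.1.val : ℤ), (a.2.2.val : ℤ)))
  simp only [Finset.sum_const, nsmul_eq_mul] at h1
  have e : (A.card : ℝ) * ((volume s).toReal / q ^ 3) = (volume s).toReal * (A.card / q ^ 3) := by
    ring
  rw [e] at h1
  refine h1.congr' ?_
  filter_upwards [eventually_gt_atTop 0] with M hM
  rw [← Finset.sum_div]
  congr 1
  have hf : {g | g ∈ D ∧ scalePt M g ∈ s}.Finite :=
    (finite_scale hs hM).subset fun g hg => hg.2
  rw [Set.ncard_eq_toFinset_card _ hf,
    Finset.card_eq_sum_card_fiberwise (f := castT q) (t := A)]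
  · push_cast
    refine Finset.sum_congr rfl fun a ha => ?_
    rw [← ncard_fiber s M hq a, ← Set.ncard_coe_finset]
    congr 2
    ext g
    simp only [Finset.coe_filter, Set.Finite.mem_toFinset, Set.mem_ofPred_eq]
    constructor
    · rintro ⟨h1, h2⟩; exact ⟨⟨(hA g).2 (h1 ▸ ha), h2⟩, h1⟩
    · rintro ⟨⟨_, h2⟩, h1⟩; exact ⟨h1, h2⟩
  · intro g hg
    simp only [Set.Finite.coe_toFinset, Set.mem_ofPred_eq] at hg
    exact (hA g).1 hg.1

lemma IsPer.inter {D₁ D₂ : Set (ℤ × ℤ × ℤ)} {q₁ q₂ c₁ c₂ : ℕ} (hco : q₁.Coprime q₂)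
    (h₁ : IsPer D₁ q₁ c₁) (h₂ : IsPer D₂ q₂ c₂) : IsPer (D₁ ∩ D₂) (q₁ * q₂) (c₁ * c₂) := by
  classical
  obtain ⟨A, hA, rfl⟩ := h₁
  obtain ⟨B, hB, rfl⟩ := h₂
  let e := ZMod.chineseRemainder hco
  let E : (ZMod (q₁ * q₂) × ZMod (q₁ * q₂) × ZMod (q₁ * q₂)) ≃
      (ZMod q₁ × ZMod q₁ × ZMod q₁) × (ZMod q₂ × ZMod q₂ × ZMod q₂) :=
    { toFun := fun x => (((e x.1).1, (e x.2.1).1, (e x.2.2).1), ((e x.1).2, (e x.2.1).2, (e x.2.2).2))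
      invFun := fun y => (e.symm (y.1.1, y.2.1), e.symm (y.1.2.1, y.2.2.1), e.symm (y.1.2.2, y.2.2.2))
      left_inv := fun x => by simp
      right_inv := fun y => by simp }
  refine ⟨(A ×ˢ B).map E.symm.toEmbedding, fun g => ?_, by simp⟩
  have : E (castT (q₁ * q₂) g) = (castT q₁ g, castT q₂ g) := by
    simp [E, castT]
  rw [Finset.mem_map_equiv, Equiv.symm_symm, this, Finset.mem_product, ← hA, ← hB]
  rfl

/-- The congruence condition modulo 4. -/
def class4 : Set (ℤ × ℤ × ℤ) := {g | (g.1 ≡ 1 [ZMOD 4] ∧ g.2.1 ≡ 1 [ZMOD 4] ∧ g.2.2 ≡ 1 [ZMOD 4]) ∨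
             (g.1 ≡ 3 [ZMOD 4] ∧ g.2.1 ≡ 3 [ZMOD 4] ∧ g.2.2 ≡ 3 [ZMOD 4])}

lemma isPer_class4 : IsPer class4 4 2 := by
  refine ⟨{(1, 1, 1), (3, 3, 3)}, fun g => ?_, by decide⟩
  have h : ∀ a b : ℤ, a ≡ b [ZMOD 4] ↔ (a : ZMod 4) = (b : ZMod 4) := fun a b =>
    (ZMod.intCast_eq_intCast_iff a b 4).symm
  simp only [class4, Set.mem_ofPred_eq, h, castT, Finset.mem_insert, Finset.mem_singleton,
    Prod.mk.injEq]
  norm_num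

/-- The local condition at `p`. -/
def locGood (p : ℕ) : Set (ℤ × ℤ × ℤ) :=
  {g | (¬ (p : ℤ) ^ 2 ∣ g.1 ∧ ¬ (p : ℤ) ^ 2 ∣ g.2.1 ∧ ¬ (p : ℤ) ^ 2 ∣ g.2.2) ∧
    ¬ ((p : ℤ) ∣ g.1 ∧ (p : ℤ) ∣ g.2.1) ∧ ¬ ((p : ℤ) ∣ g.1 ∧ (p : ℤ) ∣ g.2.2) ∧
    ¬ ((p : ℤ) ∣ g.2.1 ∧ (p : ℤ) ∣ g.2.2)}

lemma locGood_logic (a b c a' b' c' : Prop) (ha : a' → a) (hb : b' → b) (hc : c' → c) :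
    ((¬ a' ∧ ¬ b' ∧ ¬ c') ∧ ¬ (a ∧ b) ∧ ¬ (a ∧ c) ∧ ¬ (b ∧ c)) ↔
      ((¬ a ∧ ¬ b ∧ ¬ c) ∨ ((a ∧ ¬ a') ∧ ¬ b ∧ ¬ c)) ∨
      ((¬ a ∧ (b ∧ ¬ b') ∧ ¬ c) ∨ (¬ a ∧ ¬ b ∧ (c ∧ ¬ c'))) := by
  by_cases h1 : a <;> by_cases h2 : b <;> by_cases h3 : c <;> simp only [h1, h2, h3] at * <;> simp_all

lemma isPer_locGood {p : ℕ} (hp : p.Prime) :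
    IsPer (locGood p) (p ^ 2) ((p * (p - 1)) ^ 3 + 3 * ((p * (p - 1)) ^ 2 * (p - 1))) := by
  classical
  have : NeZero (p ^ 2) := ⟨by have := hp.pos; positivity⟩
  let U : Finset (ZMod (p ^ 2)) := Finset.univ.filter IsUnit
  let V : Finset (ZMod (p ^ 2)) := Finset.univ.filter fun x => ¬ IsUnit x ∧ x ≠ 0
  have hU : U.card = p * (p - 1) := by
    have h1 : Fintype.card (ZMod (p ^ 2))ˣ = p * (p - 1) := by
      rw [ZMod.card_units_eq_totient, Nat.totient_prime_pow hp (by norm_num)]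
      norm_num
    rw [← h1, ← Finset.card_univ, ← Finset.card_map ⟨Units.val, Units.val_injective⟩]
    congr 1
    ext x
    simp [U, IsUnit]
  have h01 : ¬ IsUnit (0 : ZMod (p ^ 2)) := by
    have : Fact (1 < p ^ 2) := ⟨by have := hp.one_lt; nlinarith⟩
    exact not_isUnit_zero
  have hV : V.card = p - 1 := by
    have h1 : U.card + (V.card + 1) = p ^ 2 := by
      have h2 : (Finset.univ.filter fun x : ZMod (p ^ 2) => ¬ IsUnit x) = insert 0 V := by
        ext x
        simp only [V, Finset.mem_filter, Finset.mem_univ, true_and, Finset.mem_insert]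
        by_cases hx : x = 0
        · simp [hx, h01]
        · simp [hx]
      have h3 : (0 : ZMod (p ^ 2)) ∉ V := by simp [V]
      rw [← Finset.card_insert_of_notMem h3, ← h2, Finset.card_filter_add_card_filter_not]
      simp
    rw [hU] at h1
    obtain ⟨k, rfl⟩ : ∃ k, p = k + 1 := ⟨p - 1, by have := hp.pos; omega⟩
    simp only [Nat.add_sub_cancel] at h1 ⊢
    nlinarith
  have hu : ∀ g : ℤ, (g : ZMod (p ^ 2)) ∈ U ↔ ¬ (p : ℤ) ∣ g := by
    intro g
    simp only [U, Finset.mem_filter, Finset.mem_univ, true_and]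
    rw [ZMod.coe_int_isUnit_iff_isCoprime]
    push_cast
    rw [IsCoprime.pow_left_iff (by norm_num)]
    exact (Nat.prime_iff_prime_int.1 hp).coprime_iff_not_dvd
  have hz : ∀ g : ℤ, (g : ZMod (p ^ 2)) = 0 ↔ (p : ℤ) ^ 2 ∣ g := by
    intro g
    rw [ZMod.intCast_zmod_eq_zero_iff_dvd]; push_cast; rfl
  have hv : ∀ g : ℤ, (g : ZMod (p ^ 2)) ∈ V ↔ (p : ℤ) ∣ g ∧ ¬ (p : ℤ) ^ 2 ∣ g := by
    intro g
    have := hu g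
    simp only [U, V, Finset.mem_filter, Finset.mem_univ, true_and] at this ⊢
    rw [this, not_not, Ne, hz]
  have hUV : ∀ x, x ∈ U → x ∉ V := by
    intro x hx hx'
    simp only [U, V, Finset.mem_filter, Finset.mem_univ, true_and] at hx hx'
    exact hx'.1 hx
  refine ⟨((U ×ˢ U ×ˢ U) ∪ (V ×ˢ U ×ˢ U)) ∪ ((U ×ˢ V ×ˢ U) ∪ (U ×ˢ U ×ˢ V)), fun g => ?_, ?_⟩
  · simp only [castT, Finset.mem_union, Finset.mem_product, hu, hv, locGood, Set.mem_ofPred_eq]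
    have d : ∀ g : ℤ, (p : ℤ) ^ 2 ∣ g → (p : ℤ) ∣ g := fun g h => (dvd_pow_self _ (by norm_num)).trans h
    exact locGood_logic _ _ _ _ _ _ (d g.1) (d g.2.1) (d g.2.2)
  · rw [Finset.card_union_of_disjoint, Finset.card_union_of_disjoint,
      Finset.card_union_of_disjoint]
    · simp only [Finset.card_product, hU, hV]; ring
    all_goals
      clear hU hV hu hv h01 hz
      clear_value U V
      rw [Finset.disjoint_left]
      rintro ⟨x, y, z⟩ h1 h2
      simp only [Finset.mem_union, Finset.mem_product] at h1 h2
      have hx := hUV x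
      have hy := hUV y
      have hz := hUV z
      tauto

/-- Odd primes. -/
abbrev OddPrime := {p : ℕ // p.Prime ∧ Odd p}

/-- Local density. -/
noncomputable def locDens (p : ℕ) : ℝ :=
  1 - 6 / (p : ℝ) ^ 2 + 8 / (p : ℝ) ^ 3 - 3 / (p : ℝ) ^ 4

lemma exists_isPer (W : Finset OddPrime) :
    ∃ q c : ℕ, 0 < q ∧ IsPer (class4 ∩ {g | ∀ p ∈ W, g ∈ locGood p.1}) q c ∧
      (c : ℝ) / q ^ 3 = 1 / 32 * ∏ p ∈ W, locDens p.1 := by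
  classical
  suffices H : ∃ q c : ℕ, 0 < q ∧ (∀ p : OddPrime, p ∉ W → p.1.Coprime q) ∧
      IsPer (class4 ∩ {g | ∀ p ∈ W, g ∈ locGood p.1}) q c ∧
      (c : ℝ) / q ^ 3 = 1 / 32 * ∏ p ∈ W, locDens p.1 by
    obtain ⟨q, c, h1, _, h2⟩ := H
    exact ⟨q, c, h1, h2⟩
  induction W using Finset.induction_on with
  | empty =>
    refine ⟨4, 2, by norm_num, fun p _ => ?_, by simpa using isPer_class4, by norm_num⟩
    have : p.1.Coprime 2 := Nat.coprime_two_right.2 p.2.2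
    exact this.mul_right this
  | insert p W hpW ih =>
    obtain ⟨q, c, hq, hco, hper, hd⟩ := ih
    have hp := p.2.1
    refine ⟨q * p.1 ^ 2, c * ((p.1 * (p.1 - 1)) ^ 3 + 3 * ((p.1 * (p.1 - 1)) ^ 2 * (p.1 - 1))),
      ?_, ?_, ?_, ?_⟩
    · have := hp.pos; positivity
    · intro r hr
      simp only [Finset.mem_insert, not_or] at hr
      refine (hco r hr.2).mul_right (Nat.Coprime.pow_right _ ?_)
      exact (Nat.coprime_primes r.2.1 hp).2 fun h => hr.1 (Subtype.ext h)
    · have := hper.inter ((hco p hpW).symm.pow_right 2) (isPer_locGood hp)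
      convert this using 1
      ext g
      simp only [Finset.mem_insert, forall_eq_or_imp, Set.mem_inter_iff, Set.mem_ofPred_eq]
      tauto
    · rw [Finset.prod_insert hpW]
      have hp0 : (p.1 : ℝ) ≠ 0 := by exact_mod_cast hp.ne_zero
      have hq0 : (q : ℝ) ≠ 0 := by exact_mod_cast hq.ne'
      have hl : (((p.1 * (p.1 - 1)) ^ 3 + 3 * ((p.1 * (p.1 - 1)) ^ 2 * (p.1 - 1)) : ℕ) : ℝ) /
          ((p.1 : ℝ) ^ 2) ^ 3 = locDens p.1 := by
        push_cast [Nat.cast_sub hp.one_lt.le]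
        unfold locDens
        field_simp
        ring
      rw [mul_left_comm (1 / 32 : ℝ), ← hd, ← hl]
      push_cast
      field_simp

/-- The positive part of `R(1, r₁, r₂)`. -/
def posReg (r₁ r₂ : ℝ) : Set (ℝ × ℝ × ℝ) :=
  {g | (0 < g.1 ∧ 0 < g.2.1 ∧ 0 < g.2.2) ∧ g.1 * g.2.1 * g.2.2 < 1 ∧
    r₁ ≤ g.2.2 / g.1 ∧ g.2.2 / g.1 ≤ g.2.2 / g.2.1 ∧ g.2.2 / g.2.1 < r₂}

lemma ms_and {p q : ℝ × ℝ × ℝ → Prop} (hp : MeasurableSet {g | p g}) (hq : MeasurableSet {g | q g}) :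
    MeasurableSet {g | p g ∧ q g} := hp.inter hq

lemma measurableSet_posReg (r₁ r₂ : ℝ) : MeasurableSet (posReg r₁ r₂) := by
  unfold posReg
  refine ms_and (ms_and ?_ (ms_and ?_ ?_)) (ms_and ?_ (ms_and ?_ (ms_and ?_ ?_)))
  all_goals first
    | exact measurableSet_lt (by fun_prop) (by fun_prop)
    | exact measurableSet_le (by fun_prop) (by fun_prop)

lemma lintegral_exp_subst (G : ℝ → ENNReal) (hG : ∀ x ≤ 0, G x = 0) :
    ∫⁻ x, G x = ∫⁻ a, ENNReal.ofReal (Real.exp a) * G (Real.exp a) := by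
  have h1 := lintegral_image_eq_lintegral_abs_deriv_mul (s := Set.univ) MeasurableSet.univ
    (fun x _ => (Real.hasDerivAt_exp x).hasDerivWithinAt) Real.exp_injective.injOn G
  simp only [Set.image_univ, Real.range_exp, Measure.restrict_univ, Real.abs_exp] at h1
  rw [← h1, ← lintegral_indicator measurableSet_Ioi]
  congr 1
  ext x
  by_cases hx : 0 < x
  · simp [hx]
  · simp [hx, hG x (not_lt.1 hx)]

lemma lintegral_shear (H : ℝ → ℝ → ℝ → ENNReal)
    (hH : Measurable fun p : ℝ × ℝ × ℝ => H p.1 p.2.1 p.2.2) :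
    ∫⁻ a, ∫⁻ b, ∫⁻ c, H a b c = ∫⁻ a, ∫⁻ b, ∫⁻ c, H (c - a) (c - b) c := by
  have perm : ∀ K : ℝ → ℝ → ℝ → ENNReal, (Measurable fun p : ℝ × ℝ × ℝ => K p.1 p.2.1 p.2.2) →
      ∫⁻ a, ∫⁻ b, ∫⁻ c, K a b c = ∫⁻ c, ∫⁻ a, ∫⁻ b, K a b c := by
    intro K hK
    have e1 : ∫⁻ a, ∫⁻ b, ∫⁻ c, K a b c = ∫⁻ a, ∫⁻ c, ∫⁻ b, K a b c := by
      refine lintegral_congr fun a => ?_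
      refine lintegral_lintegral_swap (Measurable.aemeasurable ?_)
      exact hK.comp (by fun_prop : Measurable fun q : ℝ × ℝ => (a, q.1, q.2))
    rw [e1]
    refine lintegral_lintegral_swap (Measurable.aemeasurable ?_)
    have : Measurable fun w : (ℝ × ℝ) × ℝ => K w.1.1 w.2 w.1.2 :=
      hK.comp (by fun_prop : Measurable fun w : (ℝ × ℝ) × ℝ => (w.1.1, w.2, w.1.2))
    exact this.lintegral_prod_right'
  rw [perm H hH, perm (fun a b c => H (c - a) (c - b) c)]
  · refine lintegral_congr fun c => ?_
    rw [← lintegral_sub_left_eq_self (fun a => ∫⁻ b, H a b c) c]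
    refine lintegral_congr fun a => ?_
    rw [← lintegral_sub_left_eq_self (fun b => H (c - a) b c) c]
  · exact hH.comp (by fun_prop : Measurable fun w : ℝ × ℝ × ℝ => (w.2.2 - w.1, w.2.2 - w.2.1, w.2.2))

lemma lintegral_exp_c (a b : ℝ) :
    ∫⁻ c in Set.Iio ((a + b) / 3), ENNReal.ofReal (Real.exp (3 * c - a - b)) =
      ENNReal.ofReal (1 / 3) := by
  rw [setLIntegral_congr Iio_ae_eq_Iic]
  have e : ∀ c, Real.exp (3 * c - a - b) = Real.exp (- a - b) * Real.exp (3 * c) := by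
    intro c; rw [← Real.exp_add]; congr 1; ring
  simp only [e]
  rw [← ofReal_integral_eq_lintegral_ofReal
    ((integrableOn_exp_mul_Iic (by norm_num) _).const_mul _)
    (Eventually.of_forall fun c => by positivity)]
  rw [integral_const_mul, integral_exp_mul_Iic (by norm_num), ← mul_div_assoc, ← Real.exp_add]
  congr 2
  rw [show -a - b + 3 * ((a + b) / 3) = 0 by ring, Real.exp_zero]

lemma lintegral_triangle {l₁ l₂ : ℝ} (h : l₁ ≤ l₂) :
    ∫⁻ a in Set.Ici l₁, ∫⁻ _ in Set.Ico a l₂, ENNReal.ofReal (1 / 3) =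
      ENNReal.ofReal ((l₂ - l₁) ^ 2 / 6) := by
  simp only [lintegral_const, Measure.restrict_apply MeasurableSet.univ, Set.univ_inter,
    Real.volume_Ico]
  have e : ∫⁻ a in Set.Ici l₁, ENNReal.ofReal (1 / 3) * ENNReal.ofReal (l₂ - a) =
      ∫⁻ a in Set.Icc l₁ l₂, ENNReal.ofReal (1 / 3 * (l₂ - a)) := by
    rw [← lintegral_indicator measurableSet_Ici, ← lintegral_indicator measurableSet_Icc]
    refine lintegral_congr fun a => ?_
    simp only [Set.indicator_apply, Set.mem_Ici, Set.mem_Icc]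
    rw [← ENNReal.ofReal_mul (by norm_num)]
    by_cases h1 : l₁ ≤ a
    · by_cases h2 : a ≤ l₂
      · simp [h1, h2]
      · simp only [h1, h2, and_false, if_true, if_false]
        exact ENNReal.ofReal_of_nonpos (by linarith)
    · simp [h1]
  rw [e, setLIntegral_congr Ioc_ae_eq_Icc.symm, ← ofReal_integral_eq_lintegral_ofReal]
  · congr 1
    rw [← intervalIntegral.integral_of_le h]
    simp only [intervalIntegral.integral_const_mul]
    rw [intervalIntegral.integral_sub (by simp) (by simp)]
    simp
    ring
  · have : Continuous fun a : ℝ => 1 / 3 * (l₂ - a) := by fun_prop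
    exact this.integrableOn_Ioc
  · filter_upwards [ae_restrict_mem measurableSet_Ioc] with a ha
    have := ha.2
    simp only [Pi.zero_apply]
    linarith

lemma posReg_exp {r₁ r₂ : ℝ} (h₁ : 0 < r₁) (h : r₁ < r₂) (a b c : ℝ) :
    (Real.exp (c - a), Real.exp (c - b), Real.exp c) ∈ posReg r₁ r₂ ↔
      Real.log r₁ ≤ a ∧ (a ≤ b ∧ b < Real.log r₂) ∧ c < (a + b) / 3 := by
  have h₂ := h₁.trans h
  have p1 : Real.exp c / Real.exp (c - a) = Real.exp a := by
    rw [← Real.exp_sub]; congr 1; ring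
  have p2 : Real.exp c / Real.exp (c - b) = Real.exp b := by
    rw [← Real.exp_sub]; congr 1; ring
  have p3 : Real.exp (c - a) * Real.exp (c - b) * Real.exp c = Real.exp (3 * c - a - b) := by
    rw [← Real.exp_add, ← Real.exp_add]; congr 1; ring
  simp only [posReg, Set.mem_ofPred_eq, p1, p2, p3, Real.exp_pos, true_and, Real.exp_le_exp,
    Real.exp_lt_one_iff, Real.log_le_iff_le_exp h₁, Real.lt_log_iff_exp_lt h₂]
  constructor
  · rintro ⟨q1, q2, q3, q4⟩; exact ⟨q2, ⟨q3, q4⟩, by linarith⟩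
  · rintro ⟨q1, ⟨q2, q3⟩, q4⟩; exact ⟨by linarith, q1, q2, q3⟩

lemma volume_posReg {r₁ r₂ : ℝ} (h₁ : 0 < r₁) (h : r₁ < r₂) :
    volume (posReg r₁ r₂) = ENNReal.ofReal ((Real.log r₂ - Real.log r₁) ^ 2 / 6) := by
  have hm := measurableSet_posReg r₁ r₂
  let f : ℝ × ℝ × ℝ → ENNReal := (posReg r₁ r₂).indicator 1
  have hf : Measurable f := measurable_one.indicator hm
  have f0 : ∀ x y z : ℝ, (x ≤ 0 ∨ y ≤ 0 ∨ z ≤ 0) → f (x, y, z) = 0 := by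
    intro x y z hxyz
    refine Set.indicator_of_notMem ?_ _
    rintro ⟨⟨q1, q2, q3⟩, _⟩
    simp only at q1 q2 q3
    rcases hxyz with h | h | h <;> linarith
  have e1 : volume (posReg r₁ r₂) = ∫⁻ x, ∫⁻ y, ∫⁻ z, f (x, y, z) := by
    rw [← lintegral_indicator_one hm, Measure.volume_eq_prod, lintegral_prod _ hf.aemeasurable]
    refine lintegral_congr fun x => ?_
    rw [Measure.volume_eq_prod, lintegral_prod]
    exact (hf.comp (by fun_prop : Measurable fun q : ℝ × ℝ => (x, q))).aemeasurable
  let H : ℝ → ℝ → ℝ → ENNReal := fun a b c => ENNReal.ofReal (Real.exp (a + b + c)) *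
    f (Real.exp a, Real.exp b, Real.exp c)
  have hH : Measurable fun p : ℝ × ℝ × ℝ => H p.1 p.2.1 p.2.2 := by
    refine Measurable.mul (by fun_prop) ?_
    exact hf.comp (by fun_prop)
  have e2 : ∫⁻ x, ∫⁻ y, ∫⁻ z, f (x, y, z) = ∫⁻ a, ∫⁻ b, ∫⁻ c, H a b c := by
    rw [lintegral_exp_subst]
    · refine lintegral_congr fun a => ?_
      rw [lintegral_exp_subst, ← lintegral_const_mul' _ _ ENNReal.ofReal_ne_top]
      · refine lintegral_congr fun b => ?_
        rw [lintegral_exp_subst, ← lintegral_const_mul' _ _ ENNReal.ofReal_ne_top,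
          ← lintegral_const_mul' _ _ ENNReal.ofReal_ne_top]
        · refine lintegral_congr fun c => ?_
          simp only [H]
          rw [Real.exp_add, Real.exp_add, ENNReal.ofReal_mul (by positivity),
            ENNReal.ofReal_mul (by positivity)]
          ring
        · intro z hz; exact f0 _ _ _ (by simp [hz])
      · intro y hy; simp [f0 _ y _ (by simp [hy])]
    · intro x hx; simp [f0 x _ _ (by simp [hx])]
  have h0 : ∀ a b c, ¬ (Real.log r₁ ≤ a ∧ (a ≤ b ∧ b < Real.log r₂) ∧ c < (a + b) / 3) →
      H (c - a) (c - b) c = 0 := by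
    intro a b c hn
    rw [← posReg_exp h₁ h] at hn
    simp only [H, f]
    rw [Set.indicator_of_notMem hn, mul_zero]
  have h1 : ∀ a b c, (Real.log r₁ ≤ a ∧ (a ≤ b ∧ b < Real.log r₂) ∧ c < (a + b) / 3) →
      H (c - a) (c - b) c = ENNReal.ofReal (Real.exp (3 * c - a - b)) := by
    intro a b c hn
    rw [← posReg_exp h₁ h] at hn
    simp only [H, f]
    rw [Set.indicator_of_mem hn, Pi.one_apply, mul_one]
    congr 2; ring
  rw [e1, e2, lintegral_shear H hH, ← lintegral_triangle (Real.log_le_log h₁ h.le),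
    ← lintegral_indicator measurableSet_Ici]
  refine lintegral_congr fun a => ?_
  by_cases ha : Real.log r₁ ≤ a
  · rw [Set.indicator_of_mem (by simpa using ha), ← lintegral_indicator measurableSet_Ico]
    refine lintegral_congr fun b => ?_
    by_cases hb : a ≤ b ∧ b < Real.log r₂
    · rw [Set.indicator_of_mem (by simpa using hb), ← lintegral_exp_c a b,
        ← lintegral_indicator measurableSet_Iio]
      refine lintegral_congr fun c => ?_
      by_cases hc : c < (a + b) / 3
      · rw [Set.indicator_of_mem (by simpa using hc), h1 a b c ⟨ha, hb, hc⟩]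
      · rw [Set.indicator_of_notMem (by simpa using hc), h0 a b c fun hn => hc hn.2.2]
    · rw [Set.indicator_of_notMem (by simpa using hb)]
      simp [fun c => h0 a b c fun hn => hb hn.2.1]
  · rw [Set.indicator_of_notMem (by simpa using ha)]
    simp [fun b c => h0 a b c fun hn => ha hn.1]

/-- The part of `R(1, r₁, r₂)` with at most one negative coordinate. -/
def regS (r₁ r₂ : ℝ) : Set (ℝ × ℝ × ℝ) :=
  {g | g ∈ regionR 1 r₁ r₂ ∧ ¬(g.1 < 0 ∧ g.2.1 < 0) ∧ ¬(g.1 < 0 ∧ g.2.2 < 0) ∧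
    ¬(g.2.1 < 0 ∧ g.2.2 < 0)}

lemma mem_regionR_one (r₁ r₂ x y z : ℝ) :
    (x, y, z) ∈ regionR 1 r₁ r₂ ↔ (|x|, |y|, |z|) ∈ posReg r₁ r₂ := by
  simp only [regionR, posReg, Set.mem_ofPred_eq, abs_mul, abs_div, abs_pos, ne_eq, mul_eq_zero,
    not_or, and_assoc]

lemma scale_mem_regS {M : ℝ} (hM : 0 < M) (r₁ r₂ : ℝ) (g : ℤ × ℤ × ℤ) :
    scalePt M g ∈ regS r₁ r₂ ↔ ((g.1 : ℝ), (g.2.1 : ℝ), (g.2.2 : ℝ)) ∈ regionR (M ^ 3) r₁ r₂ ∧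
      ¬(g.1 < 0 ∧ g.2.1 < 0) ∧ ¬(g.1 < 0 ∧ g.2.2 < 0) ∧ ¬(g.2.1 < 0 ∧ g.2.2 < 0) := by
  obtain ⟨x, y, z⟩ := g
  have hs : ∀ n : ℤ, (n : ℝ) / M < 0 ↔ n < 0 := by
    intro n
    rw [div_lt_iff₀ hM, zero_mul]; norm_cast
  have e1 : (x : ℝ) / M * (y / M) * (z / M) = x * y * z / M ^ 3 := by field_simp
  have e2 : ∀ a b : ℝ, (a / M) / (b / M) = a / b := fun a b => div_div_div_cancel_right₀ hM.ne' a b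
  have hM3 : (0 : ℝ) < M ^ 3 := by positivity
  simp only [scalePt, regS, regionR, Set.mem_ofPred_eq, hs, e1, e2]
  rw [abs_div, abs_of_pos hM3, div_lt_one hM3]
  simp [hM.ne']

lemma regS_bound {r₁ r₂ : ℝ} (h₁ : 0 < r₁) (h : r₁ < r₂) :
    ∃ C : ℝ, 1 ≤ C ∧ ∀ g ∈ regS r₁ r₂, |g.1| ≤ C ∧ |g.2.1| ≤ C ∧ |g.2.2| ≤ C := by
  have h₂ := h₁.trans h
  have hi : 0 < 1 / r₁ := by positivity
  refine ⟨(1 + r₂) * (1 + 1 / r₁), by nlinarith, ?_⟩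
  rintro ⟨x, y, z⟩ ⟨hg, -⟩
  rw [mem_regionR_one] at hg
  simp only [posReg, Set.mem_ofPred_eq] at hg ⊢
  generalize |x| = x at *
  generalize |y| = y at *
  generalize |z| = z at *
  obtain ⟨⟨hx, hy, hz⟩, hp, q1, q2, q3⟩ := hg
  rw [le_div_iff₀ hx] at q1
  rw [div_lt_iff₀ hy] at q3
  have q2' : y ≤ x := by
    rw [div_le_div_iff₀ hx hy] at q2
    exact le_of_mul_le_mul_left q2 hz
  have hz1 : z ≤ 1 + r₂ := by
    by_contra hcon
    push Not at hcon
    have hy1 : 1 < y := by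
      by_contra hc
      push Not at hc
      nlinarith
    nlinarith [mul_lt_mul'' hy1 (hy1.trans_le q2') (by norm_num) (by norm_num),
      mul_pos hx hy]
  have hx1 : x ≤ (1 + r₂) * (1 / r₁) := by
    rw [mul_one_div, le_div_iff₀ h₁]
    linarith
  refine ⟨?_, ?_, ?_⟩ <;> nlinarith

lemma bounded_regS {r₁ r₂ : ℝ} (h₁ : 0 < r₁) (h : r₁ < r₂) :
    Bornology.IsBounded (regS r₁ r₂) := by
  obtain ⟨C, -, hC⟩ := regS_bound h₁ h
  refine (Metric.isBounded_closedBall (x := (0 : ℝ × ℝ × ℝ)) (r := C)).subset fun g hg => ?_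
  rw [mem_closedBall_zero_iff, Prod.norm_def, Prod.norm_def]
  simp only [max_le_iff, Real.norm_eq_abs]
  exact hC g hg

/-- Sign changes of the coordinates. -/
def flip1 (g : ℝ × ℝ × ℝ) : ℝ × ℝ × ℝ := (-g.1, g.2.1, g.2.2)
/-- Sign changes of the coordinates. -/
def flip2 (g : ℝ × ℝ × ℝ) : ℝ × ℝ × ℝ := (g.1, -g.2.1, g.2.2)
/-- Sign changes of the coordinates. -/
def flip3 (g : ℝ × ℝ × ℝ) : ℝ × ℝ × ℝ := (g.1, g.2.1, -g.2.2)

lemma mp_flip1 : MeasurePreserving flip1 volume volume :=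
  (Measure.measurePreserving_neg (volume : Measure ℝ)).prod (MeasurePreserving.id (volume : Measure (ℝ × ℝ)))
lemma mp_flip2 : MeasurePreserving flip2 volume volume :=
  (MeasurePreserving.id (volume : Measure ℝ)).prod
    ((Measure.measurePreserving_neg (volume : Measure ℝ)).prod (MeasurePreserving.id (volume : Measure ℝ)))
lemma mp_flip3 : MeasurePreserving flip3 volume volume :=
  (MeasurePreserving.id (volume : Measure ℝ)).prod
    ((MeasurePreserving.id (volume : Measure ℝ)).prod (Measure.measurePreserving_neg (volume : Measure ℝ)))

lemma regS_eq (r₁ r₂ : ℝ) : regS r₁ r₂ =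
    (posReg r₁ r₂ ∪ flip1 ⁻¹' posReg r₁ r₂) ∪ (flip2 ⁻¹' posReg r₁ r₂ ∪ flip3 ⁻¹' posReg r₁ r₂) := by
  ext ⟨x, y, z⟩
  have hpos : ∀ {x y z : ℝ}, (x, y, z) ∈ posReg r₁ r₂ → 0 < x ∧ 0 < y ∧ 0 < z := fun h => h.1
  simp only [Set.mem_union, Set.mem_preimage, flip1, flip2, flip3]
  constructor
  · rintro ⟨h1, h2, h3, h4⟩
    rw [mem_regionR_one] at h1
    have h5 := hpos h1
    simp only [abs_pos] at h5
    simp only at h2 h3 h4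
    rcases lt_or_gt_of_ne h5.1 with hx | hx <;> rcases lt_or_gt_of_ne h5.2.1 with hy | hy <;>
      rcases lt_or_gt_of_ne h5.2.2 with hz | hz <;>
      simp only [hx, hy, hz, abs_of_neg, abs_of_pos, true_and, not_true_eq_false] at h1 h2 h3 h4
    all_goals simp only [h1, true_or, or_true]
  · intro hh
    rcases hh with (hh | hh) | (hh | hh) <;> obtain ⟨hx, hy, hz⟩ := hpos hh
    · refine ⟨?_, ?_, ?_, ?_⟩
      · rw [mem_regionR_one, abs_of_pos hx, abs_of_pos hy, abs_of_pos hz]; exact hh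
      all_goals simp only; rintro ⟨_, _⟩; linarith
    · refine ⟨?_, ?_, ?_, ?_⟩
      · rw [mem_regionR_one, ← abs_neg x, abs_of_pos hx, abs_of_pos hy, abs_of_pos hz]; exact hh
      all_goals simp only; rintro ⟨_, _⟩; linarith
    · refine ⟨?_, ?_, ?_, ?_⟩
      · rw [mem_regionR_one, ← abs_neg y, abs_of_pos hx, abs_of_pos hy, abs_of_pos hz]; exact hh
      all_goals simp only; rintro ⟨_, _⟩; linarith
    · refine ⟨?_, ?_, ?_, ?_⟩
      · rw [mem_regionR_one, ← abs_neg z, abs_of_pos hx, abs_of_pos hy, abs_of_pos hz]; exact hh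
      all_goals simp only; rintro ⟨_, _⟩; linarith

lemma measurableSet_regS (r₁ r₂ : ℝ) : MeasurableSet (regS r₁ r₂) := by
  have := measurableSet_posReg r₁ r₂
  rw [regS_eq]
  exact (this.union (mp_flip1.measurable this)).union
    ((mp_flip2.measurable this).union (mp_flip3.measurable this))

lemma volume_regS {r₁ r₂ : ℝ} (h₁ : 0 < r₁) (h : r₁ < r₂) :
    (volume (regS r₁ r₂)).toReal = 2 / 3 * (Real.log r₂ - Real.log r₁) ^ 2 := by
  have hm := measurableSet_posReg r₁ r₂
  have hpos : ∀ {x y z : ℝ}, (x, y, z) ∈ posReg r₁ r₂ → 0 < x ∧ 0 < y ∧ 0 < z := fun h => h.1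
  rw [regS_eq, measure_union, measure_union, measure_union,
    mp_flip1.measure_preimage hm.nullMeasurableSet, mp_flip2.measure_preimage hm.nullMeasurableSet,
    mp_flip3.measure_preimage hm.nullMeasurableSet, volume_posReg h₁ h]
  · rw [← ENNReal.ofReal_add (by positivity) (by positivity),
      ← ENNReal.ofReal_add (by positivity) (by positivity), ENNReal.toReal_ofReal (by positivity)]
    ring
  · rw [Set.disjoint_left]
    rintro ⟨x, y, z⟩ ha hb
    have ha' := hpos ha
    have hb' := hpos hb
    simp only at ha' hb'
    linarith [ha'.1, ha'.2.1, ha'.2.2, hb'.1, hb'.2.1, hb'.2.2]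
  · exact mp_flip3.measurable hm
  · rw [Set.disjoint_left]
    rintro ⟨x, y, z⟩ ha hb
    have ha' := hpos ha
    have hb' := hpos hb
    simp only at ha' hb'
    linarith [ha'.1, ha'.2.1, ha'.2.2, hb'.1, hb'.2.1, hb'.2.2]
  · exact mp_flip1.measurable hm
  · rw [Set.disjoint_left]
    rintro ⟨x, y, z⟩ (ha | ha) (hb | hb) <;>
    · have ha' := hpos ha
      have hb' := hpos hb
      simp only at ha' hb'
      linarith [ha'.1, ha'.2.1, ha'.2.2, hb'.1, hb'.2.1, hb'.2.2]
  · exact (mp_flip2.measurable hm).union (mp_flip3.measurable hm)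

lemma ev_lt {f₁ f₂ : ℝ × ℝ × ℝ → ℝ} {g : ℝ × ℝ × ℝ} (c₁ : ContinuousAt f₁ g)
    (c₂ : ContinuousAt f₂ g) (hne : f₁ g ≠ f₂ g) :
    ∀ᶠ g' in 𝓝 g, (f₁ g' < f₂ g' ↔ f₁ g < f₂ g) := by
  rcases lt_or_gt_of_ne hne with h | h
  · filter_upwards [c₁.eventually_lt c₂ h] with g' h'
    simp [h, h']
  · filter_upwards [c₂.eventually_lt c₁ h] with g' h'
    exact ⟨fun q => absurd h' q.not_gt, fun q => absurd h q.not_gt⟩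

lemma notMem_frontier_regS (r₁ r₂ : ℝ) {g : ℝ × ℝ × ℝ} (hx : g.1 ≠ 0) (hy : g.2.1 ≠ 0)
    (hz : g.2.2 ≠ 0) (hp : |g.1 * g.2.1 * g.2.2| ≠ 1) (h1 : |g.2.2 / g.1| ≠ r₁)
    (h2 : |g.2.2 / g.2.1| ≠ |g.2.2 / g.1|) (h3 : |g.2.2 / g.2.1| ≠ r₂) :
    g ∉ frontier (regS r₁ r₂) := by
  have cx : ContinuousAt (fun g : ℝ × ℝ × ℝ => g.1) g := by fun_prop
  have cy : ContinuousAt (fun g : ℝ × ℝ × ℝ => g.2.1) g := by fun_prop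
  have cz : ContinuousAt (fun g : ℝ × ℝ × ℝ => g.2.2) g := by fun_prop
  have c1 : ContinuousAt (fun g : ℝ × ℝ × ℝ => |g.2.2 / g.1|) g := (cz.div cx hx).abs
  have c2 : ContinuousAt (fun g : ℝ × ℝ × ℝ => |g.2.2 / g.2.1|) g := (cz.div cy hy).abs
  have cp : ContinuousAt (fun g : ℝ × ℝ × ℝ => |g.1 * g.2.1 * g.2.2|) g := by fun_prop
  have key : ∀ᶠ g' in 𝓝 g, (g' ∈ regS r₁ r₂ ↔ g ∈ regS r₁ r₂) := by
    filter_upwards [cx.eventually_ne hx, cy.eventually_ne hy, cz.eventually_ne hz,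
      ev_lt cx continuousAt_const hx, ev_lt cy continuousAt_const hy,
      ev_lt cz continuousAt_const hz, ev_lt cp continuousAt_const hp,
      ev_lt c1 continuousAt_const h1, ev_lt c2 c1 h2, ev_lt c2 continuousAt_const h3]
      with g' k1 k2 k3 k4 k5 k6 k7 k8 k9 k10
    simp only [regS, regionR, Set.mem_ofPred_eq, k4, k5, k6, k7, k10, ne_eq, mul_eq_zero, k1, k2,
      k3, hx, hy, hz, or_self, not_false_eq_true, true_and]
    have k8' := not_congr k8
    have k9' := not_congr k9
    rw [not_lt, not_lt] at k8' k9'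
    rw [k8', k9']
  by_cases hg : g ∈ regS r₁ r₂
  · intro hfr
    refine hfr.2 (mem_interior_iff_mem_nhds.2 ?_)
    filter_upwards [key] with g' h'
    exact h'.2 hg
  · intro hfr
    obtain ⟨g', h1, h2⟩ := (mem_closure_iff_frequently.1 hfr.1 |>.and_eventually key).exists
    exact hg (h2.1 h1)

lemma frontier_regS {r₁ r₂ : ℝ} : volume (frontier (regS r₁ r₂)) = 0 := by
  have hm : MeasurableSet (frontier (regS r₁ r₂)) := isClosed_frontier.measurableSet
  rw [Measure.volume_eq_prod, Measure.measure_prod_null hm]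
  have hne : ∀ a : ℝ, ∀ᵐ x : ℝ, x ≠ a := fun a => by simp [ae_iff]
  filter_upwards [hne 0] with x hx
  rw [Measure.volume_eq_prod, Pi.zero_apply, Measure.measure_prod_null (measurable_prodMk_left hm)]
  filter_upwards [hne 0, hne x, hne (-x)] with y hy hy1 hy2
  rw [Pi.zero_apply]
  refine measure_mono_null (t := {0, 1 / (x * y), -(1 / (x * y)), r₁ * x, -(r₁ * x), r₂ * y,
    -(r₂ * y)}) ?_ (Set.Finite.measure_zero (Set.toFinite _) _)
  intro z hz
  by_contra hcon
  simp only [Set.mem_insert_iff, Set.mem_singleton_iff, not_or] at hcon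
  obtain ⟨n0, n1, n2, n3, n4, n5, n6⟩ := hcon
  refine notMem_frontier_regS r₁ r₂ (g := (x, y, z)) hx hy n0 ?_ ?_ ?_ ?_ hz
  · intro hh
    simp only at hh
    rcases eq_or_eq_neg_of_abs_eq hh with e | e
    · exact n1 (by field_simp; linarith)
    · exact n2 (by field_simp; linarith)
  · intro hh
    simp only at hh
    rcases eq_or_eq_neg_of_abs_eq hh with e | e <;> rw [div_eq_iff hx] at e
    · exact n3 e
    · exact n4 (by linarith)
  · intro hh
    simp only [abs_div] at hh
    have ax := abs_pos.2 hx
    have ay := abs_pos.2 hy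
    have az := abs_pos.2 n0
    rw [div_eq_div_iff ay.ne' ax.ne'] at hh
    have := mul_left_cancel₀ az.ne' hh
    rcases abs_eq_abs.1 this.symm with e | e
    · exact hy1 e
    · exact hy2 e
  · intro hh
    simp only at hh
    rcases eq_or_eq_neg_of_abs_eq hh with e | e <;> rw [div_eq_iff hy] at e
    · exact n5 e
    · exact n6 (by linarith)

/-- Nonzero multiples of `d` of absolute value at most `X`. -/
def multSet (X : ℝ) (d : ℕ) : Set ℤ := {n | n ≠ 0 ∧ (d : ℤ) ∣ n ∧ |(n : ℝ)| ≤ X}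

lemma multSet_card {X : ℝ} (hX : 0 ≤ X) {d : ℕ} (hd : 0 < d) :
    (multSet X d).Finite ∧ ((multSet X d).ncard : ℝ) ≤ 2 * X / d := by
  have hd' : (0 : ℝ) < d := by exact_mod_cast hd
  let K : ℤ := ⌊X / d⌋
  have hK : 0 ≤ K := Int.floor_nonneg.2 (by positivity)
  let F : Finset ℤ := ((Finset.Icc (-K) K).erase 0).image fun m => (d : ℤ) * m
  have hsub : multSet X d ⊆ (F : Set ℤ) := by
    rintro n ⟨h0, ⟨m, rfl⟩, hn⟩
    simp only [F, Finset.coe_image, Set.mem_image, Finset.mem_coe, Finset.mem_erase, Finset.mem_Icc]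
    refine ⟨m, ⟨?_, ?_⟩, rfl⟩
    · rintro rfl; simp at h0
    · rw [← abs_le]
      refine Int.le_floor.2 ?_
      rw [le_div_iff₀ hd']
      push_cast at hn ⊢
      rw [abs_mul, abs_of_pos hd'] at hn
      linarith
  refine ⟨F.finite_toSet.subset hsub, ?_⟩
  have h1 : (multSet X d).ncard ≤ F.card := by
    rw [← Set.ncard_coe_finset]
    exact Set.ncard_le_ncard hsub F.finite_toSet
  have h2 : F.card ≤ ((Finset.Icc (-K) K).erase 0).card := Finset.card_image_le
  have h3 : (((Finset.Icc (-K) K).erase 0).card : ℤ) = 2 * K := by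
    rw [Finset.card_erase_of_mem (by simp [hK]), Int.card_Icc]
    omega
  have h4 : ((multSet X d).ncard : ℤ) ≤ 2 * K := by
    rw [← h3]; exact_mod_cast h1.trans h2
  have h5 : ((multSet X d).ncard : ℝ) ≤ 2 * (K : ℝ) := by exact_mod_cast h4
  have h6 : (K : ℝ) ≤ X / d := Int.floor_le _
  rw [mul_div_assoc]
  linarith

/-- Points of a box with nonzero coordinates which fail the local condition at `p`. -/
def badSet (X : ℝ) (p : ℕ) : Set (ℤ × ℤ × ℤ) :=
  {g | (g.1 ≠ 0 ∧ g.2.1 ≠ 0 ∧ g.2.2 ≠ 0) ∧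
    (|(g.1 : ℝ)| ≤ X ∧ |(g.2.1 : ℝ)| ≤ X ∧ |(g.2.2 : ℝ)| ≤ X) ∧ g ∉ locGood p}

lemma prod3_card {X : ℝ} (hX : 0 ≤ X) {a b c : ℕ} (ha : 0 < a) (hb : 0 < b) (hc : 0 < c) :
    (multSet X a ×ˢ multSet X b ×ˢ multSet X c).Finite ∧
    ((multSet X a ×ˢ multSet X b ×ˢ multSet X c).ncard : ℝ) ≤ 8 * X ^ 3 / (a * b * c) := by
  obtain ⟨fa, ca⟩ := multSet_card hX ha
  obtain ⟨fb, cb⟩ := multSet_card hX hb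
  obtain ⟨fc, cc⟩ := multSet_card hX hc
  refine ⟨fa.prod (fb.prod fc), ?_⟩
  rw [Set.ncard_prod, Set.ncard_prod]
  push_cast
  calc _ ≤ (2 * X / a) * ((2 * X / b) * (2 * X / c)) := by gcongr
    _ = _ := by field_simp; ring

lemma badSet_card {X : ℝ} (hX : 0 ≤ X) {p : ℕ} (hp : 0 < p) :
    (badSet X p).Finite ∧ ((badSet X p).ncard : ℝ) ≤ 48 * X ^ 3 / p ^ 2 := by
  have hp2 : 0 < p ^ 2 := by positivity
  obtain ⟨f1, c1⟩ := prod3_card hX hp2 one_pos one_pos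
  obtain ⟨f2, c2⟩ := prod3_card hX one_pos hp2 one_pos
  obtain ⟨f3, c3⟩ := prod3_card hX one_pos one_pos hp2
  obtain ⟨f4, c4⟩ := prod3_card hX hp hp one_pos
  obtain ⟨f5, c5⟩ := prod3_card hX hp one_pos hp
  obtain ⟨f6, c6⟩ := prod3_card hX one_pos hp hp
  have hsub : badSet X p ⊆
    (multSet X (p ^ 2) ×ˢ multSet X 1 ×ˢ multSet X 1) ∪
    ((multSet X 1 ×ˢ multSet X (p ^ 2) ×ˢ multSet X 1) ∪
    ((multSet X 1 ×ˢ multSet X 1 ×ˢ multSet X (p ^ 2)) ∪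
    ((multSet X p ×ˢ multSet X p ×ˢ multSet X 1) ∪
    ((multSet X p ×ˢ multSet X 1 ×ˢ multSet X p) ∪
    (multSet X 1 ×ˢ multSet X p ×ˢ multSet X p))))) := by
    rintro ⟨x, y, z⟩ ⟨⟨hx, hy, hz⟩, ⟨bx, bz, bw⟩, hg⟩
    simp only [Set.mem_union, Set.mem_prod, multSet, Set.mem_ofPred_eq, hx, hy, hz, bx, bz, bw,
      ne_eq, not_false_eq_true, true_and, and_true, Nat.cast_one, isUnit_one, IsUnit.dvd,
      Nat.cast_pow]
    simp only [locGood, Set.mem_ofPred_eq] at hg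
    by_contra hcon
    apply hg
    push Not at hcon ⊢
    obtain ⟨q1, q2, q3, q4, q5, q6⟩ := hcon
    exact ⟨⟨q1, q2, q3⟩, q4, q5, q6⟩
  have hfin := f1.union (f2.union (f3.union (f4.union (f5.union f6))))
  refine ⟨hfin.subset hsub, ?_⟩
  have hle := Set.ncard_le_ncard hsub hfin
  have u1 := Set.ncard_union_le (multSet X (p ^ 2) ×ˢ multSet X 1 ×ˢ multSet X 1)
    ((multSet X 1 ×ˢ multSet X (p ^ 2) ×ˢ multSet X 1) ∪
    ((multSet X 1 ×ˢ multSet X 1 ×ˢ multSet X (p ^ 2)) ∪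
    ((multSet X p ×ˢ multSet X p ×ˢ multSet X 1) ∪
    ((multSet X p ×ˢ multSet X 1 ×ˢ multSet X p) ∪
    (multSet X 1 ×ˢ multSet X p ×ˢ multSet X p)))))
  have u2 := Set.ncard_union_le (multSet X 1 ×ˢ multSet X (p ^ 2) ×ˢ multSet X 1)
    ((multSet X 1 ×ˢ multSet X 1 ×ˢ multSet X (p ^ 2)) ∪
    ((multSet X p ×ˢ multSet X p ×ˢ multSet X 1) ∪
    ((multSet X p ×ˢ multSet X 1 ×ˢ multSet X p) ∪
    (multSet X 1 ×ˢ multSet X p ×ˢ multSet X p))))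
  have u3 := Set.ncard_union_le (multSet X 1 ×ˢ multSet X 1 ×ˢ multSet X (p ^ 2))
    ((multSet X p ×ˢ multSet X p ×ˢ multSet X 1) ∪
    ((multSet X p ×ˢ multSet X 1 ×ˢ multSet X p) ∪
    (multSet X 1 ×ˢ multSet X p ×ˢ multSet X p)))
  have u4 := Set.ncard_union_le (multSet X p ×ˢ multSet X p ×ˢ multSet X 1)
    ((multSet X p ×ˢ multSet X 1 ×ˢ multSet X p) ∪
    (multSet X 1 ×ˢ multSet X p ×ˢ multSet X p))
  have u5 := Set.ncard_union_le (multSet X p ×ˢ multSet X 1 ×ˢ multSet X p)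
    (multSet X 1 ×ˢ multSet X p ×ˢ multSet X p)
  have hle2 := hle.trans (u1.trans (Nat.add_le_add_left (u2.trans (Nat.add_le_add_left
    (u3.trans (Nat.add_le_add_left (u4.trans (Nat.add_le_add_left u5 _)) _)) _)) _))
  have hle3 : ((badSet X p).ncard : ℝ) ≤ _ := Nat.cast_le.2 hle2
  push_cast at hle3 c1 c2 c3 c4 c5 c6
  have e : 48 * X ^ 3 / (p : ℝ) ^ 2 = 6 * (8 * X ^ 3 / p ^ 2) := by ring
  have e2 : (p : ℝ) * p = p ^ 2 := by ring
  simp only [mul_one, one_mul, e2] at c1 c2 c3 c4 c5 c6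
  rw [e]
  linarith

lemma summable_oddPrime : Summable fun p : OddPrime => 1 / (p.1 : ℝ) ^ 2 :=
  (Real.summable_one_div_nat_pow.2 (by norm_num)).comp_injective Subtype.val_injective

lemma tail_card {X : ℝ} (hX : 0 ≤ X) (W : Finset OddPrime) {T : Set (ℤ × ℤ × ℤ)} (hT : T.Finite)
    (hsub : T ⊆ ⋃ p : {p : OddPrime // p ∉ W}, badSet X p.1.1) :
    (T.ncard : ℝ) ≤ 48 * X ^ 3 * ∑' p : {p : OddPrime // p ∉ W}, 1 / (p.1.1 : ℝ) ^ 2 := by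
  have hs : Summable fun p : {p : OddPrime // p ∉ W} => 1 / (p.1.1 : ℝ) ^ 2 :=
    summable_oddPrime.comp_injective Subtype.val_injective
  have h1 : (Measure.count T) ≤ ∑' p : {p : OddPrime // p ∉ W}, Measure.count (badSet X p.1.1) :=
    (measure_mono hsub).trans (measure_iUnion_le _)
  have hc : ∀ S : Set (ℤ × ℤ × ℤ), S.Finite → Measure.count S = ENNReal.ofReal S.ncard := by
    intro S hS
    rw [Measure.count_apply_finite S hS, Set.ncard_eq_toFinset_card _ hS, ENNReal.ofReal_natCast]
  have h2 : ∑' p : {p : OddPrime // p ∉ W}, Measure.count (badSet X p.1.1) ≤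
      ∑' p : {p : OddPrime // p ∉ W}, ENNReal.ofReal (48 * X ^ 3 * (1 / (p.1.1 : ℝ) ^ 2)) := by
    refine ENNReal.tsum_le_tsum fun p => ?_
    obtain ⟨f, c⟩ := badSet_card hX p.1.2.1.pos
    rw [hc _ f, mul_one_div]
    exact ENNReal.ofReal_le_ofReal c
  rw [← ENNReal.ofReal_tsum_of_nonneg (fun p => by positivity) (hs.mul_left _), tsum_mul_left] at h2
  rw [hc T hT] at h1
  refine (ENNReal.ofReal_le_ofReal_iff ?_).1 (h1.trans h2)
  exact mul_nonneg (by positivity) (tsum_nonneg fun p => by positivity)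

lemma class4_odd {g : ℤ × ℤ × ℤ} (hg : g ∈ class4) :
    ¬ (2 : ℤ) ∣ g.1 ∧ ¬ (2 : ℤ) ∣ g.2.1 ∧ ¬ (2 : ℤ) ∣ g.2.2 := by
  simp only [class4, Set.mem_ofPred_eq, Int.ModEq] at hg
  omega

lemma good_iff {g : ℤ × ℤ × ℤ} (hg : g ∈ class4) :
    (Squarefree g.1 ∧ Squarefree g.2.1 ∧ Squarefree g.2.2 ∧
      Int.gcd g.1 g.2.1 = 1 ∧ Int.gcd g.1 g.2.2 = 1 ∧ Int.gcd g.2.1 g.2.2 = 1) ↔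
    ∀ p : OddPrime, g ∈ locGood p.1 := by
  obtain ⟨o1, o2, o3⟩ := class4_odd hg
  have hodd : ∀ {n : ℤ} {p : ℕ}, p.Prime → ¬ (2 : ℤ) ∣ n → (p : ℤ) ∣ n → Odd p := by
    intro n p hp hn hd
    rcases hp.eq_two_or_odd' with h | h
    · subst h; exact absurd hd hn
    · exact h
  constructor
  · rintro ⟨s1, s2, s3, g1, g2, g3⟩ p
    have hnu : ¬ IsUnit (p.1 : ℤ) := (Nat.prime_iff_prime_int.1 p.2.1).not_isUnit
    have hsq : ∀ {n : ℤ}, Squarefree n → ¬ (p.1 : ℤ) ^ 2 ∣ n := fun hs hd =>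
      hnu (hs _ (by rwa [← pow_two]))
    have hgc : ∀ {m n : ℤ}, Int.gcd m n = 1 → ¬ ((p.1 : ℤ) ∣ m ∧ (p.1 : ℤ) ∣ n) := by
      rintro m n hmn ⟨hm, hn⟩
      have := Int.dvd_coe_gcd hm hn
      rw [hmn] at this
      exact hnu (isUnit_of_dvd_one (by simpa using this))
    exact ⟨⟨hsq s1, hsq s2, hsq s3⟩, hgc g1, hgc g2, hgc g3⟩
  · intro h
    have hsq : ∀ {n : ℤ}, ¬ (2 : ℤ) ∣ n → (∀ p : OddPrime, ¬ (p.1 : ℤ) ^ 2 ∣ n) → Squarefree n := by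
      intro n hn hp
      rw [← Int.squarefree_natAbs, Nat.squarefree_iff_prime_squarefree]
      intro q hq hd
      have hd' : (q : ℤ) ^ 2 ∣ n := by
        rw [pow_two]
        have := Int.natCast_dvd.2 hd
        exact_mod_cast this
      exact hp ⟨q, hq, hodd hq hn ((dvd_pow_self _ (by norm_num)).trans hd')⟩ hd'
    have hgc : ∀ {m n : ℤ}, ¬ (2 : ℤ) ∣ m → (∀ p : OddPrime, ¬ ((p.1 : ℤ) ∣ m ∧ (p.1 : ℤ) ∣ n)) →
        Int.gcd m n = 1 := by
      intro m n hm hp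
      by_contra hne
      obtain ⟨q, hq, hd⟩ := Nat.exists_prime_and_dvd hne
      have hd' : (q : ℤ) ∣ (Int.gcd m n : ℤ) := by exact_mod_cast hd
      have h1 := hd'.trans (Int.gcd_dvd_left m n)
      have h2 := hd'.trans (Int.gcd_dvd_right m n)
      exact hp ⟨q, hq, hodd hq hm h1⟩ ⟨h1, h2⟩
    exact ⟨hsq o1 fun p => (h p).1.1, hsq o2 fun p => (h p).1.2.1, hsq o3 fun p => (h p).1.2.2,
      hgc o1 fun p => (h p).2.1, hgc o1 fun p => (h p).2.2.1, hgc o2 fun p => (h p).2.2.2⟩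

lemma multipliable_locDens : Multipliable fun p : OddPrime => locDens p.1 := by
  have hs : Summable fun p : OddPrime =>
      (- 6 / (p.1 : ℝ) ^ 2 + 8 / (p.1 : ℝ) ^ 3 - 3 / (p.1 : ℝ) ^ 4) := by
    have hk : ∀ k : ℕ, 1 < k → ∀ c : ℝ, Summable fun p : OddPrime => c / (p.1 : ℝ) ^ k := by
      intro k hk c
      have := ((Real.summable_one_div_nat_pow.2 hk).comp_injective
        (Subtype.val_injective : Function.Injective (Subtype.val : OddPrime → ℕ))).mul_left c
      refine this.congr fun p => ?_
      simp [div_eq_mul_inv]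
    exact ((hk 2 (by norm_num) _).add (hk 3 (by norm_num) _)).sub (hk 4 (by norm_num) _)
  have := Real.multipliable_one_add_of_summable hs
  refine this.congr fun p => ?_
  unfold locDens
  ring

/-- The set being counted, scaled. -/
def goodSet (M r₁ r₂ : ℝ) : Set (ℤ × ℤ × ℤ) :=
  {g | (g ∈ class4 ∧ ∀ p : OddPrime, g ∈ locGood p.1) ∧ scalePt M g ∈ regS r₁ r₂}

/-- The sieved set with finitely many local conditions. -/
def sieveSet (W : Finset OddPrime) (M r₁ r₂ : ℝ) : Set (ℤ × ℤ × ℤ) :=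
  {g | g ∈ class4 ∩ {g | ∀ p ∈ W, g ∈ locGood p.1} ∧ scalePt M g ∈ regS r₁ r₂}

lemma good_le_sieve {r₁ r₂ : ℝ} (h₁ : 0 < r₁) (h : r₁ < r₂) :
    ∃ K : ℝ, ∀ W : Finset OddPrime, ∀ M : ℝ, 0 < M →
      |((goodSet M r₁ r₂).ncard : ℝ) - (sieveSet W M r₁ r₂).ncard| ≤
        K * M ^ 3 * ∑' p : {p : OddPrime // p ∉ W}, 1 / (p.1.1 : ℝ) ^ 2 := by
  obtain ⟨C, hC1, hC⟩ := regS_bound h₁ h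
  refine ⟨48 * C ^ 3, fun W M hM => ?_⟩
  have hfin : (sieveSet W M r₁ r₂).Finite :=
    (finite_scale (bounded_regS h₁ h) hM).subset fun g hg => hg.2
  have hsub : goodSet M r₁ r₂ ⊆ sieveSet W M r₁ r₂ := by
    rintro g ⟨⟨q1, q2⟩, q3⟩
    exact ⟨⟨q1, fun p _ => q2 p⟩, q3⟩
  have hdiff := Set.ncard_sdiff_add_ncard_of_subset hsub hfin
  have hT : (sieveSet W M r₁ r₂ \ goodSet M r₁ r₂) ⊆
      ⋃ p : {p : OddPrime // p ∉ W}, badSet (C * M) p.1.1 := by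
    rintro g ⟨⟨⟨k1, k2⟩, k3⟩, k4⟩
    have : ∃ p : OddPrime, g ∉ locGood p.1 := by
      by_contra hcon
      push Not at hcon
      exact k4 ⟨⟨k1, hcon⟩, k3⟩
    obtain ⟨p, hp⟩ := this
    refine Set.mem_iUnion.2 ⟨⟨p, fun hpW => hp (k2 p hpW)⟩, ?_, ?_, hp⟩
    · obtain ⟨o1, o2, o3⟩ := class4_odd k1
      refine ⟨?_, ?_, ?_⟩
      · intro h0; rw [h0] at o1; simp at o1
      · intro h0; rw [h0] at o2; simp at o2
      · intro h0; rw [h0] at o3; simp at o3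
    · have := hC _ k3
      simp only [scalePt, abs_div, abs_of_pos hM, div_le_iff₀ hM] at this
      exact this
  have := tail_card (by positivity) W (hfin.subset Set.sdiff_subset) hT
  have e : ((goodSet M r₁ r₂).ncard : ℝ) - (sieveSet W M r₁ r₂).ncard =
      - ((sieveSet W M r₁ r₂ \ goodSet M r₁ r₂).ncard : ℝ) := by
    rw [← hdiff]; push_cast; ring
  rw [e, abs_neg, abs_of_nonneg (by positivity)]
  calc _ ≤ _ := this
    _ = _ := by ring

lemma tendsto_sieve {r₁ r₂ : ℝ} (h₁ : 0 < r₁) (h : r₁ < r₂) (W : Finset OddPrime) :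
    Tendsto (fun M : ℝ => ((sieveSet W M r₁ r₂).ncard : ℝ) / M ^ 3) atTop
      (𝓝 (1 / 48 * (∏ p ∈ W, locDens p.1) * (Real.log r₂ - Real.log r₁) ^ 2)) := by
  obtain ⟨q, c, hq, hper, hd⟩ := exists_isPer W
  have := tendsto_per (bounded_regS h₁ h) (measurableSet_regS r₁ r₂) frontier_regS hq hper
  rw [hd, volume_regS h₁ h] at this
  have e : 1 / 48 * (∏ p ∈ W, locDens p.1) * (Real.log r₂ - Real.log r₁) ^ 2 =
      2 / 3 * (Real.log r₂ - Real.log r₁) ^ 2 * (1 / 32 * ∏ p ∈ W, locDens p.1) := by ring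
  rw [e]
  exact this

lemma tendsto_good {r₁ r₂ : ℝ} (h₁ : 0 < r₁) (h : r₁ < r₂) :
    Tendsto (fun M : ℝ => ((goodSet M r₁ r₂).ncard : ℝ) / M ^ 3) atTop
      (𝓝 (1 / 48 * (∏' p : OddPrime, locDens p.1) * (Real.log r₂ - Real.log r₁) ^ 2)) := by
  obtain ⟨K, hK⟩ := good_le_sieve h₁ h
  set L := (Real.log r₂ - Real.log r₁) ^ 2
  have t1 : Tendsto (fun W : Finset OddPrime => 1 / 48 * (∏ p ∈ W, locDens p.1) * L) atTop
      (𝓝 (1 / 48 * (∏' p : OddPrime, locDens p.1) * L)) :=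
    (multipliable_locDens.hasProd.const_mul (1 / 48)).mul_const L
  have t2 : Tendsto (fun W : Finset OddPrime =>
      K * ∑' p : {p : OddPrime // p ∉ W}, 1 / (p.1.1 : ℝ) ^ 2) atTop (𝓝 0) := by
    have := (tendsto_tsum_compl_atTop_zero fun p : OddPrime => 1 / (p.1 : ℝ) ^ 2).const_mul K
    simpa using this
  rw [Metric.tendsto_nhds]
  intro ε hε
  have ε3 : 0 < ε / 3 := by positivity
  obtain ⟨W, w1, w2⟩ := ((Metric.tendsto_nhds.1 t1 _ ε3).and (Metric.tendsto_nhds.1 t2 _ ε3)).exists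
  filter_upwards [Metric.tendsto_nhds.1 (tendsto_sieve h₁ h W) _ ε3, eventually_gt_atTop 0]
    with M hM hM0
  have hM3 : (0 : ℝ) < M ^ 3 := by positivity
  have w3 : dist (((goodSet M r₁ r₂).ncard : ℝ) / M ^ 3) (((sieveSet W M r₁ r₂).ncard : ℝ) / M ^ 3)
      < ε / 3 := by
    rw [Real.dist_eq, ← sub_div, abs_div, abs_of_pos hM3, div_lt_iff₀ hM3]
    rw [Real.dist_eq, sub_zero] at w2
    have := hK W M hM0
    have := le_abs_self (K * ∑' p : {p : OddPrime // p ∉ W}, 1 / (p.1.1 : ℝ) ^ 2)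
    nlinarith
  have d1 := dist_triangle (((goodSet M r₁ r₂).ncard : ℝ) / M ^ 3)
    (((sieveSet W M r₁ r₂).ncard : ℝ) / M ^ 3) (1 / 48 * (∏' p : OddPrime, locDens p.1) * L)
  have d2 := dist_triangle (((sieveSet W M r₁ r₂).ncard : ℝ) / M ^ 3)
    (1 / 48 * (∏ p ∈ W, locDens p.1) * L) (1 / 48 * (∏' p : OddPrime, locDens p.1) * L)
  linarith

theorem stmt4 (r₁ r₂ : ℝ) (hr₁ : 0 < r₁) (hr : r₁ < r₂) :
    (fun N : ℝ =>
        (Nat.card {g : ℤ × ℤ × ℤ //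
            ((g.1 : ℝ), (g.2.1 : ℝ), (g.2.2 : ℝ)) ∈ regionR N r₁ r₂ ∧
            Squarefree g.1 ∧ Squarefree g.2.1 ∧ Squarefree g.2.2 ∧
            Int.gcd g.1 g.2.1 = 1 ∧ Int.gcd g.1 g.2.2 = 1 ∧ Int.gcd g.2.1 g.2.2 = 1 ∧
            ¬(g.1 < 0 ∧ g.2.1 < 0) ∧ ¬(g.1 < 0 ∧ g.2.2 < 0) ∧ ¬(g.2.1 < 0 ∧ g.2.2 < 0) ∧
            ((g.1 ≡ 1 [ZMOD 4] ∧ g.2.1 ≡ 1 [ZMOD 4] ∧ g.2.2 ≡ 1 [ZMOD 4]) ∨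
             (g.1 ≡ 3 [ZMOD 4] ∧ g.2.1 ≡ 3 [ZMOD 4] ∧ g.2.2 ≡ 3 [ZMOD 4]))} : ℝ) -
          1 / 48 *
            (∏' p : {p : ℕ // p.Prime ∧ Odd p},
              (1 - 6 / (p.1 : ℝ) ^ 2 + 8 / (p.1 : ℝ) ^ 3 - 3 / (p.1 : ℝ) ^ 4)) *
            N * (Real.log r₂ - Real.log r₁) ^ 2)
      =o[atTop] fun N : ℝ => N := by
  have hlim := (tendsto_good hr₁ hr).comp (tendsto_rpow_atTop (by norm_num : (0 : ℝ) < 1 / 3))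
  rw [isLittleO_iff_tendsto' (by
    filter_upwards [eventually_gt_atTop 0] with N hN h0
    exact absurd h0 hN.ne')]
  have hlim0 := hlim.sub_const
    (1 / 48 * (∏' p : OddPrime, locDens p.1) * (Real.log r₂ - Real.log r₁) ^ 2)
  rw [sub_self] at hlim0
  refine hlim0.congr' ?_
  filter_upwards [eventually_gt_atTop 0] with N hN
  have hM : (0 : ℝ) < N ^ (1 / 3 : ℝ) := by positivity
  have hM3 : (N ^ (1 / 3 : ℝ)) ^ 3 = N := by
    rw [← Real.rpow_natCast, ← Real.rpow_mul hN.le]; norm_num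
  simp only [Function.comp]
  rw [hM3, sub_div]
  congr 1
  · congr 2
    rw [← Nat.card_coe_set_eq]
    refine Nat.card_congr (Equiv.subtypeEquivRight fun g => ?_)
    have key := scale_mem_regS hM r₁ r₂ g
    rw [hM3] at key
    simp only [goodSet, Set.mem_ofPred_eq]
    rw [key]
    constructor
    · rintro ⟨⟨q1, q2⟩, q3, q4, q5, q6⟩
      obtain ⟨a1, a2, a3, a4, a5, a6⟩ := (good_iff q1).2 q2
      exact ⟨q3, a1, a2, a3, a4, a5, a6, q4, q5, q6, q1⟩
    · rintro ⟨q3, a1, a2, a3, a4, a5, a6, q4, q5, q6, q1⟩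
      exact ⟨⟨q1, (good_iff q1).1 ⟨a1, a2, a3, a4, a5, a6⟩⟩, q3, q4, q5, q6⟩
  · simp only [locDens]
    field_simp
end
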